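/- Let a > 0, ℓ ∈ {1,…,n}, ρ > 2, and f ∈ BMO(ℝⁿ). Then the variation of the doubly truncated Riesz transforms is finite almost everywhere: V_ρ(R^ε_{ℓ,a})(f)(x) < ∞ for a.e. x ∈ ℝⁿ. -/

import Mathlib

open MeasureTheory Filter Set
open scoped ENNReal

noncomputable section

/-- A strictly decreasing sequence of positive reals converging to zero. -/
def NullSeq (t : ℕ → ℝ) : Prop :=
  StrictAnti t ∧ (∀ j, 0 < t j) ∧ Tendsto t atTop (nhds 0)

/-- The `ρ`-variation seminorm `‖F‖_{E_ρ}`: the supremum, over all strictly decreasing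
null sequences `{t_j}`, of `(∑_j |F(t_j) - F(t_{j+1})|^ρ)^{1/ρ}` (valued in `ℝ≥0∞`). -/
def eVar (ρ : ℝ) (F : ℝ → ℝ) : ℝ≥0∞ :=
  ⨆ t : {t : ℕ → ℝ // NullSeq t},
    (∑' j : ℕ, ENNReal.ofReal (|F (t.1 j) - F (t.1 (j + 1))| ^ ρ)) ^ (1 / ρ)

/-- The average of `f` over a set `s` (with respect to Lebesgue measure). -/
def avgOn {n : ℕ} (f : EuclideanSpace ℝ (Fin n) → ℝ) (s : Set (EuclideanSpace ℝ (Fin n))) : ℝ :=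
  ((volume s).toReal)⁻¹ * ∫ y in s, f y

/-- `f` has BMO norm at most `M`: the mean oscillation of `f` over every ball is `≤ M`. -/
def IsBMOWith {n : ℕ} (f : EuclideanSpace ℝ (Fin n) → ℝ) (M : ℝ) : Prop :=
  ∀ (x₀ : EuclideanSpace ℝ (Fin n)) (r : ℝ), 0 < r →
    ((volume (Metric.ball x₀ r)).toReal)⁻¹ *
      ∫ y in Metric.ball x₀ r, |f y - avgOn f (Metric.ball x₀ r)| ≤ M

/-- The doubly truncated Riesz transform in direction `ℓ`:
`R^ε_{ℓ,a}(f)(x) = ∫_{ε<|x-y|<a} (x_ℓ - y_ℓ)/|x-y|^{n+1} f(y) dy`. -/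
def truncRiesz (n : ℕ) (ℓ : Fin n) (a ε : ℝ) (f : EuclideanSpace ℝ (Fin n) → ℝ)
    (x : EuclideanSpace ℝ (Fin n)) : ℝ :=
  ∫ y in {y : EuclideanSpace ℝ (Fin n) | ε < ‖x - y‖ ∧ ‖x - y‖ < a},
    (x ℓ - y ℓ) / ‖x - y‖ ^ (n + 1) * f y

namespace VR

/-- greedy anchors and number of jumps of size at least `lam` -/
def anch (lam : ℝ) (G : ℕ → ℝ) : ℕ → ℝ × ℕ
  | 0 => (G 0, 0)
  | k + 1 => if lam ≤ |G (k + 1) - (anch lam G k).1| then (G (k + 1), (anch lam G k).2 + 1)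
      else anch lam G k

lemma anch_close {lam : ℝ} (hl : 0 < lam) (G : ℕ → ℝ) (k : ℕ) :
    |G k - (anch lam G k).1| < lam := by
  induction k with
  | zero => simpa [anch] using hl
  | succ k ih =>
    rw [anch]
    split_ifs with h
    · simpa using hl
    · exact not_le.mp h

lemma anch_mono (lam : ℝ) (G : ℕ → ℝ) : Monotone (fun k => (anch lam G k).2) := by
  apply monotone_nat_of_le_succ
  intro k
  rw [anch]
  split_ifs with h <;> simp

lemma anch_const (lam : ℝ) (G : ℕ → ℝ) {p q : ℕ} (hpq : p ≤ q)
    (h : (anch lam G q).2 = (anch lam G p).2) : (anch lam G q).1 = (anch lam G p).1 := by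
  induction q, hpq using Nat.le_induction with
  | base => rfl
  | succ q hq ih =>
    have h1 := anch_mono lam G hq
    simp only at h1
    rw [anch] at h ⊢
    split_ifs at h ⊢ with hh
    · simp only at h
      omega
    · exact ih h

lemma anch_jump {lam : ℝ} (hl : 0 < lam) (G : ℕ → ℝ) {p q : ℕ} (hpq : p ≤ q)
    (h : 2 * lam ≤ |G p - G q|) : (anch lam G p).2 + 1 ≤ (anch lam G q).2 := by
  by_contra hcon
  have h1 := anch_mono lam G hpq
  simp only at h1
  have h2 : (anch lam G q).2 = (anch lam G p).2 := by omega
  have h3 := anch_const lam G hpq h2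
  have h4 := anch_close hl G p
  have h5 := anch_close hl G q
  rw [h3] at h5
  rw [abs_lt] at h4 h5
  rcases abs_cases (G p - G q) with ⟨h6, _⟩ | ⟨h6, _⟩ <;> linarith

lemma anch_le (lam : ℝ) (G : ℕ → ℝ) (k : ℕ) : (anch lam G k).2 ≤ k := by
  induction k with
  | zero => simp [anch]
  | succ k ih =>
    rw [anch]
    split_ifs with h
    · simpa using ih
    · omega

lemma count_jump {lam : ℝ} (hl : 0 < lam) (G : ℕ → ℝ) (Nb : ℝ≥0∞)
    (hN : ∀ k, ((anch lam G k).2 : ℝ≥0∞) ≤ Nb) (p : ℕ → ℕ) (hp : Monotone p) :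
    ∑' j, (if 2 * lam ≤ |G (p j) - G (p (j + 1))| then (1 : ℝ≥0∞) else 0) ≤ Nb := by
  rw [ENNReal.tsum_eq_iSup_nat]
  apply iSup_le
  intro J
  have : ∀ J : ℕ, (∑ j ∈ Finset.range J,
      (if 2 * lam ≤ |G (p j) - G (p (j + 1))| then 1 else 0 : ℕ)) ≤ (anch lam G (p J)).2 := by
    intro J
    induction J with
    | zero => simp
    | succ J ih =>
      rw [Finset.sum_range_succ]
      have hm : p J ≤ p (J + 1) := hp (Nat.le_succ J)
      split_ifs with h
      · have := anch_jump hl G hm h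
        omega
      · have := anch_mono lam G hm
        simp only at this
        omega
  refine le_trans ?_ (hN (p J))
  have h1 : ((∑ j ∈ Finset.range J,
      (if 2 * lam ≤ |G (p j) - G (p (j + 1))| then 1 else 0 : ℕ) : ℕ) : ℝ≥0∞)
      ≤ ((anch lam G (p J)).2 : ℝ≥0∞) := by exact_mod_cast this J
  refine le_trans (le_of_eq ?_) h1
  push_cast
  rfl

lemma bdd_of_jumps (G : ℕ → ℝ) (Nb : ℝ≥0∞) (hNb : Nb ≠ ⊤)
    (hN : ∀ k, ((anch 1 G k).2 : ℝ≥0∞) ≤ Nb) : ∃ D : ℝ, 0 ≤ D ∧ ∀ k l, |G k - G l| ≤ D := by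
  obtain ⟨B, hB⟩ : ∃ B : ℕ, ∀ k, (anch 1 G k).2 ≤ B := by
    obtain ⟨B, hB⟩ := ENNReal.exists_nat_gt hNb
    refine ⟨B, fun k => ?_⟩
    have := (hN k).trans hB.le
    exact_mod_cast this
  have hfin : ∃ K, ∀ k, K ≤ k → (anch 1 G k).2 = (anch 1 G K).2 := by
    obtain ⟨m, ⟨K, rfl⟩, hK⟩ : ∃ m ∈ range (fun k => (anch 1 G k).2),
        ∀ m' ∈ range (fun k => (anch 1 G k).2), m' ≤ m := by
      have hf : (range (fun k => (anch 1 G k).2)).Finite :=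
        (Set.finite_Iic B).subset (by rintro _ ⟨k, rfl⟩; exact hB k)
      exact Set.exists_max_image _ id hf (range_nonempty _)
    exact ⟨K, fun k hk => le_antisymm (hK _ ⟨k, rfl⟩) (anch_mono 1 G hk)⟩
  obtain ⟨K, hK⟩ := hfin
  have h1 : ∀ k, K ≤ k → |G k - (anch 1 G K).1| < 1 := fun k hk => by
    have := anch_close one_pos G k
    rwa [anch_const 1 G hk (hK k hk)] at this
  have h2 : ∀ k, |G k - (anch 1 G K).1| ≤
      1 + ∑ i ∈ Finset.range K, |G i - (anch 1 G K).1| := by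
    intro k
    have h0 : 0 ≤ ∑ i ∈ Finset.range K, |G i - (anch 1 G K).1| :=
      Finset.sum_nonneg fun _ _ => abs_nonneg _
    rcases le_or_gt K k with hk | hk
    · linarith [h1 k hk]
    · have := Finset.single_le_sum (f := fun i => |G i - (anch 1 G K).1|)
        (fun _ _ => abs_nonneg _) (Finset.mem_range.mpr hk)
      linarith
  set S := 1 + ∑ i ∈ Finset.range K, |G i - (anch 1 G K).1|
  have hS : 0 ≤ S := (abs_nonneg _).trans (h2 0)
  refine ⟨2 * S, by linarith, fun k l => ?_⟩
  have e1 := abs_le.mp (h2 k)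
  have e2 := abs_le.mp (h2 l)
  rw [abs_le]
  constructor <;> linarith [e1.1, e1.2, e2.1, e2.2]

/-- the variation of a sequence with controlled jump counts -/
lemma seq_var (ρ : ℝ) (hρ : 2 < ρ) (G : ℕ → ℝ) (Nb : ℕ → ℝ≥0∞)
    (hN : ∀ i k, ((anch ((1/2 : ℝ) ^ i) G k).2 : ℝ≥0∞) ≤ Nb i)
    (hsum : ∑' i, ENNReal.ofReal ((4 * (1/2 : ℝ) ^ i) ^ ρ) * Nb i ≠ ⊤) :
    ∃ C : ℝ≥0∞, C ≠ ⊤ ∧ ∀ p : ℕ → ℕ, Monotone p →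
      ∑' j, ENNReal.ofReal (|G (p j) - G (p (j + 1))| ^ ρ) ≤ C := by
  have hN0 : Nb 0 ≠ ⊤ := by
    have := ENNReal.ne_top_of_tsum_ne_top hsum 0
    intro h
    rw [h] at this
    apply this
    rw [ENNReal.mul_top]
    simp only [ne_eq, ENNReal.ofReal_eq_zero, not_le]
    positivity
  obtain ⟨D, hD0, hD⟩ := bdd_of_jumps G (Nb 0) hN0 (fun k => by simpa using hN 0 k)
  refine ⟨∑' i, ENNReal.ofReal ((4 * (1/2 : ℝ) ^ i) ^ ρ) * Nb i + ENNReal.ofReal (D ^ ρ) * Nb 0,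
    ENNReal.add_ne_top.mpr ⟨hsum, ENNReal.mul_ne_top ENNReal.ofReal_ne_top hN0⟩, ?_⟩
  intro p hp
  have key : ∀ j, ENNReal.ofReal (|G (p j) - G (p (j + 1))| ^ ρ) ≤
      ∑' i, ENNReal.ofReal ((4 * (1/2 : ℝ) ^ i) ^ ρ) *
        (if 2 * (1/2 : ℝ) ^ i ≤ |G (p j) - G (p (j + 1))| then (1 : ℝ≥0∞) else 0) +
      ENNReal.ofReal (D ^ ρ) *
        (if 2 * (1/2 : ℝ) ^ 0 ≤ |G (p j) - G (p (j + 1))| then (1 : ℝ≥0∞) else 0) := by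
    intro j
    have hd := hD (p j) (p (j + 1))
    set d := |G (p j) - G (p (j + 1))| with hdd
    have hd0 : 0 ≤ d := abs_nonneg _
    rcases le_or_gt 2 d with h2 | h2
    · refine le_trans ?_ le_add_self
      rw [if_pos (by simpa using h2), mul_one]
      exact ENNReal.ofReal_le_ofReal (Real.rpow_le_rpow hd0 hd (by linarith))
    · rcases hd0.eq_or_lt with h0 | h0
      · rw [← h0, Real.zero_rpow (by linarith)]
        simp
      · obtain ⟨m, hm1, hm2⟩ := exists_nat_pow_near_of_lt_one (x := d / 4) (y := (1/2 : ℝ))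
          (by positivity) (by linarith) (by norm_num) (by norm_num)
        refine le_trans ?_ le_self_add
        refine le_trans ?_ (ENNReal.le_tsum m)
        rw [if_pos (by rw [pow_succ] at hm1; linarith), mul_one]
        exact ENNReal.ofReal_le_ofReal (Real.rpow_le_rpow hd0 (by linarith) (by linarith))
  refine (ENNReal.tsum_le_tsum key).trans ?_
  rw [ENNReal.tsum_add, ENNReal.tsum_comm, ENNReal.tsum_mul_left]
  simp_rw [ENNReal.tsum_mul_left]
  gcongr with i
  · exact count_jump (by positivity) G (Nb i) (hN i) p hp
  · exact count_jump (by positivity) G (Nb 0) (hN 0) p hp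

lemma tsum_inj_ite (p : ℕ → ℕ) (c : ℕ → ℝ≥0∞) (P : ℕ → Prop) [DecidablePred P]
    (h : ∀ i j, P i → P j → p i = p j → i = j) :
    ∑' j, (if P j then c (p j) else 0) ≤ ∑' k, c k := by
  have h1 : ∑' j, (if P j then c (p j) else 0) = ∑' j : {j // P j}, c (p j) := by
    have := tsum_subtype {j | P j} (fun j => c (p j))
    rw [show (∑' j : {j // P j}, c (p j)) = ∑' j : ({j | P j} : Set ℕ), c (p j) from rfl, this]
    apply tsum_congr
    intro j
    by_cases hj : P j <;> simp [hj]
  rw [h1]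
  have hinj : Function.Injective (fun j : {j // P j} => p j) := by
    intro i j hij
    exact Subtype.ext (h i j i.2 j.2 hij)
  exact ENNReal.tsum_comp_le_tsum_of_injective hinj c

lemma exists_level (a : ℝ) (ha : 0 < a) (t : ℝ) (ht : 0 < t) :
    ∃ k : ℕ, a * (1/2 : ℝ) ^ (k + 1) < min t a ∧ min t a ≤ a * (1/2 : ℝ) ^ k := by
  obtain ⟨m, hm1, hm2⟩ := exists_nat_pow_near_of_lt_one (x := min t a / a) (y := (1/2 : ℝ))
          (by positivity) (by rw [div_le_one ha]; exact min_le_right _ _)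
          (by norm_num) (by norm_num)
  refine ⟨m, ?_, ?_⟩
  · rw [lt_div_iff₀ ha] at hm1; linarith
  · rw [div_le_iff₀ ha] at hm2; linarith

lemma sq_add4 (x y z w : ℝ) : (x + y + z + w)^2 ≤ 4 * (x^2+y^2+z^2+w^2) := by
  nlinarith [sq_nonneg (x-y), sq_nonneg (x-z), sq_nonneg (x-w), sq_nonneg (y-z), sq_nonneg (y-w), sq_nonneg (z-w)]

lemma eVar_fin (ρ : ℝ) (hρ : 2 < ρ) (a : ℝ) (ha : 0 < a) (F : ℝ → ℝ) (G : ℕ → ℝ)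
    (hFa : ∀ t, a ≤ t → F t = F a)
    (ν : Measure ℝ) (hν : ν univ ≠ ⊤)
    (hF : ∀ (k : ℕ) (s t : ℝ), a * (1/2 : ℝ) ^ (k + 1) ≤ s → s ≤ t → t ≤ a * (1/2 : ℝ) ^ k →
      ENNReal.ofReal ((F s - F t) ^ 2) ≤ ν (Ioc s t))
    (he : ∑' k, ENNReal.ofReal ((F (a * (1/2 : ℝ) ^ k) - G k) ^ 2) ≠ ⊤)
    (Nb : ℕ → ℝ≥0∞)
    (hN : ∀ i k, ((anch ((1/2 : ℝ) ^ i) G k).2 : ℝ≥0∞) ≤ Nb i)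
    (hsum : ∑' i, ENNReal.ofReal ((4 * (1/2 : ℝ) ^ i) ^ ρ) * Nb i ≠ ⊤) :
    eVar ρ F ≠ ⊤ := by
  obtain ⟨C, hC, hCv⟩ := seq_var ρ hρ G Nb hN hsum
  set e : ℕ → ℝ := fun k => F (a * (1/2 : ℝ) ^ k) - G k with hedef
  set rr : ℕ → ℝ := fun k => a * (1/2 : ℝ) ^ k with hrr
  have hrr_anti : Antitone rr := by
    intro i j hij
    exact mul_le_mul_of_nonneg_left (pow_le_pow_of_le_one (by norm_num) (by norm_num) hij) ha.le
  set c : ℕ → ℝ≥0∞ := fun k => ENNReal.ofReal (e k ^ 2) + ν (Ioc (rr (k+1)) (rr k)) with hc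
  have hcsum : ∑' k, c k ≠ ⊤ := by
    rw [hc, ENNReal.tsum_add]
    refine ENNReal.add_ne_top.mpr ⟨he, ?_⟩
    rw [← measure_iUnion]
    · exact ne_top_of_le_ne_top hν (measure_mono (subset_univ _))
    · have := hrr_anti.pairwise_disjoint_on_Ioc_succ
      simpa using this
    · intro i; exact measurableSet_Ioc
  set C1 : ℝ≥0∞ := ν univ + (4 * ∑' k, c k + 4 * ∑' k, c k) with hC1
  have hC1t : C1 ≠ ⊤ := by
    refine ENNReal.add_ne_top.mpr ⟨hν, ENNReal.add_ne_top.mpr ⟨?_, ?_⟩⟩ <;>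
    exact ENNReal.mul_ne_top (by norm_num) hcsum
  set C2 : ℝ≥0∞ := ENNReal.ofReal (C1.toReal ^ ((ρ - 2)/2)) * C1 with hC2
  set C3 : ℝ≥0∞ := ENNReal.ofReal (2 ^ (ρ - 1)) * (C + C2) with hC3
  have hC3t : C3 ≠ ⊤ := ENNReal.mul_ne_top ENNReal.ofReal_ne_top
    (ENNReal.add_ne_top.mpr ⟨hC, ENNReal.mul_ne_top ENNReal.ofReal_ne_top hC1t⟩)
  suffices h : ∀ t : {t : ℕ → ℝ // NullSeq t},
      (∑' j : ℕ, ENNReal.ofReal (|F (t.1 j) - F (t.1 (j + 1))| ^ ρ)) ≤ C3 by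
    have : eVar ρ F ≤ C3 ^ (1 / ρ) := by
      apply iSup_le
      intro t
      exact ENNReal.rpow_le_rpow (h t) (by positivity)
    exact ne_top_of_le_ne_top (ENNReal.rpow_ne_top_of_nonneg (by positivity) hC3t) this
  rintro ⟨t, hta, htp, htl⟩
  simp only
  choose p hp1 hp2 using fun j => exists_level a ha (t j) (htp j)
  set τ : ℕ → ℝ := fun j => min (t j) a with hτ
  have hFτ : ∀ j, F (t j) = F (τ j) := by
    intro j
    rcases le_total (t j) a with h | h
    · simp [hτ, h]
    · simp [hτ, h, hFa _ h]
  have hτa : Antitone τ := fun i j hij => min_le_min (hta.antitone hij) le_rfl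
  have hpm : Monotone p := by
    apply monotone_nat_of_le_succ
    intro j
    by_contra hcon
    push Not at hcon
    have h1 : rr (p j) ≤ rr (p (j+1) + 1) := hrr_anti hcon
    have h2 := hp1 (j+1)
    have h3 := hp2 j
    have h4 := hτa (Nat.le_succ j)
    simp only [hτ, hrr] at *
    linarith
  set R : ℕ → ℝ := fun j => (F (τ j) - G (p j)) - (F (τ (j+1)) - G (p (j+1))) with hR
  have hloc : ∀ j, ENNReal.ofReal ((F (τ j) - F (rr (p j))) ^ 2) ≤ ν (Ioc (rr (p j + 1)) (rr (p j))) := by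
    intro j
    refine (hF (p j) _ _ (hp1 j).le (hp2 j) le_rfl).trans (measure_mono ?_)
    exact Ioc_subset_Ioc_left (hp1 j).le
  have hRj : ∀ j, ENNReal.ofReal (R j ^ 2) ≤ ν (Ioc (τ (j+1)) (τ j)) +
      (4 * (if p j < p (j+1) then c (p j) else 0) + 4 * (if p j < p (j+1) then c (p (j+1)) else 0)) := by
    intro j
    rcases (hpm (Nat.le_succ j)).eq_or_lt with h | h
    · refine le_trans ?_ le_self_add
      have : R j ^ 2 = (F (τ (j+1)) - F (τ j)) ^ 2 := by
        simp only [hR]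
        rw [← h]; ring
      rw [this]
      refine hF (p j) _ _ ?_ (hτa (Nat.le_succ j)) (hp2 j)
      have := (hp1 (j+1)).le
      rw [← Nat.succ_eq_add_one j, ← h] at this
      exact this
    · refine le_trans ?_ le_add_self
      have h' : p j < p (j+1) := h
      rw [if_pos h', if_pos h']
      have hb : R j ^ 2 ≤ 4 * (e (p j) ^ 2 + (F (τ j) - F (rr (p j)))^2) +
          4 * (e (p (j+1)) ^ 2 + (F (τ (j+1)) - F (rr (p (j+1))))^2) := by
        have := sq_add4 (e (p j)) (F (τ j) - F (rr (p j))) (-e (p (j+1))) (-(F (τ (j+1)) - F (rr (p (j+1)))))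
        have e1 : R j = e (p j) + (F (τ j) - F (rr (p j))) + (-e (p (j+1))) + (-(F (τ (j+1)) - F (rr (p (j+1))))) := by
          simp only [hR, hedef, hrr]; ring
        rw [e1]
        refine this.trans (le_of_eq ?_)
        ring
      refine (ENNReal.ofReal_le_ofReal hb).trans ?_
      rw [ENNReal.ofReal_add (by positivity) (by positivity), ENNReal.ofReal_mul (by norm_num),
        ENNReal.ofReal_mul (by norm_num), ENNReal.ofReal_add (by positivity) (by positivity),
        ENNReal.ofReal_add (by positivity) (by positivity)]
      have h4 : ENNReal.ofReal 4 = 4 := by simp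
      rw [h4]
      simp only [hc]
      gcongr
      · exact hloc j
      · exact hloc (j+1)
  have hRsum : ∑' j, ENNReal.ofReal (R j ^ 2) ≤ C1 := by
    refine (ENNReal.tsum_le_tsum hRj).trans ?_
    rw [ENNReal.tsum_add, ENNReal.tsum_add, ENNReal.tsum_mul_left, ENNReal.tsum_mul_left]
    rw [hC1]
    gcongr ?_ + (4 * ?_ + 4 * ?_)
    · rw [← measure_iUnion]
      · exact measure_mono (subset_univ _)
      · have := hτa.pairwise_disjoint_on_Ioc_succ
        simpa using this
      · intro i; exact measurableSet_Ioc
    · apply tsum_inj_ite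
      intro i j hi hj hij
      rcases lt_trichotomy i j with h | h | h
      · have := hpm (Nat.succ_le_of_lt h); simp only [Nat.succ_eq_add_one] at this; omega
      · exact h
      · have := hpm (Nat.succ_le_of_lt h); simp only [Nat.succ_eq_add_one] at this; omega
    · apply tsum_inj_ite (fun j => p (j+1))
      intro i j hi hj hij
      rcases lt_trichotomy i j with h | h | h
      · have := hpm (Nat.succ_le_of_lt h); simp only [Nat.succ_eq_add_one] at this; omega
      · exact h
      · have := hpm (Nat.succ_le_of_lt h); simp only [Nat.succ_eq_add_one] at this; omega
  have hRρ : ∀ j, ENNReal.ofReal (|R j| ^ ρ) ≤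
      ENNReal.ofReal (C1.toReal ^ ((ρ - 2)/2)) * ENNReal.ofReal (R j ^ 2) := by
    intro j
    rw [← ENNReal.ofReal_mul (by positivity)]
    apply ENNReal.ofReal_le_ofReal
    have h1 : R j ^ 2 ≤ C1.toReal := by
      have := (ENNReal.le_tsum j).trans hRsum
      rwa [ENNReal.ofReal_le_iff_le_toReal hC1t] at this
    rcases eq_or_ne (R j) 0 with h0 | h0
    · rw [h0]; simp [Real.zero_rpow (by linarith : ρ ≠ 0)]
    have hpos : 0 < |R j| := abs_pos.mpr h0
    have : |R j| ^ ρ = (R j ^ 2) ^ ((ρ - 2)/2) * R j ^ 2 := by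
      rw [← sq_abs, ← Real.rpow_natCast, ← Real.rpow_mul hpos.le, ← Real.rpow_add hpos]
      congr 1
      push_cast
      ring
    rw [this]
    gcongr
  have hfin : ∀ j, ENNReal.ofReal (|F (t j) - F (t (j+1))| ^ ρ) ≤ ENNReal.ofReal (2 ^ (ρ - 1)) *
      (ENNReal.ofReal (|G (p j) - G (p (j+1))| ^ ρ) + ENNReal.ofReal (|R j| ^ ρ)) := by
    intro j
    rw [← ENNReal.ofReal_add (by positivity) (by positivity), ← ENNReal.ofReal_mul (by positivity)]
    apply ENNReal.ofReal_le_ofReal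
    have h1 : F (t j) - F (t (j+1)) = (G (p j) - G (p (j+1))) + R j := by
      rw [hFτ, hFτ]; simp only [hR]; ring
    rw [h1]
    refine (Real.rpow_le_rpow (abs_nonneg _) (abs_add_le _ _) (by linarith)).trans ?_
    have h2 := NNReal.rpow_add_le_mul_rpow_add_rpow ⟨|G (p j) - G (p (j+1))|, abs_nonneg _⟩
      ⟨|R j|, abs_nonneg _⟩ (p := ρ) (by linarith)
    exact_mod_cast h2
  refine (ENNReal.tsum_le_tsum hfin).trans ?_
  rw [ENNReal.tsum_mul_left, ENNReal.tsum_add, hC3]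
  gcongr
  · exact hCv p hpm
  · refine (ENNReal.tsum_le_tsum hRρ).trans ?_
    rw [ENNReal.tsum_mul_left, hC2]
    gcongr

end VR

namespace VR

abbrev EE (n : ℕ) := EuclideanSpace ℝ (Fin n)

/-! ### Cauchy-Schwarz -/

lemma lint_cs {α : Type*} [MeasurableSpace α] (μ : Measure α) {u v : α → ℝ≥0∞}
    (hu : AEMeasurable u μ) (hv : AEMeasurable v μ) :
    (∫⁻ x, u x * v x ∂μ) ^ 2 ≤ (∫⁻ x, u x ^ 2 ∂μ) * ∫⁻ x, v x ^ 2 ∂μ := by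
  have h := ENNReal.lintegral_mul_le_Lp_mul_Lq μ Real.HolderConjugate.two_two hu hv
  have h2 : (∫⁻ x, u x * v x ∂μ) ^ 2 ≤ ((∫⁻ x, u x ^ (2:ℝ) ∂μ) ^ (1 / (2:ℝ)) *
      (∫⁻ x, v x ^ (2:ℝ) ∂μ) ^ (1 / (2:ℝ))) ^ 2 := by
    gcongr
    exact h
  refine h2.trans (le_of_eq ?_)
  rw [mul_pow, ← ENNReal.rpow_natCast, ← ENNReal.rpow_natCast, ← ENNReal.rpow_mul,
    ← ENNReal.rpow_mul]
  norm_num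

lemma int_cs {α : Type*} [MeasurableSpace α] (μ : Measure α) {u v : α → ℝ}
    (hu : AEMeasurable u μ) (hv : AEMeasurable v μ) :
    ‖∫ x, u x * v x ∂μ‖ₑ ^ 2 ≤ (∫⁻ x, ‖u x‖ₑ ^ 2 ∂μ) * ∫⁻ x, ‖v x‖ₑ ^ 2 ∂μ := by
  refine le_trans ?_ (lint_cs μ hu.enorm hv.enorm)
  gcongr
  refine (enorm_integral_le_lintegral_enorm _).trans (le_of_eq ?_)
  simp_rw [enorm_mul]

lemma tsum_cs {ι : Type*} [Countable ι] (u v : ι → ℝ≥0∞) :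
    (∑' i, u i * v i) ^ 2 ≤ (∑' i, u i ^ 2) * ∑' i, v i ^ 2 := by
  let _ : MeasurableSpace ι := ⊤
  have h := lint_cs (Measure.count : Measure ι) (u := u) (v := v)
    (measurable_of_countable _).aemeasurable (measurable_of_countable _).aemeasurable
  simpa [lintegral_count] using h

/-! ### square norm -/

def Sq {n : ℕ} (g : EE n → ℝ) : ℝ≥0∞ := ∫⁻ x, ‖g x‖ₑ ^ 2

structure IsL2 {n : ℕ} (g : EE n → ℝ) : Prop where
  meas : Measurable g
  fin : Sq g ≠ ⊤

lemma Sq_eq {n : ℕ} (g : EE n → ℝ) : eLpNorm g 2 volume = (Sq g) ^ (1/2 : ℝ) := by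
  rw [eLpNorm_eq_lintegral_rpow_enorm_toReal (by norm_num) (by norm_num)]
  simp [Sq]

lemma IsL2.memLp {n : ℕ} {g : EE n → ℝ} (h : IsL2 g) : MemLp g 2 volume :=
  ⟨h.meas.aestronglyMeasurable, by
    rw [Sq_eq]
    exact ENNReal.rpow_lt_top_of_nonneg (by norm_num) h.fin⟩

lemma isL2_of_memLp {n : ℕ} {g : EE n → ℝ} (hm : Measurable g) (h : MemLp g 2 volume) : IsL2 g :=
  ⟨hm, by
    have := h.2
    rw [Sq_eq] at this
    intro hh
    rw [hh] at this
    simp at this⟩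

lemma IsL2.add {n : ℕ} {g h : EE n → ℝ} (hg : IsL2 g) (hh : IsL2 h) : IsL2 (fun x => g x + h x) :=
  isL2_of_memLp (hg.meas.add hh.meas) (hg.memLp.add hh.memLp)

lemma IsL2.sub {n : ℕ} {g h : EE n → ℝ} (hg : IsL2 g) (hh : IsL2 h) : IsL2 (fun x => g x - h x) :=
  isL2_of_memLp (hg.meas.sub hh.meas) (hg.memLp.sub hh.memLp)

lemma IsL2.int_mul {n : ℕ} {g h : EE n → ℝ} (hg : IsL2 g) (hh : IsL2 h) :
    Integrable (fun x => g x * h x) :=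
  MemLp.integrable_mul hg.memLp hh.memLp

lemma IsL2.locInt {n : ℕ} {g : EE n → ℝ} (hg : IsL2 g) : LocallyIntegrable g volume :=
  hg.memLp.locallyIntegrable (by norm_num)

lemma Sq_ofReal {n : ℕ} {g : EE n → ℝ} (hg : IsL2 g) : Sq g = ENNReal.ofReal (∫ x, g x * g x) := by
  rw [ofReal_integral_eq_lintegral_ofReal (hg.int_mul hg) (ae_of_all _ fun x => mul_self_nonneg _)]
  unfold Sq
  congr 1
  ext x
  rw [← enorm_pow, ← pow_two, Real.enorm_eq_ofReal (sq_nonneg _)]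

lemma pyth {n : ℕ} {u v : EE n → ℝ} (hu : IsL2 u) (hv : IsL2 v) (h : ∫ x, u x * v x = 0) :
    Sq (fun x => u x + v x) = Sq u + Sq v := by
  rw [Sq_ofReal (hu.add hv), Sq_ofReal hu, Sq_ofReal hv, ← ENNReal.ofReal_add
    (integral_nonneg fun x => mul_self_nonneg _) (integral_nonneg fun x => mul_self_nonneg _)]
  congr 1
  have h1 : ∀ x, (u x + v x) * (u x + v x) = (u x * u x + v x * v x) + 2 * (u x * v x) := by
    intro x; ring
  simp_rw [h1]
  have h2 : Integrable (fun x => u x * u x + v x * v x) := (hu.int_mul hu).add (hv.int_mul hv)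
  rw [integral_add h2 ((hu.int_mul hv).const_mul 2),
    integral_add (hu.int_mul hu) (hv.int_mul hv), integral_const_mul, h]
  simp

/-! ### dyadic cubes -/

def rad (a : ℝ) (m : ℕ) : ℝ := a * (1/2 : ℝ) ^ m

lemma rad_pos {a : ℝ} (ha : 0 < a) (m : ℕ) : 0 < rad a m := by unfold rad; positivity

lemma rad_succ (a : ℝ) (m : ℕ) : rad a (m+1) = rad a m / 2 := by
  unfold rad; rw [pow_succ]; ring

lemma rad_add (a : ℝ) (m k : ℕ) : rad a (m+k) = rad a m * (1/2)^k := by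
  unfold rad; rw [pow_add]; ring

variable {n : ℕ}

def cidx (a : ℝ) (m : ℕ) (y : EE n) : Fin n → ℤ := fun i => ⌊y i / rad a m⌋

def cube (a : ℝ) (m : ℕ) (z : EE n) : Set (EE n) := {y | cidx a m y = cidx a m z}

def LC {β : Type*} (a : ℝ) (m : ℕ) (h : EE n → β) : Prop :=
  ∀ x y, cidx a m x = cidx a m y → h x = h y

def MZ (a : ℝ) (m : ℕ) (g : EE n → ℝ) : Prop := ∀ x, ∫ y in cube a m x, g y = 0

def cE (a : ℝ) (m : ℕ) (f : EE n → ℝ) (x : EE n) : ℝ :=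
  (rad a m ^ n)⁻¹ * ∫ y in cube a m x, f y

lemma measurable_cidx (a : ℝ) (m : ℕ) : Measurable (cidx a m : EE n → Fin n → ℤ) := by
  apply measurable_pi_lambda
  intro i
  apply Int.measurable_floor.comp
  have : Continuous (fun y : EE n => y i / rad a m) := by fun_prop
  exact this.measurable

lemma mem_cube_self (a : ℝ) (m : ℕ) (x : EE n) : x ∈ cube a m x := rfl

lemma cube_eq (a : ℝ) (m : ℕ) (x : EE n) : cube a m x = cidx a m ⁻¹' {cidx a m x} := rfl

lemma cube_congr {a : ℝ} {m : ℕ} {x y : EE n} (h : cidx a m x = cidx a m y) :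
    cube a m x = cube a m y := by
  unfold cube; rw [h]

lemma measurableSet_cube (a : ℝ) (m : ℕ) (x : EE n) : MeasurableSet (cube a m x) :=
  measurable_cidx a m (measurableSet_singleton _)

lemma LC.measurable {β : Type*} [MeasurableSpace β] [Nonempty β] {a : ℝ} {m : ℕ} {h : EE n → β}
    (hh : LC a m h) : Measurable h := by
  have hf : Function.FactorsThrough h (cidx a m) := fun x y hxy => hh x y hxy
  have : h = (Function.extend (cidx a m) h (fun _ => Classical.arbitrary β)) ∘ (cidx a m) := by
    ext x
    simp [hf.extend_apply]
  rw [this]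
  exact (measurable_of_countable _).comp (measurable_cidx a m)

lemma mem_Ico_of_floor {r y : ℝ} (hr : 0 < r) {z : ℤ} (h : ⌊y / r⌋ = z) :
    r * z ≤ y ∧ y < r * z + r := by
  rw [Int.floor_eq_iff, le_div_iff₀ hr, div_lt_iff₀ hr] at h
  constructor <;> nlinarith [h.1, h.2]

lemma floor_of_mem_Ico {r y : ℝ} (hr : 0 < r) {z : ℤ} (h : r * z ≤ y ∧ y < r * z + r) :
    ⌊y / r⌋ = z := by
  rw [Int.floor_eq_iff, le_div_iff₀ hr, div_lt_iff₀ hr]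
  constructor <;> nlinarith [h.1, h.2]

lemma volume_box (s : Fin n → Set ℝ) :
    volume {y : EE n | ∀ i, y i ∈ s i} = ∏ i, volume (s i) := by
  have h := (EuclideanSpace.volume_preserving_symm_measurableEquiv_toLp (Fin n)).symm
  have h2 := h.measure_preimage_equiv (s := {y : EE n | ∀ i, y i ∈ s i})
  rw [← h2, ← volume_pi_pi]
  congr 1
  ext y
  simp

lemma volume_cube {a : ℝ} (ha : 0 < a) (m : ℕ) (x : EE n) :
    volume (cube a m x) = ENNReal.ofReal (rad a m ^ n) := by
  have hr := rad_pos ha m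
  have : cube a m x = {y : EE n | ∀ i, y i ∈ Ico (rad a m * (cidx a m x i))
      (rad a m * (cidx a m x i) + rad a m)} := by
    ext y
    simp only [cube, mem_ofPred_eq, funext_iff, mem_Ico]
    constructor
    · intro h i
      exact mem_Ico_of_floor hr (h i)
    · intro h i
      exact floor_of_mem_Ico hr (h i)
  rw [this, volume_box]
  simp only [Real.volume_Ico, add_sub_cancel_left, Finset.prod_const, Finset.card_univ,
    Fintype.card_fin]
  rw [ENNReal.ofReal_pow hr.le]

lemma abs_coord_lt {a : ℝ} (ha : 0 < a) {m : ℕ} {x y : EE n} (h : y ∈ cube a m x) (i : Fin n) :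
    |y i - x i| < rad a m := by
  have hr := rad_pos ha m
  have h1 := mem_Ico_of_floor hr (congrFun h i)
  have h2 := mem_Ico_of_floor hr (z := cidx a m x i) (y := x i) rfl
  rw [abs_lt]
  constructor <;> linarith [h1.1, h1.2, h2.1, h2.2]

lemma norm_le_sum (z : EE n) : ‖z‖ ≤ ∑ i, |z i| := by
  rw [EuclideanSpace.norm_eq]
  apply Real.sqrt_le_iff.mpr
  refine ⟨Finset.sum_nonneg fun _ _ => abs_nonneg _, ?_⟩
  simp_rw [Real.norm_eq_abs]
  exact Finset.sum_sq_le_sq_sum_of_nonneg (fun i _ => abs_nonneg (z i))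

lemma norm_cube_le {a : ℝ} (ha : 0 < a) {m : ℕ} {x y : EE n} (h : y ∈ cube a m x) :
    ‖y - x‖ ≤ n * rad a m := by
  refine (norm_le_sum _).trans ?_
  have : ∑ i, |(y - x) i| ≤ ∑ _i : Fin n, rad a m :=
    Finset.sum_le_sum fun i _ => by simpa using (abs_coord_lt ha h i).le
  simpa using this

lemma cidx_succ {a : ℝ} {m : ℕ} {x y : EE n} (h : cidx a (m+1) x = cidx a (m+1) y) :
    cidx a m x = cidx a m y := by
  have key : ∀ t : ℝ, ⌊t / rad a m⌋ = ⌊t / rad a (m+1)⌋ / 2 := by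
    intro t
    rw [rad_succ]
    have : t / rad a m = (t / (rad a m / 2)) / (2 : ℕ) := by
      push_cast
      rw [div_div]; congr 1; ring
    rw [this, Int.floor_div_natCast]
    rfl
  funext i
  have := congrFun h i
  simp only [cidx] at this ⊢
  rw [key, key, this]

lemma cidx_mono {a : ℝ} {m k : ℕ} (hmk : m ≤ k) {x y : EE n} (h : cidx a k x = cidx a k y) :
    cidx a m x = cidx a m y := by
  induction k, hmk using Nat.le_induction with
  | base => exact h
  | succ k hk ih => exact ih (cidx_succ h)

lemma LC.mono {β : Type*} {a : ℝ} {m k : ℕ} (hmk : m ≤ k) {h : EE n → β} (hh : LC a m h) :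
    LC a k h := fun x y hxy => hh x y (cidx_mono hmk hxy)

lemma integrableOn_cube {a : ℝ} (ha : 0 < a) (m : ℕ) (x : EE n) {f : EE n → ℝ}
    (hf : LocallyIntegrable f volume) : IntegrableOn f (cube a m x) := by
  apply (hf.integrableOn_isCompact (isCompact_closedBall x (n * rad a m))).mono_set
  intro y hy
  rw [Metric.mem_closedBall, dist_eq_norm]
  exact norm_cube_le ha hy

lemma iUnion_cubes (a : ℝ) (m : ℕ) : (⋃ z : Fin n → ℤ, cidx a m ⁻¹' {z}) = (univ : Set (EE n)) := by
  ext x; simp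

lemma disj_cubes (a : ℝ) (m : ℕ) :
    Pairwise (Function.onFun Disjoint fun z : Fin n → ℤ => (cidx a m ⁻¹' {z} : Set (EE n))) := by
  intro z w hzw
  exact Disjoint.preimage _ (by simpa using hzw)

lemma lint_le {a : ℝ} {m : ℕ} {c u v : EE n → ℝ≥0∞} (hc : LC a m c) (hu : Measurable u)
    (hv : Measurable v) (h : ∀ x, ∫⁻ y in cube a m x, u y ≤ ∫⁻ y in cube a m x, v y) :
    ∫⁻ x, c x * u x ≤ ∫⁻ x, c x * v x := by
  have dec : ∀ w : EE n → ℝ≥0∞, ∫⁻ x, w x = ∑' z : Fin n → ℤ, ∫⁻ x in cidx a m ⁻¹' {z}, w x := by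
    intro w
    rw [← lintegral_iUnion (fun z => measurable_cidx a m (measurableSet_singleton z))
      (disj_cubes a m), iUnion_cubes, Measure.restrict_univ]
  rw [dec, dec]
  apply ENNReal.tsum_le_tsum
  intro z
  by_cases hz : ∃ x : EE n, cidx a m x = z
  · obtain ⟨x, rfl⟩ := hz
    rw [← cube_eq]
    have e : ∀ w : EE n → ℝ≥0∞, Measurable w →
        ∫⁻ y in cube a m x, c y * w y = c x * ∫⁻ y in cube a m x, w y := by
      intro w hw
      rw [← lintegral_const_mul _ hw]
      apply setLIntegral_congr_fun (measurableSet_cube a m x)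
      intro y hy
      simp only
      rw [hc y x hy]
    rw [e u hu, e v hv]
    gcongr c x * ?_
    exact h x
  · have : (cidx a m ⁻¹' {z} : Set (EE n)) = ∅ := by
      ext x
      simp only [mem_preimage, mem_singleton_iff, mem_empty_iff_false, iff_false]
      exact fun hx => hz ⟨x, hx⟩
    rw [this]
    simp

lemma int_zero {a : ℝ} {m : ℕ} {c g : EE n → ℝ} (hc : LC a m c) (hg : MZ a m g)
    (hi : Integrable (fun x => c x * g x)) : ∫ x, c x * g x = 0 := by
  rw [← setIntegral_univ, ← iUnion_cubes a m, integral_iUnion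
    (fun z => measurable_cidx a m (measurableSet_singleton z)) (disj_cubes a m) hi.integrableOn]
  convert tsum_zero with z
  by_cases hz : ∃ x : EE n, cidx a m x = z
  · obtain ⟨x, rfl⟩ := hz
    rw [← cube_eq, setIntegral_congr_fun (g := fun y => c x * g y) (measurableSet_cube a m x),
      integral_const_mul, hg x, mul_zero]
    intro y hy
    simp only
    rw [hc y x hy]
  · have : (cidx a m ⁻¹' {z} : Set (EE n)) = ∅ := by
      ext x
      simp only [mem_preimage, mem_singleton_iff, mem_empty_iff_false, iff_false]
      exact fun hx => hz ⟨x, hx⟩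
    rw [this]
    simp

lemma MZ.mono {a : ℝ} (ha : 0 < a) {m k : ℕ} (hmk : m ≤ k) {g : EE n → ℝ}
    (hl : LocallyIntegrable g volume) (hg : MZ a k g) : MZ a m g := by
  intro x
  have hc : LC a k ((cube a m x).indicator (fun _ => (1 : ℝ))) := by
    intro y z hyz
    have : y ∈ cube a m x ↔ z ∈ cube a m x := by
      simp only [cube, mem_ofPred_eq, cidx_mono hmk hyz]
    by_cases hy : y ∈ cube a m x
    · simp [hy, this.mp hy]
    · have hz : z ∉ cube a m x := fun h => hy (this.mpr h)
      simp [hy, hz]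
  have e : (fun y => (cube a m x).indicator (fun _ => (1 : ℝ)) y * g y) = (cube a m x).indicator g := by
    ext y
    by_cases hy : y ∈ cube a m x <;> simp [hy]
  have := int_zero hc hg (by
    rw [e]; exact (integrableOn_cube ha m x hl).integrable_indicator (measurableSet_cube a m x))
  rwa [e, integral_indicator (measurableSet_cube a m x)] at this

lemma cE_LC (a : ℝ) (m : ℕ) (f : EE n → ℝ) : LC a m (cE a m f) := by
  intro x y h
  unfold cE
  rw [cube_congr h]

lemma integral_cE {a : ℝ} (ha : 0 < a) (m : ℕ) (f : EE n → ℝ) (x : EE n) :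
    ∫ y in cube a m x, cE a m f y = ∫ y in cube a m x, f y := by
  have hr := rad_pos ha m
  rw [setIntegral_congr_fun (g := fun _ => cE a m f x) (measurableSet_cube a m x)
    (fun y hy => cE_LC a m f y x hy)]
  rw [setIntegral_const, measureReal_def, volume_cube ha, ENNReal.toReal_ofReal (by positivity)]
  unfold cE
  rw [smul_eq_mul, ← mul_assoc, mul_inv_cancel₀ (by positivity), one_mul]

lemma LC.integrableOn {a : ℝ} (ha : 0 < a) {m : ℕ} {h : EE n → ℝ} (hh : LC a m h) (x : EE n) :
    IntegrableOn h (cube a m x) := by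
  have : IntegrableOn (fun _ => h x) (cube a m x) := by
    apply integrableOn_const
    · rw [volume_cube ha]; exact ENNReal.ofReal_ne_top
    · simp
  exact this.congr_fun (fun y hy => (hh y x hy).symm) (measurableSet_cube a m x)

lemma MZ_sub_cE {a : ℝ} (ha : 0 < a) (m : ℕ) {f : EE n → ℝ} (hf : LocallyIntegrable f volume) :
    MZ a m (fun x => f x - cE a m f x) := by
  intro x
  rw [integral_sub (integrableOn_cube ha m x hf) ((cE_LC a m f).integrableOn ha x),
    integral_cE ha, sub_self]

lemma MZ.sub {a : ℝ} (ha : 0 < a) {m : ℕ} {f g : EE n → ℝ} (hf : LocallyIntegrable f volume)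
    (hg : LocallyIntegrable g volume) (h1 : MZ a m f) (h2 : MZ a m g) :
    MZ a m (fun x => f x - g x) := by
  intro x
  rw [integral_sub (integrableOn_cube ha m x hf) (integrableOn_cube ha m x hg), h1, h2, sub_self]

lemma cE_meas (a : ℝ) (m : ℕ) (f : EE n → ℝ) : Measurable (cE a m f) := (cE_LC a m f).measurable

lemma Sq_cE_le {a : ℝ} (ha : 0 < a) (m : ℕ) {f : EE n → ℝ} (hf : Measurable f) :
    Sq (cE a m f) ≤ Sq f := by
  have hr := rad_pos ha m
  have := lint_le (a := a) (m := m) (c := fun _ : EE n => (1 : ℝ≥0∞)) (fun _ _ _ => rfl)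
    (u := fun x => ‖cE a m f x‖ₑ ^ 2) (v := fun x => ‖f x‖ₑ ^ 2)
    ((cE_meas a m f).enorm.pow_const 2) (hf.enorm.pow_const 2) ?_
  · simpa [Sq] using this
  intro x
  rw [setLIntegral_congr_fun (g := fun _ => ‖cE a m f x‖ₑ ^ 2) (measurableSet_cube a m x)
    (fun y hy => by simp only; rw [cE_LC a m f y x hy])]
  rw [setLIntegral_const, volume_cube ha]
  have h1 : ‖∫ y in cube a m x, f y‖ₑ ^ 2 ≤ ENNReal.ofReal (rad a m ^ n) *
      ∫⁻ y in cube a m x, ‖f y‖ₑ ^ 2 := by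
    have := int_cs (volume.restrict (cube a m x)) (u := fun _ => (1:ℝ)) (v := f)
      aemeasurable_const hf.aemeasurable
    simpa [volume_cube ha] using this
  unfold cE
  rw [enorm_mul, mul_pow, Real.enorm_eq_ofReal (by positivity)]
  have h2 : ENNReal.ofReal (rad a m ^ n)⁻¹ * ENNReal.ofReal (rad a m ^ n) = 1 := by
    rw [← ENNReal.ofReal_mul (by positivity), inv_mul_cancel₀ (by positivity), ENNReal.ofReal_one]
  calc _ ≤ ENNReal.ofReal (rad a m ^ n)⁻¹ ^ 2 * (ENNReal.ofReal (rad a m ^ n) *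
      ∫⁻ y in cube a m x, ‖f y‖ₑ ^ 2) * ENNReal.ofReal (rad a m ^ n) := by gcongr
    _ = (ENNReal.ofReal (rad a m ^ n)⁻¹ * ENNReal.ofReal (rad a m ^ n)) ^ 2 *
      ∫⁻ y in cube a m x, ‖f y‖ₑ ^ 2 := by ring
    _ = _ := by rw [h2]; simp

lemma IsL2.cE {a : ℝ} (ha : 0 < a) (m : ℕ) {f : EE n → ℝ} (hf : IsL2 f) : IsL2 (cE a m f) :=
  ⟨cE_meas a m f, ne_top_of_le_ne_top hf.fin (Sq_cE_le ha m hf.meas)⟩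

/-- orthogonality -/
lemma orth {a : ℝ} {m : ℕ} {c g : EE n → ℝ} (hc : LC a m c) (hg : MZ a m g)
    (hc2 : IsL2 c) (hg2 : IsL2 g) : ∫ x, c x * g x = 0 :=
  int_zero hc hg (hc2.int_mul hg2)

lemma Sq_sub_cE_le {a : ℝ} (ha : 0 < a) (m : ℕ) {f : EE n → ℝ} (hf : IsL2 f) :
    Sq (fun x => f x - cE a m f x) ≤ Sq f := by
  have h := pyth (hf.cE ha m) (hf.sub (hf.cE ha m))
    (orth (cE_LC a m f) (MZ_sub_cE ha m hf.locInt) (hf.cE ha m) (hf.sub (hf.cE ha m)))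
  have e : (fun x => VR.cE a m f x + (f x - VR.cE a m f x)) = f := by ext x; ring
  rw [e] at h
  rw [h]
  exact le_add_self

def hcomp (a : ℝ) (f : EE n → ℝ) : ℕ → EE n → ℝ
  | 0 => cE a 0 f
  | i + 1 => fun x => cE a (i+1) f x - cE a i f x

lemma hcomp_LC (a : ℝ) (f : EE n → ℝ) (i : ℕ) : LC a i (hcomp a f i) := by
  cases i with
  | zero => exact cE_LC a 0 f
  | succ i =>
    intro x y h
    simp only [hcomp]
    rw [cE_LC a (i+1) f x y h, cE_LC a i f x y (cidx_succ h)]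

lemma hcomp_L2 {a : ℝ} (ha : 0 < a) {f : EE n → ℝ} (hf : IsL2 f) (i : ℕ) : IsL2 (hcomp a f i) := by
  cases i with
  | zero => exact hf.cE ha 0
  | succ i => exact (hf.cE ha (i+1)).sub (hf.cE ha i)

lemma hcomp_MZ {a : ℝ} (ha : 0 < a) {f : EE n → ℝ} (hf : IsL2 f) (i : ℕ) :
    MZ a i (hcomp a f (i+1)) := by
  have h1 : LocallyIntegrable (fun x => f x - cE a i f x) volume := (hf.sub (hf.cE ha i)).locInt
  have h2 : LocallyIntegrable (fun x => f x - cE a (i+1) f x) volume :=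
    (hf.sub (hf.cE ha (i+1))).locInt
  have := MZ.sub ha h1 h2 (MZ_sub_cE ha i hf.locInt)
    (MZ.mono ha (Nat.le_succ i) h2 (MZ_sub_cE ha (i+1) hf.locInt))
  convert this using 2
  simp only [hcomp]; ring

lemma hcomp_sum (a : ℝ) (f : EE n → ℝ) (N : ℕ) (x : EE n) :
    ∑ i ∈ Finset.range (N+1), hcomp a f i x = cE a N f x := by
  induction N with
  | zero => simp [hcomp]
  | succ N ih => rw [Finset.sum_range_succ, ih]; simp only [hcomp]; ring

lemma hcomp_Sq {a : ℝ} (ha : 0 < a) {f : EE n → ℝ} (hf : IsL2 f) :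
    ∑' i, Sq (hcomp a f i) ≤ Sq f := by
  have key : ∀ N, ∑ i ∈ Finset.range (N+1), Sq (hcomp a f i) = Sq (cE a N f) := by
    intro N
    induction N with
    | zero => simp [hcomp]
    | succ N ih =>
      rw [Finset.sum_range_succ, ih]
      rw [← pyth (hf.cE ha N) (hcomp_L2 ha hf (N+1))
        (orth (cE_LC a N f) (hcomp_MZ ha hf N) (hf.cE ha N) (hcomp_L2 ha hf (N+1)))]
      congr 1
      ext x
      simp only [hcomp]; ring
  rw [ENNReal.tsum_eq_iSup_nat]
  apply iSup_le
  intro N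
  refine le_trans ?_ ((key N).trans_le (Sq_cE_le ha N hf.meas))
  exact Finset.sum_le_sum_of_subset (Finset.range_mono (Nat.le_succ N))

end VR

namespace VR
variable {n : ℕ}

def KK (ℓ : Fin n) (z : EE n) : ℝ := z ℓ / ‖z‖ ^ (n + 1)

def Ann (x : EE n) (s t : ℝ) : Set (EE n) := {y | s < ‖x - y‖ ∧ ‖x - y‖ ≤ t}

def TT (ℓ : Fin n) (s t : ℝ) (g : EE n → ℝ) (x : EE n) : ℝ :=
  ∫ y in Ann x s t, KK ℓ (x - y) * g y

lemma measurable_KK (ℓ : Fin n) : Measurable (KK ℓ) := by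
  unfold KK
  apply Measurable.div
  · exact (by fun_prop : Continuous fun z : EE n => z ℓ).measurable
  · exact (by fun_prop : Continuous fun z : EE n => ‖z‖ ^ (n+1)).measurable

lemma measurable_KKx (ℓ : Fin n) (x : EE n) : Measurable (fun y => KK ℓ (x - y)) :=
  (measurable_KK ℓ).comp (by fun_prop)

lemma measurableSet_Ann (x : EE n) (s t : ℝ) : MeasurableSet (Ann x s t) := by
  have h1 : MeasurableSet {y : EE n | s < ‖x - y‖} :=
    (isOpen_lt continuous_const (by fun_prop)).measurableSet
  have h2 : MeasurableSet {y : EE n | ‖x - y‖ ≤ t} :=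
    (isClosed_le (by fun_prop) continuous_const).measurableSet
  exact h1.inter h2

lemma Ann_subset (x : EE n) (s t : ℝ) : Ann x s t ⊆ Metric.closedBall x t := by
  intro y hy
  rw [Metric.mem_closedBall, dist_comm, dist_eq_norm]
  exact hy.2

lemma abs_coord_le (z : EE n) (ℓ : Fin n) : |z ℓ| ≤ ‖z‖ := by
  simpa using PiLp.norm_apply_le z ℓ

lemma KK_bound (ℓ : Fin n) {s : ℝ} (hs : 0 < s) {z : EE n} (hz : s ≤ ‖z‖) :
    |KK ℓ z| ≤ (s ^ n)⁻¹ := by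
  have hz0 : 0 < ‖z‖ := hs.trans_le hz
  unfold KK
  rw [abs_div, abs_of_pos (by positivity : 0 < ‖z‖ ^ (n+1)), div_le_iff₀ (by positivity)]
  have h1 := abs_coord_le z ℓ
  calc |z ℓ| ≤ 1 * ‖z‖ := by linarith
    _ ≤ ((s ^ n)⁻¹ * ‖z‖ ^ n) * ‖z‖ := by
        gcongr
        rw [← div_eq_inv_mul, le_div_iff₀ (by positivity), one_mul]
        gcongr
    _ = _ := by rw [pow_succ]; ring

lemma pow_diff (m : ℕ) {b c : ℝ} (hb : 0 ≤ b) (hbc : b ≤ c) :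
    c ^ (m+1) - b ^ (m+1) ≤ (m+1) * (c - b) * c ^ m := by
  induction m with
  | zero => simp
  | succ m ih =>
    have h1 : c ^ (m+1+1) - b^(m+1+1) = c * (c^(m+1) - b^(m+1)) + (c - b) * b^(m+1) := by ring
    have h2 : b^(m+1) ≤ c^(m+1) := by gcongr
    have h3 : c * (c^(m+1) - b^(m+1)) ≤ c * ((m+1) * (c - b) * c ^ m) :=
      mul_le_mul_of_nonneg_left ih (hb.trans hbc)
    have h4 : (c - b) * b^(m+1) ≤ (c-b) * c^(m+1) := mul_le_mul_of_nonneg_left h2 (by linarith)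
    rw [h1]
    refine (add_le_add h3 h4).trans (le_of_eq ?_)
    push_cast
    ring

lemma abs_pow_diff (m : ℕ) {b c R : ℝ} (hb : 0 ≤ b) (hc : 0 ≤ c) (hbR : b ≤ R) (hcR : c ≤ R) :
    |c ^ (m+1) - b ^ (m+1)| ≤ (m+1) * |c - b| * R ^ m := by
  rcases le_total b c with h | h
  · rw [abs_of_nonneg (sub_nonneg.mpr (by gcongr)), abs_of_nonneg (sub_nonneg.mpr h)]
    refine (pow_diff m hb h).trans ?_
    have : 0 ≤ c - b := by linarith
    gcongr
  · rw [abs_sub_comm, abs_sub_comm c b, abs_of_nonneg (sub_nonneg.mpr (by gcongr)),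
      abs_of_nonneg (sub_nonneg.mpr h)]
    refine (pow_diff m hc h).trans ?_
    have : 0 ≤ b - c := by linarith
    gcongr

lemma KK_lip (ℓ : Fin n) {R : ℝ} (hR : 0 < R) {z w : EE n} (hz : R/2 ≤ ‖z‖) (hz' : ‖z‖ ≤ R)
    (hw : R/2 ≤ ‖w‖) (hw' : ‖w‖ ≤ R) :
    |KK ℓ z - KK ℓ w| ≤ (n + 2) * 4 ^ (n+1) * ‖z - w‖ / R ^ (n+1) := by
  have hz0 : 0 < ‖z‖ := by linarith
  have hw0 : 0 < ‖w‖ := by linarith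
  have e : KK ℓ z - KK ℓ w = (z - w) ℓ / ‖z‖^(n+1) +
      w ℓ * ((‖w‖^(n+1) - ‖z‖^(n+1)) / (‖z‖^(n+1) * ‖w‖^(n+1))) := by
    unfold KK
    simp only [PiLp.sub_apply]
    field_simp
    ring
  rw [e]
  have h1 : |(z - w) ℓ / ‖z‖^(n+1)| ≤ 4^(n+1) * ‖z - w‖ / R^(n+1) := by
    rw [abs_div, abs_of_pos (by positivity : 0 < ‖z‖ ^ (n+1)), div_le_div_iff₀ (by positivity) (by positivity)]
    have h2 : R^(n+1) ≤ 4^(n+1) * ‖z‖^(n+1) := by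
      rw [← mul_pow]; gcongr; linarith
    calc |(z-w) ℓ| * R^(n+1) ≤ ‖z - w‖ * (4^(n+1) * ‖z‖^(n+1)) := by
          gcongr; exact abs_coord_le _ _
      _ = _ := by ring
  have h2 : |w ℓ * ((‖w‖^(n+1) - ‖z‖^(n+1)) / (‖z‖^(n+1) * ‖w‖^(n+1)))| ≤
      (n+1) * 4^(n+1) * ‖z - w‖ / R^(n+1) := by
    rw [abs_mul, abs_div, abs_of_pos (by positivity : 0 < ‖z‖ ^ (n+1) * ‖w‖^(n+1))]
    have a1 : |w ℓ| ≤ R := (abs_coord_le _ _).trans hw'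
    have a2 := abs_pow_diff n hz0.le hw0.le hz' hw'
    have a3 : |‖w‖ - ‖z‖| ≤ ‖z - w‖ := by
      rw [norm_sub_rev]; exact abs_norm_sub_norm_le w z
    have a4 : (R/2)^(n+1) * (R/2)^(n+1) ≤ ‖z‖^(n+1) * ‖w‖^(n+1) := by gcongr
    calc |w ℓ| * (|‖w‖^(n+1) - ‖z‖^(n+1)| / (‖z‖^(n+1) * ‖w‖^(n+1)))
        ≤ R * (((n+1) * ‖z - w‖ * R^n) / ((R/2)^(n+1) * (R/2)^(n+1))) := by
          gcongr
          exact a2.trans (by gcongr)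
      _ = _ := by
          rw [div_pow]
          have : (4:ℝ)^(n+1) = 2^(n+1) * 2^(n+1) := by rw [← mul_pow]; norm_num
          rw [this, pow_succ R n]
          field_simp
  refine (abs_add_le _ _).trans ((add_le_add h1 h2).trans (le_of_eq ?_))
  ring

lemma integrableOn_KK (ℓ : Fin n) {s : ℝ} (hs : 0 < s) (t : ℝ) (x : EE n) {g : EE n → ℝ}
    (hg : LocallyIntegrable g volume) :
    IntegrableOn (fun y => KK ℓ (x - y) * g y) (Ann x s t) := by
  have h1 : IntegrableOn g (Ann x s t) :=
    (hg.integrableOn_isCompact (isCompact_closedBall x t)).mono_set (Ann_subset x s t)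
  refine Integrable.bdd_mul (c := (s^n)⁻¹) h1 (measurable_KKx ℓ x).aestronglyMeasurable ?_
  filter_upwards [ae_restrict_mem (measurableSet_Ann x s t)] with y hy
  exact KK_bound ℓ hs hy.1.le

/-- volume of unit ball -/
def vb (n : ℕ) : ℝ := (volume (Metric.ball (0 : EE n) 1)).toReal

lemma vb_nonneg (n : ℕ) : 0 ≤ vb n := ENNReal.toReal_nonneg

lemma vol_closedBall (x : EE n) {R : ℝ} (hR : 0 ≤ R) :
    volume (Metric.closedBall x R) = ENNReal.ofReal (R ^ n * vb n) := by
  rw [Measure.addHaar_closedBall _ _ hR, ENNReal.ofReal_mul (by positivity), vb,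
    ENNReal.ofReal_toReal measure_ball_lt_top.ne]
  simp

lemma vol_ball (x : EE n) {R : ℝ} (hR : 0 < R) :
    volume (Metric.ball x R) = ENNReal.ofReal (R ^ n * vb n) := by
  rw [Measure.addHaar_ball_of_pos _ _ hR, ENNReal.ofReal_mul (by positivity), vb,
    ENNReal.ofReal_toReal measure_ball_lt_top.ne]
  simp

lemma vol_shell (x : EE n) (hn : 1 ≤ n) {s d R q : ℝ} (hR : 0 < R) (hs : R/2 ≤ s) (hs' : s ≤ R)
    (hq : 0 ≤ q) (hq1 : q ≤ 1) (hd : d = n * (q * R)) :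
    volume {y : EE n | |‖x - y‖ - s| ≤ d} ≤
      ENNReal.ofReal (4 * n * n * (n+1)^n * vb n * q * R ^ n) := by
  have hd0 : 0 ≤ d := by rw [hd]; positivity
  have hsub : {y : EE n | |‖x - y‖ - s| ≤ d} ⊆
      Metric.closedBall x (s + d) \ Metric.ball x (max (s - d) 0) := by
    intro y hy
    have hy' : |‖x - y‖ - s| ≤ d := hy
    rw [abs_le] at hy'
    rw [Set.mem_sdiff, Metric.mem_closedBall, Metric.mem_ball, dist_comm, dist_eq_norm, not_lt]
    refine ⟨by linarith [hy'.2], max_le (by linarith [hy'.1]) (norm_nonneg _)⟩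
  refine (measure_mono hsub).trans ?_
  have hb0 : (0:ℝ) ≤ max (s-d) 0 := le_max_right _ _
  have hbc : max (s-d) 0 ≤ s + d := max_le (by linarith) (by linarith)
  have hball : volume (Metric.ball x (max (s-d) 0)) = ENNReal.ofReal ((max (s-d) 0)^n * vb n) := by
    rcases hb0.eq_or_lt with h | h
    · rw [← h]; simp; omega
    · exact vol_ball x h
  rw [measure_sdiff (Metric.ball_subset_ball hbc |>.trans Metric.ball_subset_closedBall)
    measurableSet_ball.nullMeasurableSet measure_ball_lt_top.ne, hball,
    vol_closedBall x (by linarith), ← ENNReal.ofReal_sub _ (by have := vb_nonneg n; positivity)]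
  apply ENNReal.ofReal_le_ofReal
  rw [← sub_mul]
  have hv := vb_nonneg n
  have hcpos : 0 < s + d := by linarith
  have hcR : s + d ≤ (n+1) * R := by
    rw [hd]
    have : (n:ℝ) * (q * R) ≤ n * (1 * R) := by gcongr
    linarith
  have key : ((s+d)^n - (max (s-d) 0)^n) * (s+d) ≤ n * (2 * d) * (s+d)^n := by
    obtain ⟨m, rfl⟩ : ∃ m, n = m + 1 := ⟨n - 1, by omega⟩
    have := pow_diff m hb0 hbc
    have h2 : s + d - max (s-d) 0 ≤ 2 * d := by linarith [le_max_left (s-d) 0]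
    calc _ ≤ ((m+1) * (s + d - max (s-d) 0) * (s+d)^m) * (s+d) := by gcongr
      _ ≤ ((m+1) * (2*d) * (s+d)^m) * (s+d) := by gcongr
      _ = _ := by push_cast; ring
  have key2 : (s+d)^n - (max (s-d) 0)^n ≤ 4 * n * n * (n+1)^n * q * R^n := by
    have h3 : ((s+d)^n - (max (s-d) 0)^n) * (R/2) ≤ (4 * n * n * (n+1)^n * q * R^n) * (R/2) := by
      calc _ ≤ ((s+d)^n - (max (s-d) 0)^n) * (s+d) := by
            apply mul_le_mul_of_nonneg_left (by linarith)
            exact sub_nonneg.mpr (by gcongr)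
        _ ≤ n * (2 * d) * (s+d)^n := key
        _ ≤ n * (2 * d) * ((n+1)*R)^n := by gcongr
        _ = _ := by rw [hd, mul_pow]; ring
    exact le_of_mul_le_mul_right h3 (by positivity)
  calc _ ≤ (4 * n * n * (n+1)^n * q * R^n) * vb n := by gcongr
    _ = _ := by ring

/-- representative point of a cube -/
def rep (a : ℝ) (i : ℕ) (y : EE n) : EE n :=
  Classical.choose (⟨y, rfl⟩ : ∃ w : EE n, cidx a i w = cidx a i y)

lemma rep_spec (a : ℝ) (i : ℕ) (y : EE n) : cidx a i (rep a i y) = cidx a i y :=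
  Classical.choose_spec (⟨y, rfl⟩ : ∃ w : EE n, cidx a i w = cidx a i y)

lemma rep_LC (a : ℝ) (i : ℕ) : LC a i (rep a i : EE n → EE n) := by
  intro x y h
  unfold rep
  congr 1
  ext w
  rw [h]

open Classical in
def psi (ℓ : Fin n) (a : ℝ) (i : ℕ) (x : EE n) (s t : ℝ) (y : EE n) : ℝ :=
  if cube a i y ⊆ Ann x s t then KK ℓ (x - rep a i y) else 0

lemma psi_LC (ℓ : Fin n) (a : ℝ) (i : ℕ) (x : EE n) (s t : ℝ) : LC a i (psi ℓ a i x s t) := by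
  intro y z h
  unfold psi
  rw [cube_congr h, rep_LC a i y z h]

lemma psi_bound (ℓ : Fin n) (a : ℝ) (i : ℕ) (x : EE n) {s : ℝ} (hs : 0 < s) (t : ℝ) (y : EE n) :
    |psi ℓ a i x s t y| ≤ (s^n)⁻¹ := by
  unfold psi
  split_ifs with h
  · exact KK_bound ℓ hs (h (rep_spec a i y)).1.le
  · simp; positivity

lemma psi_int (ℓ : Fin n) (a : ℝ) (i : ℕ) (x : EE n) {s : ℝ} (hs : 0 < s) (t : ℝ)
    {g : EE n → ℝ} (hg : LocallyIntegrable g volume) :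
    IntegrableOn (fun y => psi ℓ a i x s t y * g y) (Ann x s t) := by
  have h1 : IntegrableOn g (Ann x s t) :=
    (hg.integrableOn_isCompact (isCompact_closedBall x t)).mono_set (Ann_subset x s t)
  exact Integrable.bdd_mul (c := (s^n)⁻¹) h1 (psi_LC ℓ a i x s t).measurable.aestronglyMeasurable
    (ae_of_all _ fun y => psi_bound ℓ a i x hs t y)

lemma psi_zero (ℓ : Fin n) (a : ℝ) (i : ℕ) (x : EE n) {s : ℝ} (hs : 0 < s) (t : ℝ)
    {g : EE n → ℝ} (hg : LocallyIntegrable g volume) (hz : MZ a i g) :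
    ∫ y in Ann x s t, psi ℓ a i x s t y * g y = 0 := by
  have e : (Ann x s t).indicator (fun y => psi ℓ a i x s t y * g y) =
      fun y => psi ℓ a i x s t y * g y := by
    apply indicator_eq_self.mpr
    intro y hy
    by_contra hcon
    apply hy
    have : psi ℓ a i x s t y = 0 := by
      unfold psi
      rw [if_neg (fun h => hcon (h (mem_cube_self a i y)))]
    simp [this]
  have hi := (psi_int ℓ a i x hs t hg).integrable_indicator (measurableSet_Ann x s t)
  rw [← integral_indicator (measurableSet_Ann x s t), e]
  rw [e] at hi
  exact int_zero (psi_LC ℓ a i x s t) hz hi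

def Cf (n : ℕ) : ℝ := (((n + 2) * 4 ^ (n+1) * n) ^ 2 + 4 ^ n * (8 * n * n * (n+1)^n)) * vb n

lemma Cf_nonneg (n : ℕ) : 0 ≤ Cf n := by
  unfold Cf; have := vb_nonneg n; positivity

lemma fine (hn : 1 ≤ n) (ℓ : Fin n) {a : ℝ} (ha : 0 < a) {i j : ℕ} (hij : j ≤ i) {g : EE n → ℝ}
    (hgm : Measurable g) (hg : LocallyIntegrable g volume) (hz : MZ a i g) (x : EE n) {s t : ℝ}
    (hs : rad a j / 2 ≤ s) (hst : s ≤ t) (ht : t ≤ rad a j) :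
    ‖TT ℓ s t g x‖ₑ ^ 2 ≤ ENNReal.ofReal (Cf n * (1/2)^(i-j) / rad a j ^ n) *
      ∫⁻ y in Ann x s t, ‖g y‖ₑ ^ 2 := by
  set R := rad a j with hRdef
  have hR : 0 < R := rad_pos ha j
  have hs0 : 0 < s := by linarith
  set q : ℝ := (1/2)^(i-j) with hq
  have hq0 : 0 ≤ q := by positivity
  have hq1 : q ≤ 1 := pow_le_one₀ (by norm_num) (by norm_num)
  have hri : rad a i = q * R := by
    have := rad_add a j (i - j)
    rw [Nat.add_sub_cancel' hij] at this
    rw [this, hq, hRdef]; ring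
  set u : EE n → ℝ := fun y => KK ℓ (x - y) - psi ℓ a i x s t y with hu
  have hum : Measurable u := (measurable_KKx ℓ x).sub (psi_LC ℓ a i x s t).measurable
  have e : TT ℓ s t g x = ∫ y in Ann x s t, u y * g y := by
    have : ∀ y, u y * g y = KK ℓ (x - y) * g y - psi ℓ a i x s t y * g y := by
      intro y; simp only [hu]; ring
    simp_rw [this]
    rw [integral_sub (integrableOn_KK ℓ hs0 t x hg) (psi_int ℓ a i x hs0 t hg),
      psi_zero ℓ a i x hs0 t hg hz, sub_zero]
    rfl
  rw [e]
  refine (int_cs _ hum.aemeasurable hgm.aemeasurable).trans ?_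
  gcongr ?_ * _
  set d : ℝ := n * (q * R) with hd
  set Sh : Set (EE n) := {y : EE n | |‖x - y‖ - s| ≤ d} ∪ {y : EE n | |‖x - y‖ - t| ≤ d} with hSh
  have hShm : MeasurableSet Sh := by
    apply MeasurableSet.union <;>
    exact (isClosed_le (by fun_prop) continuous_const).measurableSet
  set C1 : ℝ := (n + 2) * 4 ^ (n+1) * n with hC1
  have hpt : ∀ y ∈ Ann x s t, ‖u y‖ₑ ^ 2 ≤ ENNReal.ofReal ((C1 * q / R^n)^2) +
      Sh.indicator (fun _ => ENNReal.ofReal (4^n / (R^n)^2)) y := by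
    intro y hy
    rw [← enorm_pow, Real.enorm_eq_ofReal (sq_nonneg _)]
    by_cases hsub : cube a i y ⊆ Ann x s t
    · refine le_trans ?_ le_self_add
      apply ENNReal.ofReal_le_ofReal
      rw [← sq_abs]
      have h1 := hsub (rep_spec a i y)
      have h2 := KK_lip ℓ hR (z := x - y) (w := x - rep a i y) (by linarith [hy.1]) (hy.2.trans ht)
        (by linarith [h1.1]) (h1.2.trans ht)
      have h3 : ‖(x - y) - (x - rep a i y)‖ ≤ d := by
        have := norm_cube_le ha (show rep a i y ∈ cube a i y from rep_spec a i y)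
        rw [hd, ← hri]
        convert this using 2
        abel
      have h4 : |u y| ≤ C1 * q / R^n := by
        simp only [hu, psi, if_pos hsub]
        refine h2.trans ?_
        calc _ ≤ (n + 2) * 4 ^ (n+1) * d / R ^ (n+1) := by gcongr
          _ = _ := by rw [hd, hC1, pow_succ]; field_simp; ring
      gcongr
    · refine le_trans ?_ le_add_self
      have hyS : y ∈ Sh := by
        obtain ⟨w, hw, hwA⟩ := not_subset.mp hsub
        have h3 : ‖w - y‖ ≤ d := by
          have := norm_cube_le ha hw
          rwa [hri] at this
        have h4 : |‖x - y‖ - ‖x - w‖| ≤ d := by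
          refine (abs_norm_sub_norm_le _ _).trans ?_
          rw [show (x - y) - (x - w) = w - y by abel]
          exact h3
        rw [abs_le] at h4
        have hy1 := hy.1
        have hy2 := hy.2
        by_cases hws : s < ‖x - w‖
        · have hwt : t < ‖x - w‖ := by
            by_contra hc
            exact hwA ⟨hws, not_lt.mp hc⟩
          right
          change |‖x - y‖ - t| ≤ d
          rw [abs_le]; constructor <;> linarith [h4.1, h4.2]
        · left
          change |‖x - y‖ - s| ≤ d
          rw [not_lt] at hws
          rw [abs_le]; constructor <;> linarith [h4.1, h4.2]
      rw [indicator_of_mem hyS]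
      apply ENNReal.ofReal_le_ofReal
      simp only [hu, psi, if_neg hsub, sub_zero]
      rw [← sq_abs]
      have h5 := KK_bound ℓ (s := R/2) (by positivity) (z := x - y) (by linarith [hy.1])
      calc |KK ℓ (x - y)|^2 ≤ (((R/2)^n)⁻¹)^2 := by gcongr
        _ = _ := by
          rw [div_pow]
          have : (4:ℝ)^n = (2^n)^2 := by rw [← pow_mul, mul_comm, pow_mul]; norm_num
          rw [this]; field_simp
  calc ∫⁻ y in Ann x s t, ‖u y‖ₑ ^ 2
      ≤ ∫⁻ y in Ann x s t, (ENNReal.ofReal ((C1 * q / R^n)^2) +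
        Sh.indicator (fun _ => ENNReal.ofReal (4^n / (R^n)^2)) y) :=
        setLIntegral_mono' (measurableSet_Ann x s t) hpt
    _ = ENNReal.ofReal ((C1 * q / R^n)^2) * volume (Ann x s t) +
        ∫⁻ y in Ann x s t, Sh.indicator (fun _ => ENNReal.ofReal (4^n / (R^n)^2)) y := by
        rw [lintegral_add_left measurable_const, setLIntegral_const]
    _ ≤ ENNReal.ofReal ((C1 * q / R^n)^2) * ENNReal.ofReal (R^n * vb n) +
        ENNReal.ofReal (4^n / (R^n)^2) * (ENNReal.ofReal (4 * n * n * (n+1)^n * vb n * q * R ^ n)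
          + ENNReal.ofReal (4 * n * n * (n+1)^n * vb n * q * R ^ n)) := by
        refine add_le_add (mul_le_mul_right ?_ _) ?_
        · rw [← vol_closedBall x hR.le]
          exact measure_mono ((Ann_subset x s t).trans (Metric.closedBall_subset_closedBall ht))
        · refine (setLIntegral_le_lintegral _ _).trans ?_
          rw [lintegral_indicator_const hShm]
          gcongr
          refine (measure_union_le _ _).trans ?_
          gcongr
          · exact vol_shell x hn hR hs (hst.trans ht) hq0 hq1 hd
          · exact vol_shell x hn hR (hs.trans hst) ht hq0 hq1 hd
    _ ≤ _ := by
        have hv := vb_nonneg n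
        rw [← ENNReal.ofReal_add (by positivity) (by positivity), ← ENNReal.ofReal_mul (by positivity),
          ← ENNReal.ofReal_mul (by positivity), ← ENNReal.ofReal_add (by positivity) (by positivity)]
        apply ENNReal.ofReal_le_ofReal
        have h1 : (C1 * q / R^n)^2 * (R^n * vb n) ≤ C1^2 * vb n * q / R^n := by
          have : (C1 * q / R^n)^2 * (R^n * vb n) = (C1^2 * vb n / R^n) * (q * q) := by
            field_simp
          rw [this]
          calc _ ≤ (C1^2 * vb n / R^n) * (q * 1) := by gcongr
            _ = _ := by ring
        refine (add_le_add h1 le_rfl).trans (le_of_eq ?_)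
        unfold Cf
        rw [hC1]
        field_simp
        ring

end VR

namespace VR
variable {n : ℕ}

/-- neighbourhood of the boundary of the cubes of level `i`, at scale `j` -/
def Bd (a : ℝ) (i j : ℕ) : Set (EE n) :=
  {y | ∃ c, Int.fract (y c / rad a i) ≤ 2 * (1/2)^(j-i) ∨
    1 - 2 * (1/2)^(j-i) ≤ Int.fract (y c / rad a i)}

lemma measurableSet_Bd (a : ℝ) (i j : ℕ) : MeasurableSet (Bd a i j : Set (EE n)) := by
  have : (Bd a i j : Set (EE n)) = ⋃ c, ({y : EE n | Int.fract (y c / rad a i) ≤ 2 * (1/2)^(j-i)} ∪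
    {y : EE n | 1 - 2 * (1/2)^(j-i) ≤ Int.fract (y c / rad a i)}) := by
    ext y; simp [Bd]
  rw [this]
  refine MeasurableSet.iUnion fun c => ?_
  have hm : Measurable fun y : EE n => Int.fract (y c / rad a i) :=
    measurable_fract.comp ((by fun_prop : Continuous fun y : EE n => y c / rad a i).measurable)
  exact (measurableSet_le hm measurable_const).union (measurableSet_le measurable_const hm)

lemma fract_bd {u v δ : ℝ} (h : |u - v| ≤ δ) (hne : ⌊u⌋ ≠ ⌊v⌋) :
    Int.fract v ≤ δ ∨ 1 - δ ≤ Int.fract v := by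
  rw [abs_le] at h
  unfold Int.fract
  rcases lt_or_gt_of_ne hne with h1 | h1
  · left
    have h2 : u < ⌊v⌋ := Int.floor_lt.mp h1
    linarith [h.1]
  · right
    have h2 : (⌊v⌋ : ℝ) + 1 ≤ ⌊u⌋ := by exact_mod_cast h1
    linarith [h.2, Int.floor_le u]

lemma mem_Bd {a : ℝ} (ha : 0 < a) {i j : ℕ} (hij : i ≤ j) {z y : EE n}
    (h : ‖z - y‖ ≤ 2 * rad a j) (hne : cidx a i z ≠ cidx a i y) : y ∈ Bd a i j := by
  have hr := rad_pos ha i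
  have hrj : rad a j = rad a i * (1/2)^(j-i) := by
    have := rad_add a i (j - i)
    rwa [Nat.add_sub_cancel' hij] at this
  obtain ⟨c, hc⟩ := Function.ne_iff.mp hne
  refine ⟨c, fract_bd (u := z c / rad a i) ?_ hc⟩
  rw [← sub_div, abs_div, abs_of_pos hr, div_le_iff₀ hr]
  calc |z c - y c| = |(z - y) c| := by simp
    _ ≤ ‖z - y‖ := abs_coord_le _ _
    _ ≤ _ := by rw [hrj] at h; linarith

lemma odd_zero (ℓ : Fin n) (x : EE n) (s t : ℝ) : ∫ y in Ann x s t, KK ℓ (x - y) = 0 := by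
  set A : Set (EE n) := {z | s < ‖z‖ ∧ ‖z‖ ≤ t} with hA
  set φ : EE n → ℝ := A.indicator (KK ℓ) with hφ
  rw [← integral_indicator (measurableSet_Ann x s t)]
  have e : (Ann x s t).indicator (fun y => KK ℓ (x - y)) = fun y => φ (x - y) := by
    ext y
    by_cases h : s < ‖x - y‖ ∧ ‖x - y‖ ≤ t
    · rw [indicator_of_mem (show y ∈ Ann x s t from h), hφ,
        indicator_of_mem (show x - y ∈ A from h)]
    · rw [indicator_of_notMem (show y ∉ Ann x s t from h), hφ,
        indicator_of_notMem (show x - y ∉ A from h)]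
  rw [e, integral_sub_left_eq_self φ volume x]
  have hodd : ∀ z, φ (-z) = - φ z := by
    intro z
    by_cases h : s < ‖z‖ ∧ ‖z‖ ≤ t
    · rw [hφ, indicator_of_mem (show z ∈ A from h),
        indicator_of_mem (show -z ∈ A from by rw [hA]; simpa using h)]
      unfold KK
      simp [neg_div]
    · rw [hφ, indicator_of_notMem (show z ∉ A from h),
        indicator_of_notMem (show -z ∉ A from by rw [hA]; simpa using h)]
      simp
  have h1 : ∫ z, φ (-z) = ∫ z, φ z := integral_neg_eq_self φ volume
  simp_rw [hodd] at h1
  rw [integral_neg] at h1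
  linarith

lemma coarse (ℓ : Fin n) {a : ℝ} (ha : 0 < a) {i j : ℕ} (hij : i ≤ j) {h : EE n → ℝ}
    (hh : LC a i h) (x : EE n) {s t : ℝ}
    (hs : rad a j / 2 ≤ s) (ht : t ≤ rad a j) :
    ‖TT ℓ s t h x‖ₑ ^ 2 ≤ ENNReal.ofReal (4^n * vb n / rad a j ^ n) *
      ∫⁻ y in Ann x s t, (Bd a i j).indicator 1 y * ‖h y‖ₑ ^ 2 := by
  set R := rad a j with hRdef
  have hR : 0 < R := rad_pos ha j
  have hs0 : 0 < s := by linarith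
  by_cases hall : ∀ y ∈ Ann x s t, cidx a i y = cidx a i x
  · have : TT ℓ s t h x = 0 := by
      unfold TT
      rw [setIntegral_congr_fun (measurableSet_Ann x s t)
        (g := fun y => KK ℓ (x - y) * h x) (fun y hy => by
          simp only [hh y x (hall y hy)]), integral_mul_const, odd_zero, zero_mul]
    rw [this]; simp
  · push Not at hall
    obtain ⟨y0, hy0, hne⟩ := hall
    have hB : ∀ y ∈ Ann x s t, y ∈ Bd a i j := by
      intro y hy
      by_cases h0 : cidx a i y = cidx a i x
      · apply mem_Bd ha hij (z := y0)
        · calc ‖y0 - y‖ = ‖(x - y) - (x - y0)‖ := by congr 1; abel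
            _ ≤ ‖x - y‖ + ‖x - y0‖ := norm_sub_le _ _
            _ ≤ _ := by linarith [hy.2, hy0.2]
        · rw [h0]; exact hne
      · apply mem_Bd ha hij (z := x)
        · linarith [hy.2]
        · exact fun h => h0 h.symm
    have e : ∫⁻ y in Ann x s t, (Bd a i j).indicator 1 y * ‖h y‖ₑ ^ 2 =
        ∫⁻ y in Ann x s t, ‖h y‖ₑ ^ 2 := by
      apply setLIntegral_congr_fun (measurableSet_Ann x s t)
      intro y hy
      simp [indicator_of_mem (hB y hy)]
    rw [e]
    refine (int_cs _ (measurable_KKx ℓ x).aemeasurable hh.measurable.aemeasurable).trans ?_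
    gcongr ?_ * _
    calc ∫⁻ y in Ann x s t, ‖KK ℓ (x - y)‖ₑ ^ 2
        ≤ ∫⁻ y in Ann x s t, ENNReal.ofReal (4^n / (R^n)^2) := by
          apply setLIntegral_mono' (measurableSet_Ann x s t)
          intro y hy
          rw [← enorm_pow, Real.enorm_eq_ofReal (sq_nonneg _)]
          apply ENNReal.ofReal_le_ofReal
          rw [← sq_abs]
          have h5 := KK_bound ℓ (s := R/2) (by positivity) (z := x - y) (by linarith [hy.1])
          calc |KK ℓ (x - y)|^2 ≤ (((R/2)^n)⁻¹)^2 := by gcongr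
            _ = _ := by
              rw [div_pow]
              have : (4:ℝ)^n = (2^n)^2 := by rw [← pow_mul, mul_comm, pow_mul]; norm_num
              rw [this]; field_simp
      _ = ENNReal.ofReal (4^n / (R^n)^2) * volume (Ann x s t) := setLIntegral_const _ _
      _ ≤ ENNReal.ofReal (4^n / (R^n)^2) * ENNReal.ofReal (R^n * vb n) := by
          refine mul_le_mul_right ?_ _
          rw [← vol_closedBall x hR.le]
          exact measure_mono ((Ann_subset x s t).trans (Metric.closedBall_subset_closedBall ht))
      _ = _ := by
          rw [← ENNReal.ofReal_mul (by positivity)]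
          congr 1
          field_simp

lemma vol_cube_Bd {a : ℝ} (ha : 0 < a) (i j : ℕ) (x : EE n) :
    volume (cube a i x ∩ Bd a i j) ≤ ENNReal.ofReal (4 * n * (1/2)^(j-i)) * volume (cube a i x) := by
  set δ : ℝ := 2 * (1/2)^(j-i) with hδ
  have hδ0 : 0 ≤ δ := by positivity
  set r := rad a i with hr
  have hr0 : 0 < r := rad_pos ha i
  set z := cidx a i x with hz
  classical
  set S : Fin n → Fin n → Set ℝ := fun c c' => if c' = c then
    Icc (r * z c) (r * z c + δ * r) ∪ Icc (r * z c + r - δ * r) (r * z c + r)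
    else Ico (r * z c') (r * z c' + r) with hS
  have hsub : cube a i x ∩ Bd a i j ⊆ ⋃ c, {y : EE n | ∀ c', y c' ∈ S c c'} := by
    rintro y ⟨hy, c, hc⟩
    rw [mem_iUnion]
    refine ⟨c, fun c' => ?_⟩
    have hI : ∀ c', r * z c' ≤ y c' ∧ y c' < r * z c' + r := fun c' =>
      mem_Ico_of_floor hr0 (congrFun hy c')
    by_cases hcc : c' = c
    · subst hcc
      simp only [hS, if_true]
      have hfl : ⌊y c' / r⌋ = z c' := congrFun hy c'
      have hfr : Int.fract (y c' / r) = y c' / r - z c' := by rw [Int.fract, hfl]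
      rw [hfr] at hc
      rcases hc with hc | hc
      · left
        refine ⟨(hI c').1, ?_⟩
        rw [sub_le_iff_le_add, div_le_iff₀ hr0] at hc
        linarith
      · right
        refine ⟨?_, (hI c').2.le⟩
        rw [le_sub_iff_add_le, le_div_iff₀ hr0] at hc
        linarith
    · simp only [hS, if_neg hcc]
      exact hI c'
  have hv : ∀ c, volume {y : EE n | ∀ c', y c' ∈ S c c'} ≤
      ENNReal.ofReal (2 * δ) * ENNReal.ofReal (r^n) := by
    intro c
    rw [volume_box]
    calc ∏ c', volume (S c c') ≤ ∏ c' : Fin n, ((if c' = c then ENNReal.ofReal (2*δ) else 1) *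
          ENNReal.ofReal r) := by
          apply Finset.prod_le_prod' 
          intro c' _
          by_cases hcc : c' = c
          · simp only [hS, if_pos hcc]
            refine (measure_union_le _ _).trans ?_
            rw [Real.volume_Icc, Real.volume_Icc, ← ENNReal.ofReal_mul (by positivity),
              ← ENNReal.ofReal_add (by ring_nf; positivity) (by ring_nf; positivity)]
            apply ENNReal.ofReal_le_ofReal
            linarith
          · simp only [hS, if_neg hcc, Real.volume_Ico, one_mul]
            apply ENNReal.ofReal_le_ofReal
            linarith
      _ = _ := by
          rw [Finset.prod_mul_distrib, Finset.prod_ite_eq']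
          simp [ENNReal.ofReal_pow hr0.le]
  refine (measure_mono hsub).trans ((measure_iUnion_le _).trans ?_)
  rw [tsum_fintype]
  refine (Finset.sum_le_sum fun c _ => hv c).trans ?_
  rw [volume_cube ha, Finset.sum_const, Finset.card_univ, Fintype.card_fin, nsmul_eq_mul, ← mul_assoc]
  refine mul_le_mul_left (le_of_eq ?_) _
  rw [← ENNReal.ofReal_natCast, ← ENNReal.ofReal_mul (by positivity)]
  congr 1
  rw [hδ]; ring

/-- the weights -/
def bb (a : ℝ) (i j : ℕ) (y : EE n) : ℝ≥0∞ :=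
  if i ≤ j then (Bd a i j).indicator 1 y else ENNReal.ofReal ((1/2)^(i-j))

lemma measurable_bb (a : ℝ) (i j : ℕ) : Measurable (bb a i j : EE n → ℝ≥0∞) := by
  unfold bb
  split_ifs
  · exact measurable_one.indicator (measurableSet_Bd a i j)
  · exact measurable_const

def dd (i j : ℕ) : ℕ := (i - j) + (j - i)

def C0 (n : ℕ) : ℝ := 4^n * vb n + 2 * Cf n

lemma C0_nonneg (n : ℕ) : 0 ≤ C0 n := by
  unfold C0; have := vb_nonneg n; have := Cf_nonneg n; positivity

lemma mixed (hn : 1 ≤ n) (ℓ : Fin n) {a : ℝ} (ha : 0 < a) {i j : ℕ} {h : EE n → ℝ}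
    (hL2 : IsL2 h) (hL : i ≤ j → LC a i h) (hZ : j < i → MZ a (i-1) h) (x : EE n) {s t : ℝ}
    (hs : rad a j / 2 ≤ s) (hst : s ≤ t) (ht : t ≤ rad a j) :
    ‖TT ℓ s t h x‖ₑ ^ 2 ≤ ENNReal.ofReal (C0 n / rad a j ^ n) *
      ∫⁻ y in Ann x s t, bb a i j y * ‖h y‖ₑ ^ 2 := by
  have hR := rad_pos ha j
  have hv := vb_nonneg n
  have hC := Cf_nonneg n
  rcases le_or_gt i j with hij | hij
  · refine (coarse ℓ ha hij (hL hij) x hs ht).trans ?_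
    simp only [bb, if_pos hij]
    refine mul_le_mul_left (ENNReal.ofReal_le_ofReal ?_) _
    unfold C0
    gcongr
    linarith
  · refine (fine hn ℓ ha (i := i - 1) (by omega) hL2.meas hL2.locInt (hZ hij) x hs hst ht).trans ?_
    simp only [bb, if_neg (not_le.mpr hij)]
    rw [lintegral_const_mul _ (by have := hL2.meas; fun_prop), ← mul_assoc,
      ← ENNReal.ofReal_mul (by have := C0_nonneg n; positivity)]
    refine mul_le_mul_left (ENNReal.ofReal_le_ofReal ?_) _
    have e : (1/2 : ℝ)^(i-j) = (1/2)^(i-1-j) * (1/2) := by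
      rw [← pow_succ]; congr 1; omega
    have : C0 n / rad a j ^ n * (1/2)^(i-j) = (C0 n / 2) * (1/2)^(i-1-j) / rad a j ^ n := by
      rw [e]; ring
    rw [this]
    gcongr
    unfold C0
    have : 0 ≤ 4^n * vb n := by positivity
    linarith

lemma bb_int {a : ℝ} (ha : 0 < a) {i j : ℕ} {h : EE n → ℝ} (hL : i ≤ j → LC a i h) 
    (hm : Measurable h) :
    ∫⁻ y, bb a i j y * ‖h y‖ₑ ^ 2 ≤ ENNReal.ofReal ((4 * n + 1) * (1/2)^(dd i j)) * Sq h := by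
  rcases le_or_gt i j with hij | hij
  · simp only [bb, if_pos hij]
    have h1 : LC a i (fun y => ‖h y‖ₑ ^ 2) := fun x y hxy => by simp only [hL hij x y hxy]
    have h2 := lint_le (u := (Bd a i j).indicator 1)
      (v := fun _ => ENNReal.ofReal (4 * n * (1/2)^(j-i))) h1
      (measurable_one.indicator (measurableSet_Bd a i j)) measurable_const (by
        intro x
        rw [setLIntegral_const, lintegral_indicator_one (measurableSet_Bd a i j),
          Measure.restrict_apply (measurableSet_Bd a i j), inter_comm]
        exact vol_cube_Bd ha i j x)
    simp_rw [mul_comm ((Bd a i j).indicator 1 _)]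
    refine h2.trans ?_
    rw [lintegral_mul_const _ (by fun_prop), mul_comm]
    refine mul_le_mul_left (ENNReal.ofReal_le_ofReal ?_) _
    have : dd i j = j - i := by unfold dd; omega
    rw [this]
    gcongr
    linarith
  · simp only [bb, if_neg (not_le.mpr hij)]
    rw [lintegral_const_mul _ (by fun_prop)]
    refine mul_le_mul_left (ENNReal.ofReal_le_ofReal ?_) _
    have : dd i j = i - j := by unfold dd; omega
    rw [this]
    have : 0 ≤ (4 * n : ℝ) * (1/2)^(i-j) := by positivity
    linarith

lemma tonelli {s t : ℝ} (ht : 0 ≤ t) {w : EE n → ℝ≥0∞} (hw : Measurable w) :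
    ∫⁻ x, ∫⁻ y in Ann x s t, w y ≤ ENNReal.ofReal (t^n * vb n) * ∫⁻ y, w y := by
  set P : Set (EE n × EE n) := {p | s < ‖p.1 - p.2‖ ∧ ‖p.1 - p.2‖ ≤ t} with hP
  have hPm : MeasurableSet P := by
    have h1 : MeasurableSet {p : EE n × EE n | s < ‖p.1 - p.2‖} :=
      (isOpen_lt continuous_const (by fun_prop)).measurableSet
    have h2 : MeasurableSet {p : EE n × EE n | ‖p.1 - p.2‖ ≤ t} :=
      (isClosed_le (by fun_prop) continuous_const).measurableSet
    exact h1.inter h2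
  have hF : Measurable (P.indicator (fun p => w p.2)) := (hw.comp measurable_snd).indicator hPm
  have e1 : ∀ x, ∫⁻ y in Ann x s t, w y = ∫⁻ y, P.indicator (fun p => w p.2) (x, y) := by
    intro x
    rw [← lintegral_indicator (measurableSet_Ann x s t)]
    rfl
  simp_rw [e1]
  rw [lintegral_lintegral_swap (f := fun x y => P.indicator (fun p => w p.2) (x, y))
    hF.aemeasurable, ← lintegral_const_mul _ hw]
  apply lintegral_mono
  intro y
  calc ∫⁻ x, P.indicator (fun p => w p.2) (x, y)
      ≤ ∫⁻ x, (Metric.closedBall y t).indicator (fun _ => w y) x := by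
        apply lintegral_mono
        intro x
        by_cases hx : (x, y) ∈ P
        · simp only
          rw [indicator_of_mem hx, indicator_of_mem]
          rw [Metric.mem_closedBall, dist_eq_norm]; exact hx.2
        · simp only
          rw [indicator_of_notMem hx]; simp
    _ = ENNReal.ofReal (t^n * vb n) * w y := by
        rw [lintegral_indicator_const measurableSet_closedBall, vol_closedBall y ht, mul_comm]

end VR

namespace VR
variable {n : ℕ}

lemma lint_KK_sq (ℓ : Fin n) {R : ℝ} (hR : 0 < R) (x : EE n) {s t : ℝ}
    (hs : R / 2 ≤ s) (ht : t ≤ R) :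
    ∫⁻ y in Ann x s t, ‖KK ℓ (x - y)‖ₑ ^ 2 ≤ ENNReal.ofReal (4^n * vb n / R ^ n) := by
  calc ∫⁻ y in Ann x s t, ‖KK ℓ (x - y)‖ₑ ^ 2
      ≤ ∫⁻ y in Ann x s t, ENNReal.ofReal (4^n / (R^n)^2) := by
        apply setLIntegral_mono' (measurableSet_Ann x s t)
        intro y hy
        rw [← enorm_pow, Real.enorm_eq_ofReal (sq_nonneg _)]
        apply ENNReal.ofReal_le_ofReal
        rw [← sq_abs]
        have h5 := KK_bound ℓ (s := R/2) (by positivity) (z := x - y) (by linarith [hy.1])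
        calc |KK ℓ (x - y)|^2 ≤ (((R/2)^n)⁻¹)^2 := by gcongr
          _ = _ := by
            rw [div_pow]
            have : (4:ℝ)^n = (2^n)^2 := by rw [← pow_mul, mul_comm, pow_mul]; norm_num
            rw [this]; field_simp
    _ = ENNReal.ofReal (4^n / (R^n)^2) * volume (Ann x s t) := setLIntegral_const _ _
    _ ≤ ENNReal.ofReal (4^n / (R^n)^2) * ENNReal.ofReal (R^n * vb n) := by
        refine mul_le_mul_right ?_ _
        rw [← vol_closedBall x hR.le]
        exact measure_mono ((Ann_subset x s t).trans (Metric.closedBall_subset_closedBall ht))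
    _ = _ := by
        rw [← ENNReal.ofReal_mul (by positivity)]
        congr 1
        field_simp

/-- the set of pairs at distance between `s` and `t` -/
def PP (n : ℕ) (s t : ℝ) : Set (EE n × EE n) := {p | s < ‖p.1 - p.2‖ ∧ ‖p.1 - p.2‖ ≤ t}

lemma measurableSet_PP (s t : ℝ) : MeasurableSet (PP n s t) := by
  have h1 : MeasurableSet {p : EE n × EE n | s < ‖p.1 - p.2‖} :=
    (isOpen_lt continuous_const (by fun_prop)).measurableSet
  have h2 : MeasurableSet {p : EE n × EE n | ‖p.1 - p.2‖ ≤ t} :=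
    (isClosed_le (by fun_prop) continuous_const).measurableSet
  exact h1.inter h2

lemma measurable_KKp (ℓ : Fin n) : Measurable (fun p : EE n × EE n => KK ℓ (p.1 - p.2)) :=
  (measurable_KK ℓ).comp (by fun_prop)

lemma TT_eq (ℓ : Fin n) (s t : ℝ) (g : EE n → ℝ) (x : EE n) :
    TT ℓ s t g x = ∫ y, (PP n s t).indicator (fun p => KK ℓ (p.1 - p.2) * g p.2) (x, y) := by
  unfold TT
  rw [← integral_indicator (measurableSet_Ann x s t)]
  rfl

lemma measurable_TT (ℓ : Fin n) (s t : ℝ) {g : EE n → ℝ} (hg : Measurable g) :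
    Measurable (TT ℓ s t g) := by
  have e : TT ℓ s t g = fun x =>
      ∫ y, (PP n s t).indicator (fun p => KK ℓ (p.1 - p.2) * g p.2) (x, y) := by
    ext x; exact TT_eq ℓ s t g x
  rw [e]
  have hm : Measurable ((PP n s t).indicator (fun p => KK ℓ (p.1 - p.2) * g p.2)) :=
    ((measurable_KKp ℓ).mul (hg.comp measurable_snd)).indicator (measurableSet_PP s t)
  exact (hm.stronglyMeasurable.integral_prod_right (f := fun x y =>
    (PP n s t).indicator (fun p => KK ℓ (p.1 - p.2) * g p.2) (x, y))).measurable

lemma measurable_annint (s t : ℝ) {w : EE n → ℝ≥0∞} (hw : Measurable w) :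
    Measurable (fun x => ∫⁻ y in Ann x s t, w y) := by
  have e : (fun x => ∫⁻ y in Ann x s t, w y) = fun x =>
      ∫⁻ y, (PP n s t).indicator (fun p => w p.2) (x, y) := by
    ext x
    rw [← lintegral_indicator (measurableSet_Ann x s t)]
    rfl
  rw [e]
  exact Measurable.lintegral_prod_right
    ((hw.comp measurable_snd).indicator (measurableSet_PP s t))

lemma TT_add (ℓ : Fin n) {s : ℝ} (hs : 0 < s) (t : ℝ) {g h : EE n → ℝ}
    (hg : LocallyIntegrable g volume) (hh : LocallyIntegrable h volume) (x : EE n) :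
    TT ℓ s t (fun y => g y + h y) x = TT ℓ s t g x + TT ℓ s t h x := by
  unfold TT
  rw [← integral_add (integrableOn_KK ℓ hs t x hg) (integrableOn_KK ℓ hs t x hh)]
  congr 1
  ext y
  ring

/-- dyadic pieces -/
def DD (ℓ : Fin n) (a : ℝ) (j : ℕ) (g : EE n → ℝ) : EE n → ℝ := TT ℓ (rad a (j+1)) (rad a j) g

lemma DD_crude (ℓ : Fin n) {a : ℝ} (ha : 0 < a) (j : ℕ) {g : EE n → ℝ} (hg : Measurable g) :
    Sq (DD ℓ a j g) ≤ ENNReal.ofReal (4^n * vb n * vb n) * Sq g := by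
  have hR := rad_pos ha j
  have hv := vb_nonneg n
  calc Sq (DD ℓ a j g) ≤ ∫⁻ x, ENNReal.ofReal (4^n * vb n / rad a j ^ n) *
        ∫⁻ y in Ann x (rad a (j+1)) (rad a j), ‖g y‖ₑ ^ 2 := by
        apply lintegral_mono
        intro x
        refine (int_cs _ (measurable_KKx ℓ x).aemeasurable hg.aemeasurable).trans ?_
        exact mul_le_mul_left (lint_KK_sq ℓ hR x (by rw [rad_succ]) le_rfl) _
    _ = ENNReal.ofReal (4^n * vb n / rad a j ^ n) *
        ∫⁻ x, ∫⁻ y in Ann x (rad a (j+1)) (rad a j), ‖g y‖ₑ ^ 2 :=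
        lintegral_const_mul _ (measurable_annint _ _ (by fun_prop))
    _ ≤ ENNReal.ofReal (4^n * vb n / rad a j ^ n) *
        (ENNReal.ofReal (rad a j ^ n * vb n) * Sq g) :=
        mul_le_mul_right (tonelli hR.le (by fun_prop)) _
    _ = _ := by
        rw [← mul_assoc, ← ENNReal.ofReal_mul (by positivity)]
        congr 2
        field_simp

lemma DD_L2 (ℓ : Fin n) {a : ℝ} (ha : 0 < a) (j : ℕ) {g : EE n → ℝ} (hg : IsL2 g) :
    IsL2 (DD ℓ a j g) :=
  ⟨measurable_TT ℓ _ _ hg.meas, ((DD_crude ℓ ha j hg.meas).trans_lt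
    (ENNReal.mul_lt_top ENNReal.ofReal_lt_top hg.fin.lt_top)).ne⟩

def C2 (n : ℕ) : ℝ := C0 n * vb n * (4 * n + 1)

lemma C2_nonneg (n : ℕ) : 0 ≤ C2 n := by
  unfold C2; have := vb_nonneg n; have := C0_nonneg n; positivity

lemma DD_mixed (hn : 1 ≤ n) (ℓ : Fin n) {a : ℝ} (ha : 0 < a) {i j : ℕ} {h : EE n → ℝ}
    (hL2 : IsL2 h) (hL : i ≤ j → LC a i h) (hZ : j < i → MZ a (i-1) h) :
    Sq (DD ℓ a j h) ≤ ENNReal.ofReal (C2 n * (1/2)^(dd i j)) * Sq h := by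
  have hR := rad_pos ha j
  have hv := vb_nonneg n
  have hC := C0_nonneg n
  have hmb : Measurable fun y => bb a i j y * ‖h y‖ₑ ^ 2 := by
    have := hL2.meas
    exact (measurable_bb a i j).mul (by fun_prop)
  calc Sq (DD ℓ a j h) ≤ ∫⁻ x, ENNReal.ofReal (C0 n / rad a j ^ n) *
        ∫⁻ y in Ann x (rad a (j+1)) (rad a j), bb a i j y * ‖h y‖ₑ ^ 2 := by
        apply lintegral_mono
        intro x
        exact mixed hn ℓ ha hL2 hL hZ x (by rw [rad_succ]) (by rw [rad_succ]; linarith) le_rfl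
    _ = ENNReal.ofReal (C0 n / rad a j ^ n) *
        ∫⁻ x, ∫⁻ y in Ann x (rad a (j+1)) (rad a j), bb a i j y * ‖h y‖ₑ ^ 2 :=
        lintegral_const_mul _ (measurable_annint _ _ hmb)
    _ ≤ ENNReal.ofReal (C0 n / rad a j ^ n) *
        (ENNReal.ofReal (rad a j ^ n * vb n) *
          (ENNReal.ofReal ((4 * n + 1) * (1/2)^(dd i j)) * Sq h)) :=
        mul_le_mul_right ((tonelli hR.le hmb).trans
          (mul_le_mul_right (bb_int ha hL hL2.meas) _)) _
    _ = _ := by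
        rw [← mul_assoc, ← mul_assoc, ← ENNReal.ofReal_mul (by positivity),
          ← ENNReal.ofReal_mul (by positivity)]
        congr 2
        unfold C2
        field_simp

lemma duality (ℓ : Fin n) {a : ℝ} (ha : 0 < a) (j : ℕ) {f u : EE n → ℝ} (hf : IsL2 f)
    (hu : IsL2 u) : ∫ x, u x * DD ℓ a j f x = - ∫ x, DD ℓ a j u x * f x := by
  have hR := rad_pos ha j
  have hR1 := rad_pos ha (j+1)
  set s := rad a (j+1) with hs
  set t := rad a j with ht
  set F : EE n → EE n → ℝ := fun x y =>
    (PP n s t).indicator (fun p => KK ℓ (p.1 - p.2) * (u p.1 * f p.2)) (x, y) with hF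
  have hfm := hf.meas
  have hum := hu.meas
  have hFm : Measurable (Function.uncurry F) := 
    ((measurable_KKp ℓ).mul ((hu.meas.comp measurable_fst).mul (hf.meas.comp measurable_snd))).indicator
      (measurableSet_PP s t)
  have hFi : Integrable (Function.uncurry F) (volume.prod volume) := by
    refine ⟨hFm.aestronglyMeasurable, ?_⟩
    rw [hasFiniteIntegral_iff_enorm, lintegral_prod _ hFm.enorm.aemeasurable]
    have hb : ∀ x y, ‖F x y‖ₑ ≤ ENNReal.ofReal ((s^n)⁻¹) *
        ((PP n s t).indicator (fun p => ‖f p.2‖ₑ^2) (x, y) +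
         ‖u x‖ₑ^2 * (PP n s t).indicator 1 (x, y)) := by
      intro x y
      by_cases h : (x, y) ∈ PP n s t
      · simp only [hF]
        rw [indicator_of_mem h, indicator_of_mem h, indicator_of_mem h, enorm_mul]
        have h1 : ‖KK ℓ (x - y)‖ₑ ≤ ENNReal.ofReal ((s^n)⁻¹) := by
          rw [Real.enorm_eq_ofReal_abs]
          exact ENNReal.ofReal_le_ofReal (KK_bound ℓ hR1 h.1.le)
        have h2 : ‖u x * f y‖ₑ ≤ ‖f y‖ₑ^2 + ‖u x‖ₑ^2 * 1 := by
          rw [mul_one, ← enorm_pow, ← enorm_pow, Real.enorm_eq_ofReal_abs,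
            Real.enorm_eq_ofReal (sq_nonneg _), Real.enorm_eq_ofReal (sq_nonneg _),
            ← ENNReal.ofReal_add (sq_nonneg _) (sq_nonneg _)]
          apply ENNReal.ofReal_le_ofReal
          rw [abs_mul]
          nlinarith [sq_nonneg (|u x| - |f y|), sq_abs (u x), sq_abs (f y), sq_nonneg (u x),
            sq_nonneg (f y)]
        exact mul_le_mul' h1 h2
      · simp only [hF]
        rw [indicator_of_notMem h]; simp
    have hm1 : Measurable ((PP n s t).indicator (fun p => ‖f p.2‖ₑ^2)) :=
      (Measurable.comp (g := fun y => ‖f y‖ₑ^2) (by fun_prop) measurable_snd).indicator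
        (measurableSet_PP s t)
    calc ∫⁻ x, ∫⁻ y, ‖Function.uncurry F (x, y)‖ₑ
        ≤ ∫⁻ x, ENNReal.ofReal ((s^n)⁻¹) * ((∫⁻ y in Ann x s t, ‖f y‖ₑ^2) +
            ‖u x‖ₑ^2 * ENNReal.ofReal (t^n * vb n)) := by
          apply lintegral_mono
          intro x
          have hmx : Measurable fun y => (PP n s t).indicator (fun p => ‖f p.2‖ₑ^2) (x, y) :=
            hm1.comp measurable_prodMk_left
          refine (lintegral_mono (hb x)).trans ?_
          rw [lintegral_const_mul' _ _ ENNReal.ofReal_ne_top, lintegral_add_left hmx,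
            lintegral_const_mul' _ _ (by simp)]
          refine mul_le_mul_right (add_le_add ?_ (mul_le_mul_right ?_ _)) _
          · rw [← lintegral_indicator (measurableSet_Ann x s t)]
            exact le_rfl
          · have e : (fun y => (PP n s t).indicator (1 : EE n × EE n → ℝ≥0∞) (x, y)) =
                (Ann x s t).indicator 1 := rfl
            rw [e, lintegral_indicator_one (measurableSet_Ann x s t), ← vol_closedBall x hR.le]
            exact measure_mono (Ann_subset x s t)
      _ = ENNReal.ofReal ((s^n)⁻¹) * ((∫⁻ x, ∫⁻ y in Ann x s t, ‖f y‖ₑ^2) +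
            Sq u * ENNReal.ofReal (t^n * vb n)) := by
          rw [lintegral_const_mul' _ _ ENNReal.ofReal_ne_top,
            lintegral_add_left (measurable_annint s t (by fun_prop)), lintegral_mul_const _ (by fun_prop)]
          rfl
      _ < ⊤ := by
          apply ENNReal.mul_lt_top ENNReal.ofReal_lt_top
          apply ENNReal.add_lt_top.mpr ⟨?_, ENNReal.mul_lt_top hu.fin.lt_top ENNReal.ofReal_lt_top⟩
          exact (tonelli hR.le (by fun_prop)).trans_lt
            (ENNReal.mul_lt_top ENNReal.ofReal_lt_top hf.fin.lt_top)
  have h1 := integral_integral_swap hFi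
  have e1 : ∀ x, ∫ y, F x y = u x * DD ℓ a j f x := by
    intro x
    rw [DD, ← hs, ← ht, TT_eq, ← integral_const_mul]
    congr 1
    ext y
    simp only [hF]
    by_cases h : (x, y) ∈ PP n s t
    · rw [indicator_of_mem h, indicator_of_mem h]; ring
    · rw [indicator_of_notMem h, indicator_of_notMem h]; ring
  have e2 : ∀ y, ∫ x, F x y = - (DD ℓ a j u y * f y) := by
    intro y
    rw [DD, ← hs, ← ht, TT_eq, ← integral_mul_const, ← integral_neg]
    congr 1
    ext x
    simp only [hF]
    by_cases h : (x, y) ∈ PP n s t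
    · have h' : (y, x) ∈ PP n s t := by
        unfold PP at h ⊢
        simpa [norm_sub_rev] using h
      rw [indicator_of_mem h, indicator_of_mem h']
      have : KK ℓ (x - y) = - KK ℓ (y - x) := by
        unfold KK
        rw [norm_sub_rev x y]
        simp only [PiLp.sub_apply]
        ring
      simp only [this]; ring
    · have h' : (y, x) ∉ PP n s t := by
        intro h2
        apply h
        unfold PP at h2 ⊢
        simpa [norm_sub_rev] using h2
      rw [indicator_of_notMem h, indicator_of_notMem h']; ring
  simp_rw [e1, e2] at h1
  rw [h1, integral_neg]

lemma dual_bound (ℓ : Fin n) {a : ℝ} (ha : 0 < a) (j : ℕ) {f v : EE n → ℝ} (hf : IsL2 f)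
    (hv : IsL2 v) (h : ∫ x, v x * v x = ∫ x, v x * DD ℓ a j f x) {B : ℝ≥0∞}
    (hB : Sq (DD ℓ a j v) ≤ B * Sq v) : Sq v ≤ B * Sq f := by
  by_cases h0 : Sq v = 0
  · rw [h0]; exact zero_le
  have h1 : Sq v ≤ ‖∫ x, DD ℓ a j v x * f x‖ₑ := by
    rw [Sq_ofReal hv, h, duality ℓ ha j hf hv, Real.enorm_eq_ofReal_abs]
    exact ENNReal.ofReal_le_ofReal (neg_le_abs _)
  have h2 : Sq v ^ 2 ≤ (B * Sq v) * Sq f := by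
    refine (pow_le_pow_left' h1 2).trans ?_
    refine (int_cs _ (DD_L2 ℓ ha j hv).meas.aemeasurable hf.meas.aemeasurable).trans ?_
    exact mul_le_mul_left hB _
  have h3 : Sq v * Sq v ≤ Sq v * (B * Sq f) := by
    calc Sq v * Sq v = Sq v ^ 2 := (sq _).symm
      _ ≤ _ := h2
      _ = _ := by ring
  exact (ENNReal.mul_le_mul_iff_right h0 hv.fin).mp h3

def uu (ℓ : Fin n) (a : ℝ) (k j : ℕ) (g : EE n → ℝ) (x : EE n) : ℝ :=
  if j < k then DD ℓ a j g x - cE a k (DD ℓ a j g) x else cE a k (DD ℓ a j g) x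

lemma uu_L2 (ℓ : Fin n) {a : ℝ} (ha : 0 < a) (k j : ℕ) {g : EE n → ℝ} (hg : IsL2 g) :
    IsL2 (uu ℓ a k j g) := by
  unfold uu
  split_ifs
  · exact (DD_L2 ℓ ha j hg).sub ((DD_L2 ℓ ha j hg).cE ha k)
  · exact (DD_L2 ℓ ha j hg).cE ha k

lemma uu_le (ℓ : Fin n) {a : ℝ} (ha : 0 < a) (k j : ℕ) {g : EE n → ℝ} (hg : IsL2 g) :
    Sq (uu ℓ a k j g) ≤ Sq (DD ℓ a j g) := by
  unfold uu
  split_ifs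
  · exact Sq_sub_cE_le ha k (DD_L2 ℓ ha j hg)
  · exact Sq_cE_le ha k (DD_L2 ℓ ha j hg).meas

lemma uu_dual (hn : 1 ≤ n) (ℓ : Fin n) {a : ℝ} (ha : 0 < a) (k j : ℕ) {f : EE n → ℝ}
    (hf : IsL2 f) : Sq (uu ℓ a k j f) ≤ ENNReal.ofReal (C2 n * (1/2)^(dd k j)) * Sq f := by
  have hD := DD_L2 ℓ ha j hf
  have hE := hD.cE ha k
  have hMZ := MZ_sub_cE ha k hD.locInt
  have ho := orth (cE_LC a k _) hMZ hE (hD.sub hE)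
  have hsplit : ∀ v : EE n → ℝ, IsL2 v → ∫ x, v x * DD ℓ a j f x =
      (∫ x, v x * cE a k (DD ℓ a j f) x) +
      ∫ x, v x * (DD ℓ a j f x - cE a k (DD ℓ a j f) x) := by
    intro v hv
    rw [← integral_add (hv.int_mul hE) (hv.int_mul (hD.sub hE))]
    congr 1; ext x; ring
  unfold uu
  split_ifs with hjk
  · apply dual_bound ℓ ha j hf (hD.sub hE)
    · rw [hsplit _ (hD.sub hE)]
      have : ∫ x, (DD ℓ a j f x - cE a k (DD ℓ a j f) x) * cE a k (DD ℓ a j f) x = 0 := by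
        rw [← ho]; congr 1; ext x; ring
      rw [this, zero_add]
    · refine (DD_mixed hn ℓ ha (i := k+1) (hD.sub hE) (fun h => by omega)
        (fun _ => by simpa using hMZ)).trans ?_
      refine mul_le_mul_left (ENNReal.ofReal_le_ofReal ?_) _
      refine mul_le_mul_of_nonneg_left ?_ (C2_nonneg n)
      apply pow_le_pow_of_le_one (by norm_num) (by norm_num)
      unfold dd; omega
  · apply dual_bound ℓ ha j hf hE
    · rw [hsplit _ hE, ho, add_zero]
    · exact DD_mixed hn ℓ ha (i := k) hE (fun _ => cE_LC a k _) (fun h => by omega)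

end VR

namespace VR
variable {n : ℕ}

def PQ : ℝ≥0∞ := ENNReal.ofReal (19/20)

lemma PQ_ne_zero : PQ ≠ 0 := by unfold PQ; simp
lemma PQ_ne_top : PQ ≠ ⊤ := ENNReal.ofReal_ne_top
lemma PQ_lt_one : PQ < 1 := by
  unfold PQ; rw [← ENNReal.ofReal_one]; exact (ENNReal.ofReal_lt_ofReal_iff (by norm_num)).mpr (by norm_num)
lemma PQ_pow_le {m k : ℕ} (h : m ≤ k) : PQ ^ k ≤ PQ ^ m := pow_le_pow_right_of_le_one' PQ_lt_one.le h

lemma PQ_cancel (m k : ℕ) : PQ⁻¹ ^ m * PQ ^ (m + k) = PQ ^ k := by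
  rw [pow_add, ← mul_assoc, ← mul_pow, ENNReal.inv_mul_cancel PQ_ne_zero PQ_ne_top, one_pow, one_mul]

def AA : ℝ≥0∞ := 2 * ∑' m : ℕ, PQ ^ m

lemma AA_ne_top : AA ≠ ⊤ := by
  unfold AA
  rw [ENNReal.tsum_geometric]
  apply ENNReal.mul_ne_top (by simp)
  rw [Ne, ENNReal.inv_eq_top, tsub_eq_zero_iff_le, not_le]
  exact PQ_lt_one

lemma dd_comm (i j : ℕ) : dd i j = dd j i := by unfold dd; omega

lemma sum_dd (j : ℕ) : ∑' i, PQ ^ (dd i j) ≤ AA := by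
  have h := ENNReal.summable.sum_add_tsum_nat_add' (f := fun i => PQ ^ (dd i j)) (k := j)
  rw [← h, AA, two_mul]
  refine add_le_add ?_ ?_
  · rw [← Finset.sum_range_reflect]
    refine (Finset.sum_le_sum fun m hm => ?_).trans (ENNReal.sum_le_tsum (Finset.range j))
    rw [Finset.mem_range] at hm
    apply PQ_pow_le
    unfold dd; omega
  · refine ENNReal.tsum_le_tsum fun m => PQ_pow_le ?_
    unfold dd; omega

lemma sum_dd' (i : ℕ) : ∑' j, PQ ^ (dd i j) ≤ AA := by
  simp_rw [dd_comm i]; exact sum_dd i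

lemma half_le (d : ℕ) : ENNReal.ofReal ((1/2)^d) ≤ PQ ^ (12 * d) := by
  unfold PQ
  rw [← ENNReal.ofReal_pow (by norm_num), pow_mul]
  apply ENNReal.ofReal_le_ofReal
  gcongr
  norm_num

lemma wcs (j : ℕ) (c : ℕ → ℝ≥0∞) :
    (∑' i, c i) ^ 2 ≤ AA * ∑' i, PQ⁻¹ ^ (2 * dd i j) * c i ^ 2 := by
  have h := tsum_cs (fun i => PQ ^ (dd i j)) (fun i => PQ⁻¹ ^ (dd i j) * c i)
  have e1 : ∀ i, PQ ^ (dd i j) * (PQ⁻¹ ^ (dd i j) * c i) = c i := by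
    intro i
    have := PQ_cancel (dd i j) 0
    rw [add_zero, pow_zero, mul_comm] at this
    rw [← mul_assoc, this, one_mul]
  simp_rw [e1] at h
  refine h.trans (mul_le_mul' ?_ (le_of_eq ?_))
  · refine le_trans (ENNReal.tsum_le_tsum fun i => ?_) (sum_dd j)
    rw [← pow_mul]; exact PQ_pow_le (by omega)
  · congr 1; ext i; rw [mul_pow, ← pow_mul, mul_comm (dd i j) 2]

lemma op_split {a : ℝ} (ha : 0 < a) {f : EE n → ℝ} (hf : IsL2 f) (U : (EE n → ℝ) → ℝ)
    (hU : ∀ g h : EE n → ℝ, IsL2 g → IsL2 h → U (fun x => g x + h x) = U g + U h) (N : ℕ) :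
    U f = (∑ i ∈ Finset.range (N+1), U (hcomp a f i)) + U (fun x => f x - cE a N f x) := by
  have h1 : ∀ N, U (cE a N f) = ∑ i ∈ Finset.range (N+1), U (hcomp a f i) := by
    intro N
    induction N with
    | zero => simp [hcomp]
    | succ N ih =>
      rw [Finset.sum_range_succ, ← ih, ← hU _ _ (hf.cE ha N) (hcomp_L2 ha hf (N+1))]
      congr 1
      ext x
      simp [hcomp]
  rw [← h1, ← hU _ _ (hf.cE ha N) (hf.sub (hf.cE ha N))]
  congr 1
  ext x
  ring

lemma lim_aux {x S C : ℝ≥0∞} (hC : C ≠ ⊤) {e : ℕ → ℝ≥0∞} (h : ∀ N, x ≤ S + e N)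
    (he : ∀ N, e N ^ 2 ≤ C * ENNReal.ofReal ((1/2)^N)) : x ≤ S := by
  have h0 : Tendsto (fun N : ℕ => C * ENNReal.ofReal ((1/2)^N)) atTop (nhds 0) := by
    have h1 : Tendsto (fun N : ℕ => ENNReal.ofReal ((1/2 : ℝ)^N)) atTop (nhds 0) := by
      rw [← ENNReal.ofReal_zero]
      exact (ENNReal.continuous_ofReal.tendsto _).comp
        (tendsto_pow_atTop_nhds_zero_of_lt_one (by norm_num) (by norm_num))
    have := ENNReal.Tendsto.const_mul h1 (Or.inr hC)
    rwa [mul_zero] at this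
  have h2 : Tendsto (fun N => e N ^ 2) atTop (nhds 0) :=
    tendsto_of_tendsto_of_tendsto_of_le_of_le tendsto_const_nhds h0 (fun _ => zero_le) he
  have h3 : Tendsto e atTop (nhds 0) := by
    have := (ENNReal.continuous_rpow_const (y := 1/2)).tendsto 0 |>.comp h2
    rw [ENNReal.zero_rpow_of_pos (by norm_num)] at this
    convert this using 1
    ext N
    rw [Function.comp_apply, ← ENNReal.rpow_natCast, ← ENNReal.rpow_mul]
    norm_num
  have h4 : Tendsto (fun N => S + e N) atTop (nhds (S + 0)) := tendsto_const_nhds.add h3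
  rw [add_zero] at h4
  exact ge_of_tendsto' h4 h

lemma bb_le_fin (a : ℝ) {i j : ℕ} (h : j < i) (y : EE n) : bb a i j y = ENNReal.ofReal ((1/2)^(i-j)) := by
  unfold bb; rw [if_neg (not_le.mpr h)]

lemma TT_tsum (hn : 1 ≤ n) (ℓ : Fin n) {a : ℝ} (ha : 0 < a) (j : ℕ) {f : EE n → ℝ}
    (hf : IsL2 f) (x : EE n) {s t : ℝ}
    (hs : rad a j / 2 ≤ s) (hst : s ≤ t) (ht : t ≤ rad a j) :
    ‖TT ℓ s t f x‖ₑ ≤ ∑' i, ‖TT ℓ s t (hcomp a f i) x‖ₑ := by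
  have hR := rad_pos ha j
  have hs0 : 0 < s := by linarith
  apply lim_aux (C := ENNReal.ofReal (C0 n / rad a j ^ n) * Sq f)
    (e := fun N => ‖TT ℓ s t (fun x => f x - cE a (N+j) f x) x‖ₑ)
    (ENNReal.mul_ne_top ENNReal.ofReal_ne_top hf.fin)
  · intro N
    rw [op_split ha hf (fun g => TT ℓ s t g x)
      (fun g h hg hh => TT_add ℓ hs0 t hg.locInt hh.locInt x) (N + j)]
    refine (enorm_add_le _ _).trans (add_le_add ?_ le_rfl)
    exact (enorm_sum_le _ _).trans (ENNReal.sum_le_tsum _)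
  · intro N
    have hrem := hf.sub (hf.cE ha (N+j))
    refine (mixed hn ℓ ha (i := N + j + 1) hrem (fun h => by omega)
      (fun _ => by simpa using MZ_sub_cE ha (N+j) hf.locInt) x hs hst ht).trans ?_
    simp_rw [bb_le_fin a (show j < N + j + 1 by omega)]
    rw [lintegral_const_mul _ (by have := hrem.meas; fun_prop), mul_assoc]
    refine mul_le_mul_right ?_ _
    rw [mul_comm]
    refine mul_le_mul' ((setLIntegral_le_lintegral _ _).trans (Sq_sub_cE_le ha (N+j) hf)) ?_
    apply ENNReal.ofReal_le_ofReal
    apply pow_le_pow_of_le_one (by norm_num) (by norm_num)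
    omega

lemma cE_add {a : ℝ} (ha : 0 < a) (k : ℕ) {g h : EE n → ℝ} (hg : LocallyIntegrable g volume)
    (hh : LocallyIntegrable h volume) (x : EE n) :
    cE a k (fun y => g y + h y) x = cE a k g x + cE a k h x := by
  unfold cE
  rw [integral_add (integrableOn_cube ha k x hg) (integrableOn_cube ha k x hh), mul_add]

lemma uu_add (ℓ : Fin n) {a : ℝ} (ha : 0 < a) (k j : ℕ) {g h : EE n → ℝ} (hg : IsL2 g)
    (hh : IsL2 h) (x : EE n) :
    uu ℓ a k j (fun y => g y + h y) x = uu ℓ a k j g x + uu ℓ a k j h x := by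
  have e : DD ℓ a j (fun y => g y + h y) = fun x => DD ℓ a j g x + DD ℓ a j h x := by
    ext z; exact TT_add ℓ (rad_pos ha _) _ hg.locInt hh.locInt z
  unfold uu
  rw [e, cE_add ha k (DD_L2 ℓ ha j hg).locInt (DD_L2 ℓ ha j hh).locInt]
  split_ifs <;> ring

/-- L² norm -/
def N2 (g : EE n → ℝ) : ℝ≥0∞ := eLpNorm g 2 volume

lemma N2_sq (g : EE n → ℝ) : N2 g ^ 2 = Sq g := by
  unfold N2
  rw [Sq_eq, ← ENNReal.rpow_natCast, ← ENNReal.rpow_mul]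
  norm_num

lemma uu_tsum (hn : 1 ≤ n) (ℓ : Fin n) {a : ℝ} (ha : 0 < a) (k j : ℕ) {f : EE n → ℝ}
    (hf : IsL2 f) : N2 (uu ℓ a k j f) ≤ ∑' i, N2 (uu ℓ a k j (hcomp a f i)) := by
  have hC2 := C2_nonneg n
  apply lim_aux (C := ENNReal.ofReal (C2 n) * Sq f)
    (e := fun N => N2 (uu ℓ a k j (fun x => f x - cE a (N+j) f x)))
    (ENNReal.mul_ne_top ENNReal.ofReal_ne_top hf.fin)
  · intro N
    have hrem := hf.sub (hf.cE ha (N+j))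
    have e : uu ℓ a k j f = (∑ i ∈ Finset.range (N+j+1), uu ℓ a k j (hcomp a f i)) +
        uu ℓ a k j (fun x => f x - cE a (N+j) f x) := by
      ext x
      rw [Pi.add_apply, Finset.sum_apply]
      exact op_split ha hf (fun g => uu ℓ a k j g x) (fun g h hg hh => uu_add ℓ ha k j hg hh x) (N+j)
    unfold N2
    rw [e]
    have hm : ∀ i, AEStronglyMeasurable (uu ℓ a k j (hcomp a f i)) volume := fun i =>
      (uu_L2 ℓ ha k j (hcomp_L2 ha hf i)).meas.aestronglyMeasurable
    refine (eLpNorm_add_le (Finset.aestronglyMeasurable_sum _ fun i _ => hm i)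
      (uu_L2 ℓ ha k j hrem).meas.aestronglyMeasurable (by norm_num)).trans (add_le_add ?_ le_rfl)
    exact (eLpNorm_sum_le (fun i _ => hm i) (by norm_num)).trans (ENNReal.sum_le_tsum _)
  · intro N
    have hrem := hf.sub (hf.cE ha (N+j))
    rw [N2_sq]
    refine (uu_le ℓ ha k j hrem).trans ?_
    refine (DD_mixed hn ℓ ha (i := N + j + 1) hrem (fun h => by omega)
      (fun _ => by simpa using MZ_sub_cE ha (N+j) hf.locInt)).trans ?_
    rw [ENNReal.ofReal_mul hC2, mul_assoc, mul_assoc]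
    refine mul_le_mul_right ?_ _
    rw [mul_comm]
    refine mul_le_mul' (Sq_sub_cE_le ha (N+j) hf) ?_
    apply ENNReal.ofReal_le_ofReal
    apply pow_le_pow_of_le_one (by norm_num) (by norm_num)
    unfold dd; omega

lemma hcomp_hyp {a : ℝ} (ha : 0 < a) {f : EE n → ℝ} (hf : IsL2 f) {i j : ℕ} (h : j < i) :
    MZ a (i-1) (hcomp a f i) := by
  obtain ⟨m, rfl⟩ : ∃ m, i = m + 1 := ⟨i - 1, by omega⟩
  exact hcomp_MZ ha hf m

lemma uu_hcomp (hn : 1 ≤ n) (ℓ : Fin n) {a : ℝ} (ha : 0 < a) (k j i : ℕ) {f : EE n → ℝ}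
    (hf : IsL2 f) : Sq (uu ℓ a k j (hcomp a f i)) ≤
      ENNReal.ofReal (C2 n) * (PQ ^ (6 * dd i j + 6 * dd k j) * Sq (hcomp a f i)) := by
  have hC2 := C2_nonneg n
  have hh := hcomp_L2 ha hf i
  have h1 := (uu_le ℓ ha k j hh).trans (DD_mixed hn ℓ ha (i := i) (j := j) hh
    (fun _ => hcomp_LC a f i) (fun h => hcomp_hyp ha hf h))
  have h2 := uu_dual hn ℓ ha k j hh
  rcases le_total (dd i j) (dd k j) with h | h
  · refine h2.trans ?_
    rw [ENNReal.ofReal_mul hC2, mul_assoc]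
    refine mul_le_mul_right (mul_le_mul_left ((half_le _).trans (PQ_pow_le ?_)) _) _
    omega
  · refine h1.trans ?_
    rw [ENNReal.ofReal_mul hC2, mul_assoc]
    refine mul_le_mul_right (mul_le_mul_left ((half_le _).trans (PQ_pow_le ?_)) _) _
    omega

lemma uu_Sq (hn : 1 ≤ n) (ℓ : Fin n) {a : ℝ} (ha : 0 < a) (k j : ℕ) {f : EE n → ℝ}
    (hf : IsL2 f) : PQ⁻¹ ^ (2 * dd k j) * Sq (uu ℓ a k j f) ≤ AA * ENNReal.ofReal (C2 n) *
      ∑' i, PQ ^ (dd i j) * (PQ ^ (dd k j) * Sq (hcomp a f i)) := by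
  rw [← N2_sq]
  calc PQ⁻¹ ^ (2 * dd k j) * N2 (uu ℓ a k j f) ^ 2
      ≤ PQ⁻¹ ^ (2 * dd k j) * (AA * ∑' i, PQ⁻¹ ^ (2 * dd i j) *
        N2 (uu ℓ a k j (hcomp a f i)) ^ 2) :=
        mul_le_mul_right ((pow_le_pow_left' (uu_tsum hn ℓ ha k j hf) 2).trans (wcs j _)) _
    _ = AA * ∑' i, PQ⁻¹ ^ (2 * dd k j) * (PQ⁻¹ ^ (2 * dd i j) *
        Sq (uu ℓ a k j (hcomp a f i))) := by
        simp_rw [N2_sq]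
        rw [ENNReal.tsum_mul_left]; ring
    _ ≤ AA * ∑' i, ENNReal.ofReal (C2 n) * (PQ ^ (dd i j) * (PQ ^ (dd k j) * Sq (hcomp a f i))) := by
        refine mul_le_mul_right (ENNReal.tsum_le_tsum fun i => ?_) _
        calc _ ≤ PQ⁻¹ ^ (2 * dd k j) * (PQ⁻¹ ^ (2 * dd i j) * (ENNReal.ofReal (C2 n) *
              (PQ ^ (6 * dd i j + 6 * dd k j) * Sq (hcomp a f i)))) := by
              gcongr; exact uu_hcomp hn ℓ ha k j i hf
          _ = ENNReal.ofReal (C2 n) * ((PQ⁻¹ ^ (2 * dd i j) * PQ ^ (2 * dd i j + 4 * dd i j)) *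
              ((PQ⁻¹ ^ (2 * dd k j) * PQ ^ (2 * dd k j + 4 * dd k j)) * Sq (hcomp a f i))) := by
              ring
          _ ≤ _ := by
              rw [PQ_cancel, PQ_cancel]
              exact mul_le_mul_right (mul_le_mul' (PQ_pow_le (by omega))
                (mul_le_mul_left (PQ_pow_le (by omega)) _)) _
    _ = _ := by rw [ENNReal.tsum_mul_left, mul_assoc]

lemma uu_total (hn : 1 ≤ n) (ℓ : Fin n) {a : ℝ} (ha : 0 < a) {f : EE n → ℝ}
    (hf : IsL2 f) : ∑' k, ∑' j, PQ⁻¹ ^ (2 * dd k j) * Sq (uu ℓ a k j f) ≠ ⊤ := by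
  apply ne_of_lt
  calc _ ≤ ∑' k, ∑' j, AA * ENNReal.ofReal (C2 n) *
      ∑' i, PQ ^ (dd i j) * (PQ ^ (dd k j) * Sq (hcomp a f i)) :=
        ENNReal.tsum_le_tsum fun k => ENNReal.tsum_le_tsum fun j => uu_Sq hn ℓ ha k j hf
    _ = AA * ENNReal.ofReal (C2 n) *
      ∑' k, ∑' j, ∑' i, PQ ^ (dd i j) * (PQ ^ (dd k j) * Sq (hcomp a f i)) := by
        simp_rw [ENNReal.tsum_mul_left]
    _ = AA * ENNReal.ofReal (C2 n) *
      ∑' i, ∑' j, ∑' k, PQ ^ (dd i j) * (PQ ^ (dd k j) * Sq (hcomp a f i)) := by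
        congr 1
        rw [ENNReal.tsum_comm]
        simp_rw [ENNReal.tsum_comm (α := ℕ) (β := ℕ) (f := fun k i => PQ ^ (dd i _) * (PQ ^ (dd k _) * Sq (hcomp a f i)))]
        rw [ENNReal.tsum_comm]
    _ ≤ AA * ENNReal.ofReal (C2 n) * ∑' i, AA * (AA * Sq (hcomp a f i)) := by
        refine mul_le_mul_right (ENNReal.tsum_le_tsum fun i => ?_) _
        calc _ ≤ ∑' j, PQ ^ (dd i j) * (AA * Sq (hcomp a f i)) := by
              refine ENNReal.tsum_le_tsum fun j => ?_
              rw [ENNReal.tsum_mul_left, ENNReal.tsum_mul_right]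
              gcongr
              exact sum_dd j
          _ ≤ _ := by
              rw [ENNReal.tsum_mul_right]
              gcongr
              exact sum_dd' i
    _ ≤ AA * ENNReal.ofReal (C2 n) * (AA * (AA * Sq f)) := by
        rw [ENNReal.tsum_mul_left, ENNReal.tsum_mul_left]
        gcongr
        exact hcomp_Sq ha hf
    _ < ⊤ := by
        have h1 := AA_ne_top.lt_top
        have h2 := hf.fin.lt_top
        exact ENNReal.mul_lt_top (ENNReal.mul_lt_top h1 ENNReal.ofReal_lt_top)
          (ENNReal.mul_lt_top h1 (ENNReal.mul_lt_top h1 h2))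

/-- the densities -/
def ww (a : ℝ) (f : EE n → ℝ) (j : ℕ) (y : EE n) : ℝ≥0∞ :=
  ∑' i, AA * (PQ⁻¹ ^ (2 * dd i j) * (ENNReal.ofReal (C0 n / rad a j ^ n) *
    (bb a i j y * ‖hcomp a f i y‖ₑ ^ 2)))

lemma measurable_term {a : ℝ} (ha : 0 < a) {f : EE n → ℝ} (hf : IsL2 f) (i j : ℕ) :
    Measurable (fun y => bb a i j y * ‖hcomp a f i y‖ₑ ^ 2) := by
  have h1 := (hcomp_L2 ha hf i).meas
  exact (measurable_bb a i j).mul (by fun_prop)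

lemma measurable_ww {a : ℝ} (ha : 0 < a) {f : EE n → ℝ} (hf : IsL2 f) (j : ℕ) :
    Measurable (ww a f j) := by
  unfold ww
  refine Measurable.tsum fun i => ?_
  exact (((measurable_term ha hf i j).const_mul _).const_mul _).const_mul _

lemma TT_ww (hn : 1 ≤ n) (ℓ : Fin n) {a : ℝ} (ha : 0 < a) (j : ℕ) {f : EE n → ℝ}
    (hf : IsL2 f) (x : EE n) {s t : ℝ}
    (hs : rad a j / 2 ≤ s) (hst : s ≤ t) (ht : t ≤ rad a j) :
    ‖TT ℓ s t f x‖ₑ ^ 2 ≤ ∫⁻ y in Ann x s t, ww a f j y := by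
  unfold ww
  rw [lintegral_tsum fun i => ((((measurable_term ha hf i j).const_mul _).const_mul _).const_mul _).aemeasurable]
  refine (pow_le_pow_left' (TT_tsum hn ℓ ha j hf x hs hst ht) 2).trans ((wcs j _).trans ?_)
  rw [← ENNReal.tsum_mul_left]
  refine ENNReal.tsum_le_tsum fun i => ?_
  have hm := measurable_term ha hf i j
  rw [lintegral_const_mul _ ((hm.const_mul _).const_mul _), lintegral_const_mul _ (hm.const_mul _),
    lintegral_const_mul _ hm]
  refine mul_le_mul_right (mul_le_mul_right ?_ _) _
  exact mixed hn ℓ ha (hcomp_L2 ha hf i) (fun _ => hcomp_LC a f i) (fun h => hcomp_hyp ha hf h)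
    x hs hst ht

lemma ww_total {a : ℝ} (ha : 0 < a) {f : EE n → ℝ} (hf : IsL2 f) :
    ∑' j, ∫⁻ x, ∫⁻ y in Ann x (rad a (j+1)) (rad a j), ww a f j y ≠ ⊤ := by
  apply ne_of_lt
  have hv := vb_nonneg n
  have hC := C0_nonneg n
  have hC2 := C2_nonneg n
  calc _ ≤ ∑' j, ENNReal.ofReal (rad a j ^ n * vb n) * ∫⁻ y, ww a f j y :=
        ENNReal.tsum_le_tsum fun j => tonelli (rad_pos ha j).le (measurable_ww ha hf j)
    _ ≤ ∑' j, ∑' i, AA * (ENNReal.ofReal (C2 n) * (PQ ^ (dd i j) * Sq (hcomp a f i))) := by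
        refine ENNReal.tsum_le_tsum fun j => ?_
        have hR := rad_pos ha j
        unfold ww
        rw [lintegral_tsum fun i =>
          ((((measurable_term ha hf i j).const_mul _).const_mul _).const_mul _).aemeasurable,
          ← ENNReal.tsum_mul_left]
        refine ENNReal.tsum_le_tsum fun i => ?_
        have hm := measurable_term ha hf i j
        rw [lintegral_const_mul _ ((hm.const_mul _).const_mul _), lintegral_const_mul _ (hm.const_mul _),
          lintegral_const_mul _ hm]
        calc _ ≤ ENNReal.ofReal (rad a j ^ n * vb n) * (AA * (PQ⁻¹ ^ (2 * dd i j) *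
              (ENNReal.ofReal (C0 n / rad a j ^ n) *
              (ENNReal.ofReal ((4 * n + 1) * (1/2)^(dd i j)) * Sq (hcomp a f i))))) := by
              gcongr
              exact bb_int ha (fun _ => hcomp_LC a f i) (hcomp_L2 ha hf i).meas
          _ = AA * ((ENNReal.ofReal (rad a j ^ n * vb n) * ENNReal.ofReal (C0 n / rad a j ^ n) *
              ENNReal.ofReal (4 * n + 1)) * ((PQ⁻¹ ^ (2 * dd i j) * ENNReal.ofReal ((1/2)^(dd i j))) *
              Sq (hcomp a f i))) := by
              rw [ENNReal.ofReal_mul (by positivity : (0:ℝ) ≤ 4 * n + 1)]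
              ring
          _ ≤ _ := by
              refine mul_le_mul_right (mul_le_mul' (le_of_eq ?_) (mul_le_mul_left ?_ _)) _
              · rw [← ENNReal.ofReal_mul (by positivity), ← ENNReal.ofReal_mul (by positivity)]
                congr 1
                unfold C2
                field_simp
              · calc _ ≤ PQ⁻¹ ^ (2 * dd i j) * PQ ^ (2 * dd i j + 10 * dd i j) := by
                      refine mul_le_mul_right ((half_le _).trans (PQ_pow_le ?_)) _
                      omega
                  _ ≤ _ := by
                      rw [PQ_cancel]; exact PQ_pow_le (by omega)
    _ = ∑' i, ∑' j, AA * (ENNReal.ofReal (C2 n) * (PQ ^ (dd i j) * Sq (hcomp a f i))) :=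
        ENNReal.tsum_comm
    _ ≤ ∑' i, AA * (ENNReal.ofReal (C2 n) * (AA * Sq (hcomp a f i))) := by
        refine ENNReal.tsum_le_tsum fun i => ?_
        rw [ENNReal.tsum_mul_left, ENNReal.tsum_mul_left, ENNReal.tsum_mul_right]
        gcongr
        exact sum_dd' i
    _ ≤ AA * (ENNReal.ofReal (C2 n) * (AA * Sq f)) := by
        rw [ENNReal.tsum_mul_left, ENNReal.tsum_mul_left, ENNReal.tsum_mul_left]
        gcongr
        exact hcomp_Sq ha hf
    _ < ⊤ := by
        have h1 := AA_ne_top.lt_top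
        have h2 := hf.fin.lt_top
        exact ENNReal.mul_lt_top h1 (ENNReal.mul_lt_top ENNReal.ofReal_lt_top
          (ENNReal.mul_lt_top h1 h2))

lemma DD_total (hn : 1 ≤ n) (ℓ : Fin n) {a : ℝ} (ha : 0 < a) {f : EE n → ℝ} (hf : IsL2 f) :
    ∑' j, Sq (DD ℓ a j f) ≠ ⊤ := by
  refine ne_top_of_le_ne_top (ww_total ha hf) (ENNReal.tsum_le_tsum fun j => lintegral_mono fun x => ?_)
  have := rad_pos ha j
  exact TT_ww hn ℓ ha j hf x (by rw [rad_succ]) (by rw [rad_succ]; linarith) le_rfl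

end VR

namespace VR
variable {n : ℕ}

def GG (ℓ : Fin n) (a : ℝ) (f : EE n → ℝ) (k : ℕ) (x : EE n) : ℝ :=
  ∑' j, cE a k (DD ℓ a j f) x

lemma cE_pt {a : ℝ} (ha : 0 < a) (k : ℕ) (g : EE n → ℝ) (x : EE n) :
    ‖cE a k g x‖ₑ ^ 2 ≤ (ENNReal.ofReal (rad a k ^ n))⁻¹ * Sq (cE a k g) := by
  have hR := rad_pos ha k
  have h0 : ENNReal.ofReal (rad a k ^ n) ≠ 0 := by
    rw [Ne, ENNReal.ofReal_eq_zero, not_le]; positivity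
  rw [mul_comm, ← div_eq_mul_inv, ENNReal.le_div_iff_mul_le (Or.inl h0) (Or.inl ENNReal.ofReal_ne_top),
    ← volume_cube ha k x, ← setLIntegral_const]
  refine le_trans (le_of_eq ?_) (setLIntegral_le_lintegral (cube a k x) _)
  apply setLIntegral_congr_fun (measurableSet_cube a k x)
  intro y hy
  simp only [cE_LC a k g y x hy]

lemma cE_sum (hn : 1 ≤ n) (ℓ : Fin n) {a : ℝ} (ha : 0 < a) {f : EE n → ℝ} (hf : IsL2 f) (k : ℕ) :
    ∃ B : ℝ≥0∞, B ≠ ⊤ ∧ ∀ x, ∑' j, ‖cE a k (DD ℓ a j f) x‖ₑ ≤ B := by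
  set κ := (ENNReal.ofReal (rad a k ^ n))⁻¹ with hκ
  have hR := rad_pos ha k
  have hκt : κ ≠ ⊤ := by
    rw [hκ, Ne, ENNReal.inv_eq_top, ENNReal.ofReal_eq_zero, not_le]; positivity
  set T1 := ∑' j, PQ⁻¹ ^ (2 * dd k j) * Sq (cE a k (DD ℓ a j f)) with hS
  have hT1 : T1 ≠ ⊤ := by
    have h1 : ∑' j, PQ⁻¹ ^ (2 * dd k j) * Sq (uu ℓ a k j f) ≠ ⊤ :=
      ENNReal.ne_top_of_tsum_ne_top (uu_total hn ℓ ha hf) k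
    have h2 : ∑' j, (if j < k then PQ⁻¹ ^ (2 * dd k j) * Sq (cE a k (DD ℓ a j f)) else 0) ≠ ⊤ := by
      rw [tsum_eq_sum (s := Finset.range k)]
      · apply ENNReal.sum_ne_top.mpr
        intro j _
        split_ifs
        · refine ENNReal.mul_ne_top (ENNReal.pow_ne_top (ENNReal.inv_ne_top.mpr PQ_ne_zero)) ?_
          exact ((DD_L2 ℓ ha j hf).cE ha k).fin
        · simp
      · intro j hj
        rw [if_neg (by simpa using hj)]
    refine ne_top_of_le_ne_top (ENNReal.add_ne_top.mpr ⟨h1, h2⟩) ?_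
    rw [← ENNReal.tsum_add]
    refine ENNReal.tsum_le_tsum fun j => ?_
    split_ifs with hjk
    · exact le_add_self
    · have : uu ℓ a k j f = cE a k (DD ℓ a j f) := by
        ext x; unfold uu; rw [if_neg hjk]
      rw [this]; exact le_self_add
  refine ⟨1 + AA * (κ * T1), ENNReal.add_ne_top.mpr ⟨ENNReal.one_ne_top, ENNReal.mul_ne_top AA_ne_top
    (ENNReal.mul_ne_top hκt hT1)⟩, fun x => ?_⟩
  set S := ∑' j, ‖cE a k (DD ℓ a j f) x‖ₑ with hSd
  have h1 : S ^ 2 ≤ AA * (κ * T1) := by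
    refine (wcs k _).trans (mul_le_mul_right ?_ _)
    rw [hS, ← ENNReal.tsum_mul_left]
    refine ENNReal.tsum_le_tsum fun j => ?_
    rw [dd_comm j k, mul_left_comm]
    exact mul_le_mul_right (cE_pt ha k _ x) _
  rcases le_total S 1 with h | h
  · exact h.trans le_self_add
  · refine le_trans ?_ (h1.trans le_add_self)
    rw [sq]
    calc S = S * 1 := (mul_one S).symm
      _ ≤ S * S := mul_le_mul_right h S

lemma GG_summable (hn : 1 ≤ n) (ℓ : Fin n) {a : ℝ} (ha : 0 < a) {f : EE n → ℝ} (hf : IsL2 f)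
    (k : ℕ) (x : EE n) : Summable (fun j => cE a k (DD ℓ a j f) x) := by
  obtain ⟨B, hB, h⟩ := cE_sum hn ℓ ha hf k
  have h1 := ne_top_of_le_ne_top hB (h x)
  apply Summable.of_norm
  have := ENNReal.summable_toReal h1
  simpa using this

lemma GG_bdd (hn : 1 ≤ n) (ℓ : Fin n) {a : ℝ} (ha : 0 < a) {f : EE n → ℝ} (hf : IsL2 f)
    (k : ℕ) : ∃ B : ℝ, ∀ x, |GG ℓ a f k x| ≤ B := by
  obtain ⟨B, hB, h⟩ := cE_sum hn ℓ ha hf k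
  refine ⟨B.toReal, fun x => ?_⟩
  have h1 : ‖GG ℓ a f k x‖ₑ ≤ B := enorm_tsum_le_tsum_enorm.trans (h x)
  rw [Real.enorm_eq_ofReal_abs] at h1
  exact (ENNReal.ofReal_le_iff_le_toReal hB).mp h1

lemma GG_LC (ℓ : Fin n) (a : ℝ) (f : EE n → ℝ) (k : ℕ) : LC a k (GG ℓ a f k) := by
  intro x y h
  unfold GG
  congr 1
  ext j
  exact cE_LC a k _ x y h

lemma bdd_intOn {a : ℝ} (ha : 0 < a) {g : EE n → ℝ} (hm : Measurable g) {B : ℝ}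
    (hB : ∀ x, |g x| ≤ B) (k : ℕ) (x : EE n) : IntegrableOn g (cube a k x) := by
  apply Measure.integrableOn_of_bounded (M := B)
  · rw [volume_cube ha]; exact ENNReal.ofReal_ne_top
  · exact hm.aestronglyMeasurable
  · exact ae_of_all _ hB

lemma int_GG (hn : 1 ≤ n) (ℓ : Fin n) {a : ℝ} (ha : 0 < a) {f : EE n → ℝ} (hf : IsL2 f)
    {k m : ℕ} (hkm : k ≤ m) (x : EE n) :
    ∫ y in cube a k x, GG ℓ a f m y = ∑' j, ∫ y in cube a k x, DD ℓ a j f y := by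
  obtain ⟨B, hB, h⟩ := cE_sum hn ℓ ha hf m
  unfold GG
  rw [integral_tsum (fun j => (cE_meas a m _).aestronglyMeasurable)]
  · congr 1
    ext j
    have hD := DD_L2 ℓ ha j hf
    have h1 := (MZ_sub_cE ha m hD.locInt).mono ha hkm (hD.sub (hD.cE ha m)).locInt x
    rw [integral_sub (integrableOn_cube ha k x hD.locInt)
      (integrableOn_cube ha k x (hD.cE ha m).locInt)] at h1
    linarith
  · rw [← lintegral_tsum (fun j => (cE_meas a m _).enorm.aemeasurable)]
    have : ∫⁻ y in cube a k x, ∑' j, ‖cE a m (DD ℓ a j f) y‖ₑ ≤ ∫⁻ y in cube a k x, B :=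
      lintegral_mono h
    rw [setLIntegral_const, volume_cube ha] at this
    exact ne_top_of_le_ne_top (ENNReal.mul_ne_top hB ENNReal.ofReal_ne_top) this

lemma GG_MZ (hn : 1 ≤ n) (ℓ : Fin n) {a : ℝ} (ha : 0 < a) {f : EE n → ℝ} (hf : IsL2 f)
    (k : ℕ) : MZ a k (fun x => GG ℓ a f (k+1) x - GG ℓ a f k x) := by
  intro x
  obtain ⟨B1, h1⟩ := GG_bdd hn ℓ ha hf (k+1)
  obtain ⟨B2, h2⟩ := GG_bdd hn ℓ ha hf k
  rw [integral_sub (bdd_intOn ha (GG_LC ℓ a f (k+1)).measurable h1 k x)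
    (bdd_intOn ha (GG_LC ℓ a f k).measurable h2 k x), int_GG hn ℓ ha hf (by omega),
    int_GG hn ℓ ha hf le_rfl, sub_self]

/-- partial sums -/
def SS (ℓ : Fin n) (a : ℝ) (f : EE n → ℝ) (k : ℕ) (x : EE n) : ℝ :=
  ∑ j ∈ Finset.range k, DD ℓ a j f x

lemma err_le (hn : 1 ≤ n) (ℓ : Fin n) {a : ℝ} (ha : 0 < a) {f : EE n → ℝ} (hf : IsL2 f)
    (k : ℕ) (x : EE n) : ‖SS ℓ a f k x - GG ℓ a f k x‖ₑ ≤ ∑' j, ‖uu ℓ a k j f x‖ₑ := by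
  have h1 : HasSum (fun j => if j < k then DD ℓ a j f x else 0) (SS ℓ a f k x) := by
    have : HasSum (fun j => if j < k then DD ℓ a j f x else 0)
        (∑ j ∈ Finset.range k, if j < k then DD ℓ a j f x else 0) := hasSum_sum_of_ne_finset_zero (f := fun j => if j < k then DD ℓ a j f x else 0)
      (s := Finset.range k) (fun j hj => if_neg (by simpa using hj))
    convert this using 1
    unfold SS
    apply Finset.sum_congr rfl
    intro j hj
    rw [if_pos (by simpa using hj)]
  have h2 := h1.sub (GG_summable hn ℓ ha hf k x).hasSum
  change HasSum _ (SS ℓ a f k x - GG ℓ a f k x) at h2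
  rw [← h2.tsum_eq]
  refine enorm_tsum_le_tsum_enorm.trans (ENNReal.tsum_le_tsum fun j => ?_)
  unfold uu
  split_ifs
  · exact le_rfl
  · rw [zero_sub, enorm_neg]

lemma err_total (hn : 1 ≤ n) (ℓ : Fin n) {a : ℝ} (ha : 0 < a) {f : EE n → ℝ} (hf : IsL2 f) :
    ∑' k, Sq (fun x => SS ℓ a f k x - GG ℓ a f k x) ≠ ⊤ := by
  refine ne_top_of_le_ne_top (ENNReal.mul_ne_top AA_ne_top (uu_total hn ℓ ha hf)) ?_
  rw [← ENNReal.tsum_mul_left]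
  refine ENNReal.tsum_le_tsum fun k => ?_
  have hm : ∀ j, Measurable fun x => ‖uu ℓ a k j f x‖ₑ ^ 2 := by
    intro j
    have := (uu_L2 ℓ ha k j hf).meas
    fun_prop
  calc Sq (fun x => SS ℓ a f k x - GG ℓ a f k x)
      ≤ ∫⁻ x, AA * ∑' j, PQ⁻¹ ^ (2 * dd k j) * ‖uu ℓ a k j f x‖ₑ ^ 2 := by
        apply lintegral_mono
        intro x
        refine (pow_le_pow_left' (err_le hn ℓ ha hf k x) 2).trans ((wcs k _).trans ?_)
        simp_rw [dd_comm _ k]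
        exact le_rfl
    _ = AA * ∑' j, PQ⁻¹ ^ (2 * dd k j) * Sq (uu ℓ a k j f) := by
        rw [lintegral_const_mul' _ _ AA_ne_top, lintegral_tsum fun j => ((hm j).const_mul _).aemeasurable]
        congr 2
        ext j
        rw [lintegral_const_mul _ (hm j)]
        rfl

lemma enorm_sq3 (x y z : ℝ) : ‖x - y + z‖ₑ ^ 2 ≤ 3 * (‖x‖ₑ^2 + ‖y‖ₑ^2 + ‖z‖ₑ^2) := by
  simp_rw [← enorm_pow, Real.enorm_eq_ofReal (sq_nonneg _)]
  rw [← ENNReal.ofReal_add (by positivity) (by positivity),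
    ← ENNReal.ofReal_add (by positivity) (by positivity),
    show (3 : ℝ≥0∞) = ENNReal.ofReal 3 by simp, ← ENNReal.ofReal_mul (by norm_num)]
  apply ENNReal.ofReal_le_ofReal
  nlinarith [sq_nonneg (x + y), sq_nonneg (x - z), sq_nonneg (y + z)]

lemma gam_total (hn : 1 ≤ n) (ℓ : Fin n) {a : ℝ} (ha : 0 < a) {f : EE n → ℝ} (hf : IsL2 f) :
    ∑' k, Sq (fun x => GG ℓ a f (k+1) x - GG ℓ a f k x) ≠ ⊤ := by
  have hSm : ∀ k, Measurable (SS ℓ a f k) := by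
    intro k
    unfold SS
    exact Finset.measurable_sum _ fun j _ => (DD_L2 ℓ ha j hf).meas
  have hem : ∀ k, Measurable fun x => ‖SS ℓ a f k x - GG ℓ a f k x‖ₑ ^ 2 := by
    intro k
    have h1 := hSm k
    have h2 := (GG_LC ℓ a f k).measurable
    fun_prop
  have hDm : ∀ k, Measurable fun x => ‖DD ℓ a k f x‖ₑ ^ 2 := by
    intro k
    have h1 := (DD_L2 ℓ ha k hf).meas
    fun_prop
  have hE := err_total hn ℓ ha hf
  have hE' : ∑' k, Sq (fun x => SS ℓ a f (k+1) x - GG ℓ a f (k+1) x) ≠ ⊤ :=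
    ne_top_of_le_ne_top hE (ENNReal.tsum_comp_le_tsum_of_injective (add_left_injective 1) _)
  refine ne_top_of_le_ne_top (ENNReal.mul_ne_top (by norm_num : (3 : ℝ≥0∞) ≠ ⊤)
    (ENNReal.add_ne_top.mpr ⟨ENNReal.add_ne_top.mpr ⟨DD_total hn ℓ ha hf, hE'⟩, hE⟩)) ?_
  rw [← ENNReal.tsum_add, ← ENNReal.tsum_add, ← ENNReal.tsum_mul_left]
  refine ENNReal.tsum_le_tsum fun k => ?_
  simp only [Sq]
  rw [← lintegral_add_left (hDm k), ← lintegral_add_left (show Measurable fun x => ‖DD ℓ a k f x‖ₑ^2 +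
    ‖SS ℓ a f (k+1) x - GG ℓ a f (k+1) x‖ₑ^2 from (hDm k).add (hem (k+1))),
    ← lintegral_const_mul' _ _ (by norm_num)]
  apply lintegral_mono
  intro x
  refine le_trans (le_of_eq ?_) (enorm_sq3 _ _ _)
  have : SS ℓ a f (k+1) x = SS ℓ a f k x + DD ℓ a k f x := Finset.sum_range_succ _ _
  rw [this]; ring_nf

lemma anch_LC {a : ℝ} {G : ℕ → EE n → ℝ} (hG : ∀ k, LC a k (G k)) (lam : ℝ) (K : ℕ) :
    LC a K (fun x => anch lam (fun k => G k x) K) := by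
  intro x y h
  induction K with
  | zero => simp only [anch, hG 0 x y h]
  | succ K ih =>
    have h1 := ih (cidx_succ h)
    simp only at h1 ⊢
    rw [anch, anch, h1, hG (K+1) x y h]

lemma jump_int {a : ℝ} (ha : 0 < a) {G : ℕ → EE n → ℝ} (hG : ∀ k, LC a k (G k))
    (hB : ∀ k, ∃ B, ∀ x, |G k x| ≤ B) (hM : ∀ k, MZ a k (fun x => G (k+1) x - G k x))
    {lam : ℝ} (hl : 0 < lam) (x0 : EE n) (K : ℕ) :
    ∫ x in cube a 0 x0, (lam^2 * (anch lam (fun k => G k x) K).2 +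
        (G K x - (anch lam (fun k => G k x) K).1)^2) ≤
      ∑ k ∈ Finset.range K, ∫ x in cube a 0 x0, (G (k+1) x - G k x)^2 := by
  have hAm : ∀ K, Measurable (fun x => (anch lam (fun k => G k x) K).1) := fun K =>
    (measurable_fst).comp (anch_LC hG lam K).measurable
  have hNm : ∀ K, Measurable (fun x => ((anch lam (fun k => G k x) K).2 : ℝ)) := fun K =>
    (measurable_from_nat (f := fun m : ℕ => (m : ℝ))).comp (measurable_snd.comp (anch_LC hG lam K).measurable)
  have hGm : ∀ k, Measurable (G k) := fun k => (hG k).measurable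
  have hcl : ∀ K x, |G K x - (anch lam (fun k => G k x) K).1| < lam := fun K x =>
    anch_close hl (fun k => G k x) K
  have hsqb : ∀ K x, (G K x - (anch lam (fun k => G k x) K).1)^2 ≤ lam^2 := by
    intro K x
    rw [← sq_abs]
    have := hcl K x
    have h0 := abs_nonneg (G K x - (anch lam (fun k => G k x) K).1)
    nlinarith
  have hI : ∀ K, IntegrableOn (fun x => lam^2 * ((anch lam (fun k => G k x) K).2 : ℝ) +
      (G K x - (anch lam (fun k => G k x) K).1)^2) (cube a 0 x0) := by
    intro K
    have h1 := hAm K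
    have h2 := hNm K
    have h3 := hGm K
    apply bdd_intOn ha (by fun_prop) (B := lam^2 * K + lam^2)
    intro x
    rw [abs_of_nonneg (by positivity)]
    have := anch_le lam (fun k => G k x) K
    have h4 : ((anch lam (fun k => G k x) K).2 : ℝ) ≤ K := by exact_mod_cast this
    have := hsqb K x
    gcongr
  have hg : ∀ k, IntegrableOn (fun x => (G (k+1) x - G k x)^2) (cube a 0 x0) := by
    intro k
    obtain ⟨B1, h1⟩ := hB (k+1)
    obtain ⟨B2, h2⟩ := hB k
    have h3 := hGm k
    have h4 := hGm (k+1)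
    apply bdd_intOn ha (by fun_prop) (B := (B1+B2)^2)
    intro x
    rw [abs_of_nonneg (sq_nonneg _), ← sq_abs]
    have := abs_sub (G (k+1) x) (G k x)
    have := h1 x
    have := h2 x
    gcongr
    linarith
  have hx : ∀ k, IntegrableOn (fun x => 2 * (G k x - (anch lam (fun k => G k x) k).1) *
      (G (k+1) x - G k x)) (cube a 0 x0) := by
    intro k
    obtain ⟨B1, h1⟩ := hB (k+1)
    obtain ⟨B2, h2⟩ := hB k
    have h3 := hGm k
    have h4 := hGm (k+1)
    have h5 := hAm k
    apply bdd_intOn ha (by fun_prop) (B := (2 * lam) * (B1+B2))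
    intro x
    rw [abs_mul, abs_mul, abs_two]
    have := abs_sub (G (k+1) x) (G k x)
    have := h1 x
    have := h2 x
    have := (hcl k x).le
    gcongr
    linarith
  induction K with
  | zero => simp [anch]
  | succ K ih =>
    rw [Finset.sum_range_succ]
    have hzero : ∫ x in cube a 0 x0, 2 * (G K x - (anch lam (fun k => G k x) K).1) *
        (G (K+1) x - G K x) = 0 := by
      rw [← integral_indicator (measurableSet_cube a 0 x0)]
      have hc : LC a K ((cube a 0 x0).indicator
          (fun x => 2 * (G K x - (anch lam (fun k => G k x) K).1))) := by
        intro x y h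
        have h0 : cidx a 0 x = cidx a 0 y := cidx_mono (Nat.zero_le K) h
        have h1 := anch_LC hG lam K x y h
        simp only at h1
        by_cases hxq : x ∈ cube a 0 x0
        · have hyq : y ∈ cube a 0 x0 := h0.symm.trans hxq
          rw [indicator_of_mem hxq, indicator_of_mem hyq, h1, hG K x y h]
        · have hyq : y ∉ cube a 0 x0 := fun hy => hxq (h0.trans hy)
          rw [indicator_of_notMem hxq, indicator_of_notMem hyq]
      have e : (cube a 0 x0).indicator (fun x => 2 * (G K x - (anch lam (fun k => G k x) K).1) *
          (G (K+1) x - G K x)) = fun x => (cube a 0 x0).indicator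
          (fun x => 2 * (G K x - (anch lam (fun k => G k x) K).1)) x * (G (K+1) x - G K x) := by
        ext x
        by_cases hxq : x ∈ cube a 0 x0
        · rw [indicator_of_mem hxq, indicator_of_mem hxq]
        · rw [indicator_of_notMem hxq, indicator_of_notMem hxq, zero_mul]
      have hi := (hx K).integrable_indicator (measurableSet_cube a 0 x0)
      rw [e] at hi ⊢
      exact int_zero hc (hM K) hi
    calc _ ≤ ∫ x in cube a 0 x0, ((lam^2 * ((anch lam (fun k => G k x) K).2 : ℝ) +
          (G K x - (anch lam (fun k => G k x) K).1)^2) + (2 * (G K x - (anch lam (fun k => G k x) K).1) *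
          (G (K+1) x - G K x) + (G (K+1) x - G K x)^2)) := by
          apply integral_mono (hI (K+1)) ((hI K).add ((hx K).add (hg K)))
          intro x
          simp only [Pi.add_apply]
          rw [anch]
          split_ifs with h
          · simp only [sub_self]
            push_cast
            have : lam^2 ≤ |G (K+1) x - (anch lam (fun k => G k x) K).1|^2 := by gcongr
            rw [sq_abs] at this
            nlinarith
          · apply le_of_eq; ring
      _ = (∫ x in cube a 0 x0, (lam^2 * ((anch lam (fun k => G k x) K).2 : ℝ) +
          (G K x - (anch lam (fun k => G k x) K).1)^2)) + (0 +
          ∫ x in cube a 0 x0, (G (K+1) x - G K x)^2) := by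
          have hxg : Integrable (fun x => 2 * (G K x - (anch lam (fun k => G k x) K).1) *
            (G (K+1) x - G K x) + (G (K+1) x - G K x)^2) (volume.restrict (cube a 0 x0)) :=
            (hx K).add (hg K)
          rw [integral_add (hI K) hxg, integral_add (hx K) (hg K), hzero]
      _ ≤ _ := by linarith

lemma jump_lint {a : ℝ} (ha : 0 < a) {G : ℕ → EE n → ℝ} (hG : ∀ k, LC a k (G k))
    (hB : ∀ k, ∃ B, ∀ x, |G k x| ≤ B) (hM : ∀ k, MZ a k (fun x => G (k+1) x - G k x))
    {lam : ℝ} (hl : 0 < lam) (x0 : EE n) :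
    ENNReal.ofReal (lam^2) * ∫⁻ x in cube a 0 x0, ⨆ K, ((anch lam (fun k => G k x) K).2 : ℝ≥0∞) ≤
      ∑' k, Sq (fun x => G (k+1) x - G k x) := by
  have hNm : ∀ K, Measurable (fun x => ((anch lam (fun k => G k x) K).2 : ℝ≥0∞)) := fun K =>
    (measurable_from_nat (f := fun m : ℕ => (m : ℝ≥0∞))).comp (measurable_snd.comp (anch_LC hG lam K).measurable)
  rw [lintegral_iSup hNm (fun p q hpq x => by
    simp only; exact_mod_cast anch_mono lam (fun k => G k x) hpq), ENNReal.mul_iSup]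
  refine iSup_le fun K => ?_
  have hGm : ∀ k, Measurable (G k) := fun k => (hG k).measurable
  have hNr : Measurable (fun x => ((anch lam (fun k => G k x) K).2 : ℝ)) := 
    (measurable_from_nat (f := fun m : ℕ => (m : ℝ))).comp (measurable_snd.comp (anch_LC hG lam K).measurable)
  have hAm : Measurable (fun x => (anch lam (fun k => G k x) K).1) := 
    (measurable_fst).comp (anch_LC hG lam K).measurable
  have key := jump_int ha hG hB hM hl x0 K
  have hle : ∀ x, ((anch lam (fun k => G k x) K).2 : ℝ) ≤ K := fun x => by
    exact_mod_cast anch_le lam (fun k => G k x) K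
  have hI1 : IntegrableOn (fun x => lam^2 * ((anch lam (fun k => G k x) K).2 : ℝ)) (cube a 0 x0) := by
    apply bdd_intOn ha (by fun_prop) (B := lam^2 * K)
    intro x
    rw [abs_of_nonneg (by positivity)]
    have := hle x
    gcongr
  have hI2 : IntegrableOn (fun x => (G K x - (anch lam (fun k => G k x) K).1)^2) (cube a 0 x0) := by
    have h1 := hGm K
    apply bdd_intOn ha (by fun_prop) (B := lam^2)
    intro x
    rw [abs_of_nonneg (by positivity), ← sq_abs]
    have := (anch_close hl (fun k => G k x) K).le
    gcongr
  have h1 : ∫ x in cube a 0 x0, lam^2 * ((anch lam (fun k => G k x) K).2 : ℝ) ≤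
      ∑ k ∈ Finset.range K, ∫ x in cube a 0 x0, (G (k+1) x - G k x)^2 := by
    refine le_trans ?_ key
    rw [integral_add hI1 hI2]
    have : 0 ≤ ∫ x in cube a 0 x0, (G K x - (anch lam (fun k => G k x) K).1)^2 :=
      integral_nonneg fun x => sq_nonneg _
    linarith
  have e1 : ENNReal.ofReal (lam^2) * ∫⁻ x in cube a 0 x0, ((anch lam (fun k => G k x) K).2 : ℝ≥0∞) =
      ENNReal.ofReal (∫ x in cube a 0 x0, lam^2 * ((anch lam (fun k => G k x) K).2 : ℝ)) := by
    rw [ofReal_integral_eq_lintegral_ofReal hI1 (ae_of_all _ fun x => by positivity),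
      ← lintegral_const_mul _ (hNm K)]
    congr 1
    ext x
    rw [ENNReal.ofReal_mul (by positivity), ENNReal.ofReal_natCast]
  rw [e1]
  refine (ENNReal.ofReal_le_ofReal h1).trans ?_
  rw [ENNReal.ofReal_sum_of_nonneg fun k _ => integral_nonneg fun x => sq_nonneg _]
  refine le_trans (Finset.sum_le_sum fun k _ => ?_) (ENNReal.sum_le_tsum (Finset.range K))
  have hg : IntegrableOn (fun x => (G (k+1) x - G k x)^2) (cube a 0 x0) := by
    obtain ⟨B1, h1⟩ := hB (k+1)
    obtain ⟨B2, h2⟩ := hB k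
    have h3 := hGm k
    have h4 := hGm (k+1)
    apply bdd_intOn ha (by fun_prop) (B := (B1+B2)^2)
    intro x
    rw [abs_of_nonneg (sq_nonneg _), ← sq_abs]
    have := abs_sub (G (k+1) x) (G k x)
    have := h1 x
    have := h2 x
    gcongr
    linarith
  rw [ofReal_integral_eq_lintegral_ofReal hg (ae_of_all _ fun x => sq_nonneg _)]
  refine le_trans (le_of_eq ?_) (setLIntegral_le_lintegral (cube a 0 x0) _)
  congr 1
  ext x
  rw [← enorm_pow, Real.enorm_eq_ofReal (sq_nonneg _)]

end VR

namespace VR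
variable {n : ℕ}

lemma Ann_empty (x : EE n) {s t : ℝ} (h : t ≤ s) : Ann x s t = ∅ := by
  ext y
  simp only [Ann, mem_ofPred_eq, mem_empty_iff_false, iff_false, not_and, not_le]
  intro h1; linarith

lemma TT_split (ℓ : Fin n) {s t u : ℝ} (hs : 0 < s) (hst : s ≤ t) (htu : t ≤ u) {f : EE n → ℝ}
    (hf : LocallyIntegrable f volume) (x : EE n) :
    TT ℓ s u f x = TT ℓ s t f x + TT ℓ t u f x := by
  have e : Ann x s u = Ann x s t ∪ Ann x t u := by
    ext y
    simp only [Ann, mem_ofPred_eq, mem_union]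
    constructor
    · rintro ⟨h1, h2⟩
      rcases le_or_gt ‖x - y‖ t with h | h
      · exact Or.inl ⟨h1, h⟩
      · exact Or.inr ⟨h, h2⟩
    · rintro (⟨h1, h2⟩ | ⟨h1, h2⟩)
      · exact ⟨h1, h2.trans htu⟩
      · exact ⟨hst.trans_lt h1, h2⟩
  have hd : Disjoint (Ann x s t) (Ann x t u) := by
    rw [Set.disjoint_left]
    rintro y ⟨_, h2⟩ ⟨h3, _⟩
    linarith
  unfold TT
  rw [e, setIntegral_union hd (measurableSet_Ann x t u) (integrableOn_KK ℓ hs t x hf)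
    (integrableOn_KK ℓ (hs.trans_le hst) u x hf)]

lemma TT_rad (ℓ : Fin n) {a : ℝ} (ha : 0 < a) {f : EE n → ℝ}
    (hf : LocallyIntegrable f volume) (x : EE n) (k : ℕ) :
    TT ℓ (rad a k) a f x = SS ℓ a f k x := by
  have hle : ∀ k, rad a k ≤ a := by
    intro k
    unfold rad
    have : ((1/2:ℝ))^k ≤ 1 := pow_le_one₀ (by norm_num) (by norm_num)
    nlinarith
  induction k with
  | zero =>
    have : rad a 0 = a := by simp [rad]
    rw [this]
    simp [TT, SS, Ann_empty x le_rfl]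
  | succ k ih =>
    have h1 := rad_pos ha k
    rw [TT_split ℓ (rad_pos ha (k+1)) (by rw [rad_succ]; linarith) (hle k) hf, ih]
    unfold SS
    rw [Finset.sum_range_succ, add_comm]
    rfl

def nu (a : ℝ) (f : EE n → ℝ) (x : EE n) : Measure ℝ :=
  Measure.map (fun y => ‖x - y‖) (Measure.sum fun j =>
    (volume.withDensity (ww a f j)).restrict (Ann x (rad a (j+1)) (rad a j)))

lemma nu_univ (a : ℝ) (f : EE n → ℝ) (x : EE n) :
    nu a f x univ = ∑' j, ∫⁻ y in Ann x (rad a (j+1)) (rad a j), ww a f j y := by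
  unfold nu
  have hm : Measurable (fun y : EE n => ‖x - y‖) := by fun_prop
  rw [Measure.map_apply hm MeasurableSet.univ, preimage_univ, Measure.sum_apply _ MeasurableSet.univ]
  congr 1
  ext j
  rw [Measure.restrict_apply MeasurableSet.univ, univ_inter,
    withDensity_apply _ (measurableSet_Ann _ _ _)]

lemma nu_Ioc (a : ℝ) (f : EE n → ℝ) (x : EE n) {k : ℕ} {s t : ℝ} (hs : rad a (k+1) ≤ s)
    (ht : t ≤ rad a k) : ∫⁻ y in Ann x s t, ww a f k y ≤ nu a f x (Ioc s t) := by
  unfold nu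
  have hm : Measurable (fun y : EE n => ‖x - y‖) := by fun_prop
  have hA : (fun y : EE n => ‖x - y‖) ⁻¹' (Ioc s t) = Ann x s t := rfl
  rw [Measure.map_apply hm measurableSet_Ioc, hA, Measure.sum_apply _ (measurableSet_Ann _ _ _)]
  refine le_trans (le_of_eq ?_) (ENNReal.le_tsum k)
  rw [Measure.restrict_apply (measurableSet_Ann _ _ _), inter_eq_left.mpr,
    withDensity_apply _ (measurableSet_Ann _ _ _)]
  rintro y ⟨h1, h2⟩
  exact ⟨hs.trans_lt h1, h2.trans ht⟩

lemma nu_ae {a : ℝ} (ha : 0 < a) {f : EE n → ℝ} (hf : IsL2 f) :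
    ∀ᵐ x, nu a f x univ ≠ ⊤ := by
  simp_rw [nu_univ]
  have hm : ∀ j, Measurable fun x => ∫⁻ y in Ann x (rad a (j+1)) (rad a j), ww a f j y := fun j =>
    measurable_annint _ _ (measurable_ww ha hf j)
  have h := ww_total ha hf
  rw [← lintegral_tsum fun j => (hm j).aemeasurable] at h
  filter_upwards [ae_lt_top (Measurable.tsum hm) h] with x hx using hx.ne

lemma err_ae (hn : 1 ≤ n) (ℓ : Fin n) {a : ℝ} (ha : 0 < a) {f : EE n → ℝ} (hf : IsL2 f) :
    ∀ᵐ x, ∑' k, ENNReal.ofReal ((SS ℓ a f k x - GG ℓ a f k x)^2) ≠ ⊤ := by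
  have hm : ∀ k, Measurable fun x => ENNReal.ofReal ((SS ℓ a f k x - GG ℓ a f k x)^2) := by
    intro k
    have h1 : Measurable (SS ℓ a f k) := by
      unfold SS
      exact Finset.measurable_sum _ fun j _ => (DD_L2 ℓ ha j hf).meas
    have h2 := (GG_LC ℓ a f k).measurable
    fun_prop
  have h : ∑' k, ∫⁻ x, ENNReal.ofReal ((SS ℓ a f k x - GG ℓ a f k x)^2) ≠ ⊤ := by
    have := err_total hn ℓ ha hf
    unfold Sq at this
    simp_rw [← enorm_pow, Real.enorm_eq_ofReal (sq_nonneg _)] at this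
    exact this
  rw [← lintegral_tsum fun j => (hm j).aemeasurable] at h
  filter_upwards [ae_lt_top (Measurable.tsum hm) h] with x hx using hx.ne

def Nb (ℓ : Fin n) (a : ℝ) (f : EE n → ℝ) (i : ℕ) (x : EE n) : ℝ≥0∞ :=
  ⨆ K, ((anch ((1/2:ℝ)^i) (fun k => GG ℓ a f k x) K).2 : ℝ≥0∞)

lemma Nb_meas (ℓ : Fin n) (a : ℝ) (f : EE n → ℝ) (i : ℕ) : Measurable (Nb ℓ a f i) := by
  unfold Nb
  exact Measurable.iSup fun K => (measurable_from_nat (f := fun m : ℕ => (m : ℝ≥0∞))).comp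
    (measurable_snd.comp (anch_LC (GG_LC ℓ a f) _ K).measurable)

lemma geo_fin {ρ : ℝ} (hρ : 2 < ρ) {C : ℝ≥0∞} (hC : C ≠ ⊤) {b : ℕ → ℝ≥0∞}
    (hb : ∀ i, ENNReal.ofReal (((1/2:ℝ)^i)^2) * b i ≤ C) :
    ∑' i, ENNReal.ofReal ((4 * (1/2 : ℝ) ^ i) ^ ρ) * b i ≠ ⊤ := by
  set q : ℝ := (1/2:ℝ)^(ρ-2) with hq
  have hq0 : 0 ≤ q := by positivity
  have hq1 : q < 1 := Real.rpow_lt_one (by norm_num) (by norm_num) (by linarith)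
  have hS : ∑' i : ℕ, ENNReal.ofReal q ^ i ≠ ⊤ := by
    rw [ENNReal.tsum_geometric, ENNReal.inv_ne_top]
    rw [Ne, tsub_eq_zero_iff_le, not_le]
    rw [← ENNReal.ofReal_one]
    exact (ENNReal.ofReal_lt_ofReal_iff (by norm_num)).mpr hq1
  refine ne_top_of_le_ne_top (ENNReal.mul_ne_top (ENNReal.mul_ne_top
    (ENNReal.ofReal_ne_top (r := 4^ρ)) hC) hS) ?_
  rw [← ENNReal.tsum_mul_left]
  refine ENNReal.tsum_le_tsum fun i => ?_
  have e : (4 * (1/2 : ℝ) ^ i) ^ ρ = 4^ρ * (((1/2:ℝ)^i)^2 * q^i) := by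
    rw [Real.mul_rpow (by norm_num) (by positivity)]
    congr 1
    rw [hq, ← Real.rpow_natCast, ← Real.rpow_natCast (_ ^ (i:ℝ)), ← Real.rpow_natCast (_ ^ (ρ-2)),
      ← Real.rpow_mul (by norm_num), ← Real.rpow_mul (by norm_num), ← Real.rpow_mul (by norm_num),
      ← Real.rpow_add (by norm_num)]
    congr 1
    push_cast
    ring
  rw [e, ENNReal.ofReal_mul (by positivity), ENNReal.ofReal_mul (by positivity),
    ENNReal.ofReal_pow hq0]
  calc ENNReal.ofReal (4^ρ) * (ENNReal.ofReal (((1/2:ℝ)^i)^2) * ENNReal.ofReal q ^ i) * b i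
      = ENNReal.ofReal (4^ρ) * (ENNReal.ofReal (((1/2:ℝ)^i)^2) * b i) * ENNReal.ofReal q ^ i := by ring
    _ ≤ _ := by gcongr; exact hb i

lemma ae_of_cubes {a : ℝ} {p : EE n → Prop}
    (h : ∀ x0, ∀ᵐ x ∂(volume.restrict (cube a 0 x0)), p x) : ∀ᵐ x : EE n, p x := by
  have h1 : ∀ᵐ x ∂((volume : Measure (EE n)).restrict (⋃ z : Fin n → ℤ, cidx a 0 ⁻¹' {z})), p x := by
    rw [ae_restrict_iUnion_iff]
    intro z
    by_cases hz : ∃ x0 : EE n, cidx a 0 x0 = z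
    · obtain ⟨x0, rfl⟩ := hz
      exact h x0
    · have : (cidx a 0 ⁻¹' {z} : Set (EE n)) = ∅ := by
        ext y
        simp only [mem_preimage, mem_singleton_iff, mem_empty_iff_false, iff_false]
        exact fun hy => hz ⟨y, hy⟩
      rw [this]; simp
  rwa [iUnion_cubes, Measure.restrict_univ] at h1

lemma Nb_ae (hn : 1 ≤ n) (ℓ : Fin n) {a : ℝ} (ha : 0 < a) {f : EE n → ℝ} (hf : IsL2 f)
    {ρ : ℝ} (hρ : 2 < ρ) :
    ∀ᵐ x, ∑' i, ENNReal.ofReal ((4 * (1/2 : ℝ) ^ i) ^ ρ) * Nb ℓ a f i x ≠ ⊤ := by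
  apply ae_of_cubes (a := a)
  intro x0
  have hb : ∀ i, ENNReal.ofReal (((1/2:ℝ)^i)^2) * ∫⁻ x in cube a 0 x0, Nb ℓ a f i x ≤
      ∑' k, Sq (fun x => GG ℓ a f (k+1) x - GG ℓ a f k x) := fun i =>
    jump_lint ha (GG_LC ℓ a f) (GG_bdd hn ℓ ha hf) (GG_MZ hn ℓ ha hf) (by positivity) x0
  have h := geo_fin hρ (gam_total hn ℓ ha hf) hb
  have hm : ∀ i, Measurable fun x => ENNReal.ofReal ((4 * (1/2 : ℝ) ^ i) ^ ρ) * Nb ℓ a f i x :=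
    fun i => (Nb_meas ℓ a f i).const_mul _
  simp_rw [← lintegral_const_mul _ (Nb_meas ℓ a f _)] at h
  rw [← lintegral_tsum fun j => (hm j).aemeasurable] at h
  filter_upwards [ae_lt_top (Measurable.tsum hm) h] with x hx using hx.ne

theorem var_L2 (hn : 1 ≤ n) (ℓ : Fin n) {a : ℝ} (ha : 0 < a) {f : EE n → ℝ} (hf : IsL2 f)
    {ρ : ℝ} (hρ : 2 < ρ) : ∀ᵐ x, eVar ρ (fun t => TT ℓ t a f x) ≠ ⊤ := by
  filter_upwards [nu_ae ha hf, err_ae hn ℓ ha hf, Nb_ae hn ℓ ha hf hρ] with x h1 h2 h3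
  refine eVar_fin ρ hρ a ha _ (fun k => GG ℓ a f k x) ?_ (nu a f x) h1 ?_ ?_
    (fun i => Nb ℓ a f i x) ?_ h3
  · intro t ht
    simp only [TT, Ann_empty x ht, Ann_empty x le_rfl]
  · intro k s t hs hst ht
    change rad a (k+1) ≤ s at hs
    change t ≤ rad a k at ht
    have hta : t ≤ a := by
      refine ht.trans ?_
      unfold rad
      have : ((1/2:ℝ))^k ≤ 1 := pow_le_one₀ (by norm_num) (by norm_num)
      nlinarith
    have e : TT ℓ s a f x - TT ℓ t a f x = TT ℓ s t f x := by
      rw [TT_split ℓ ((rad_pos ha (k+1)).trans_le hs) hst hta hf.locInt]; ring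
    rw [e, ← Real.enorm_eq_ofReal (sq_nonneg _), enorm_pow]
    exact (TT_ww hn ℓ ha k hf x (by rw [← rad_succ]; exact hs) hst ht).trans (nu_Ioc a f x hs ht)
  · have : ∀ k, TT ℓ (a * (1/2)^k) a f x = SS ℓ a f k x := TT_rad ℓ ha hf.locInt x
    simp only [this]
    exact h2
  · intro i k
    exact le_iSup (fun K => ((anch ((1/2:ℝ)^i) (fun k => GG ℓ a f k x) K).2 : ℝ≥0∞)) k

end VR

namespace VR
variable {n : ℕ}

lemma osc_ball {f : EE n → ℝ} {M : ℝ} (hf : IsBMOWith f M) (x : EE n) {R : ℝ} (hR : 0 < R) :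
    ∃ c : ℝ, ∫ y in Metric.ball x R, |f y - c| ≤ M * (R ^ n * vb n) := by
  refine ⟨avgOn f (Metric.ball x R), ?_⟩
  have h := hf x R hR
  have hpos : 0 < (volume (Metric.ball x R)).toReal :=
    ENNReal.toReal_pos (Metric.measure_ball_pos volume x hR).ne' measure_ball_lt_top.ne
  have e : (volume (Metric.ball x R)).toReal = R ^ n * vb n := by
    rw [vol_ball x hR, ENNReal.toReal_ofReal (mul_nonneg (by positivity) (vb_nonneg n))]
  rw [e] at h hpos
  rw [inv_mul_le_iff₀ hpos] at h
  linarith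

/-- Oscillation on cubes. -/
lemma osc_cube {f : EE n → ℝ} {M : ℝ} (hl : LocallyIntegrable f volume) (hf : IsBMOWith f M)
    {a : ℝ} (ha : 0 < a) : ∃ M' : ℝ, 1 ≤ M' ∧
      (∀ m x, ∫⁻ y in cube a m x, ‖f y - cE a m f x‖ₑ ≤ ENNReal.ofReal (M' * rad a m ^ n)) ∧
      (∀ m x, |cE a (m+1) f x - cE a m f x| ≤ M') := by
  set C : ℝ := M * ((n+1)^n * vb n) with hC
  have key : ∀ m x, ∫ y in cube a m x, |f y - cE a m f x| ≤ 2 * C * rad a m ^ n := by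
    intro m x
    have hr := rad_pos ha m
    set R := ((n:ℝ)+1) * rad a m with hRdef
    have hR : 0 < R := by positivity
    obtain ⟨c, hc⟩ := osc_ball hf x hR
    have hsub : cube a m x ⊆ Metric.ball x R := by
      intro y hy
      rw [Metric.mem_ball, dist_eq_norm]
      have := norm_cube_le ha hy
      rw [hRdef]; linarith
    have hIB : ∀ c : ℝ, IntegrableOn (fun y => f y - c) (Metric.ball x R) := by
      intro c
      have h1 : IntegrableOn f (Metric.closedBall x R) := hl.integrableOn_isCompact (isCompact_closedBall x R)
      exact (h1.mono_set Metric.ball_subset_closedBall).sub (integrableOn_const measure_ball_lt_top.ne)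
    have hIP : ∀ c : ℝ, IntegrableOn (fun y => f y - c) (cube a m x) := fun c => (hIB c).mono_set hsub
    have h1 : ∫ y in cube a m x, |f y - c| ≤ C * rad a m ^ n := by
      calc ∫ y in cube a m x, |f y - c| ≤ ∫ y in Metric.ball x R, |f y - c| :=
            setIntegral_mono_set (hIB c).abs (ae_of_all _ fun y => abs_nonneg _) (LE.le.eventuallyLE hsub)
        _ ≤ M * (R ^ n * vb n) := hc
        _ = C * rad a m ^ n := by rw [hRdef, hC, mul_pow]; ring
    have hv : (volume (cube a m x)).toReal = rad a m ^ n := by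
      rw [volume_cube ha, ENNReal.toReal_ofReal (by positivity)]
    have hcst : ∀ b : ℝ, ∫ y in cube a m x, b = rad a m ^ n * b := by
      intro b
      rw [setIntegral_const, measureReal_def, hv, smul_eq_mul]
    have hif : IntegrableOn f (cube a m x) := integrableOn_cube ha m x hl
    have h2 : rad a m ^ n * |c - cE a m f x| ≤ C * rad a m ^ n := by
      have e : rad a m ^ n * (c - cE a m f x) = - ∫ y in cube a m x, (f y - c) := by
        rw [integral_sub hif (integrableOn_const (by rw [volume_cube ha]; exact ENNReal.ofReal_ne_top)),
          hcst]
        unfold cE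
        field_simp
        ring
      rw [← abs_of_pos (by positivity : 0 < rad a m ^ n), ← abs_mul, abs_of_pos (by positivity : 0 < rad a m ^ n),
        e, abs_neg]
      exact (abs_integral_le_integral_abs).trans h1
    have hvt : volume (cube a m x) ≠ ⊤ := by rw [volume_cube ha]; exact ENNReal.ofReal_ne_top
    calc ∫ y in cube a m x, |f y - cE a m f x| ≤ ∫ y in cube a m x, (|f y - c| + |c - cE a m f x|) := by
          apply integral_mono (hIP _).abs ((hIP _).abs.add (integrableOn_const hvt))
          intro y
          exact abs_sub_le _ _ _
      _ = (∫ y in cube a m x, |f y - c|) + rad a m ^ n * |c - cE a m f x| := by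
          rw [integral_add (hIP _).abs (integrableOn_const hvt), hcst]
      _ ≤ _ := by linarith
  have hC0 : 0 ≤ C := by
    have h := key 0 0
    have h2 : 0 ≤ ∫ y in cube a 0 (0 : EE n), |f y - cE a 0 f 0| := integral_nonneg fun y => abs_nonneg _
    have h3 : 0 < rad a 0 ^ n := by have := rad_pos ha 0; positivity
    by_contra hneg
    push Not at hneg
    nlinarith
  refine ⟨max 1 (2^n * (2 * C)), le_max_left _ _, ?_, ?_⟩
  · intro m x
    have hr := rad_pos ha m
    have hI : IntegrableOn (fun y => f y - cE a m f x) (cube a m x) :=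
      (integrableOn_cube ha m x hl).sub (integrableOn_const (by rw [volume_cube ha]; exact ENNReal.ofReal_ne_top))
    rw [← ofReal_integral_norm_eq_lintegral_enorm hI]
    apply ENNReal.ofReal_le_ofReal
    refine (key m x).trans ?_
    have : 2 * C ≤ max 1 (2^n * (2 * C)) := by
      refine le_trans ?_ (le_max_right _ _)
      have : (1:ℝ) ≤ 2^n := one_le_pow₀ (by norm_num)
      nlinarith
    have h3 : 0 < rad a m ^ n := by positivity
    nlinarith
  · intro m x
    refine le_trans ?_ (le_max_right _ _)
    have hr := rad_pos ha m
    have hr' := rad_pos ha (m+1)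
    have hvt : volume (cube a (m+1) x) ≠ ⊤ := by rw [volume_cube ha]; exact ENNReal.ofReal_ne_top
    have hvt' : volume (cube a m x) ≠ ⊤ := by rw [volume_cube ha]; exact ENNReal.ofReal_ne_top
    have hv : (volume (cube a (m+1) x)).toReal = rad a (m+1) ^ n := by
      rw [volume_cube ha, ENNReal.toReal_ofReal (by positivity)]
    have hI : IntegrableOn (fun y => f y - cE a m f x) (cube a m x) :=
      (integrableOn_cube ha m x hl).sub (integrableOn_const hvt')
    have e : rad a (m+1) ^ n * (cE a (m+1) f x - cE a m f x) =
        ∫ y in cube a (m+1) x, (f y - cE a m f x) := by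
      rw [integral_sub (integrableOn_cube ha (m+1) x hl) (integrableOn_const hvt), setIntegral_const,
        measureReal_def, hv, smul_eq_mul, mul_sub]
      congr 1
      rw [cE]
      field_simp
    have h1 : rad a (m+1) ^ n * |cE a (m+1) f x - cE a m f x| ≤ 2 * C * rad a m ^ n := by
      rw [← abs_of_pos (by positivity : 0 < rad a (m+1) ^ n), ← abs_mul, e]
      refine (abs_integral_le_integral_abs).trans (le_trans ?_ (key m x))
      refine setIntegral_mono_set hI.abs (ae_of_all _ fun y => abs_nonneg _) ?_
      apply LE.le.eventuallyLE
      intro y hy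
      exact cidx_succ hy
    rw [rad_succ, div_pow] at h1
    have h3 : 0 < rad a m ^ n := by positivity
    have h4 : (0:ℝ) < 2^n := by positivity
    have h5 : rad a m ^ n * |cE a (m+1) f x - cE a m f x| ≤ rad a m ^ n * (2^n * (2 * C)) := by
      rw [div_mul_eq_mul_div, div_le_iff₀ h4] at h1
      linarith
    exact le_of_mul_le_mul_left h5 h3

lemma sq_le_two_pow (N : ℕ) : (N+1)^2 ≤ 4 * 2^N := by
  induction N with
  | zero => norm_num
  | succ k ih =>
    rcases k with _ | _ | k
    · norm_num
    · norm_num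
    · rw [pow_succ 2 (k+1+1)]
      have h : (k+1+1+1+1)^2 ≤ 2*(k+1+1+1)^2 := 
        Nat.le.intro (k := k^2+4*k+2) (by ring)
      linarith

lemma anch_dist {lam M : ℝ} (hl : 0 < lam) (G : ℕ → ℝ) (hG : ∀ k, |G (k+1) - G k| ≤ M) (k : ℕ) :
    |(anch lam G k).1 - G 0| ≤ (lam + M) * (anch lam G k).2 := by
  induction k with
  | zero => simp [anch]
  | succ k ih =>
    rw [anch]
    split_ifs with h
    · have h1 := (anch_close hl G k).le
      have h2 := hG k
      push_cast
      have h3 := abs_sub_le (G (k+1)) (G k) (G 0)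
      have h4 := abs_sub_le (G k) (anch lam G k).1 (G 0)
      linarith
    · exact ih

/-- the weight -/
def ZZ (a M : ℝ) (f : EE n → ℝ) (k : ℕ) (x : EE n) : ℝ≥0∞ :=
  2 ^ (anch (3*M) (fun j => cE a j f x) k).2 *
    (ENNReal.ofReal M + ‖f x - (anch (3*M) (fun j => cE a j f x) k).1‖ₑ)

lemma ZZ_meas (a M : ℝ) {f : EE n → ℝ} (hf : Measurable f) (k : ℕ) : Measurable (ZZ a M f k) := by
  have h := (anch_LC (fun j => cE_LC a j f) (3*M) k).measurable
  have h1 : Measurable (fun x => (anch (3*M) (fun j => cE a j f x) k).1) := measurable_fst.comp h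
  have h2 : Measurable (fun x => (2:ℝ≥0∞) ^ (anch (3*M) (fun j => cE a j f x) k).2) :=
    (measurable_from_nat (f := fun m : ℕ => (2 : ℝ≥0∞)^m)).comp (measurable_snd.comp h)
  unfold ZZ
  exact h2.mul (measurable_const.add (hf.sub h1).enorm)

lemma ZZ_cube {a M : ℝ} {f : EE n → ℝ} (hf : Measurable f) {m k : ℕ} (hkm : k ≤ m) (x : EE n) :
    ∫⁻ y in cube a m x, ZZ a M f k y = 2 ^ (anch (3*M) (fun j => cE a j f x) k).2 *
      (ENNReal.ofReal M * volume (cube a m x) +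
        ∫⁻ y in cube a m x, ‖f y - (anch (3*M) (fun j => cE a j f x) k).1‖ₑ) := by
  rw [← setLIntegral_const, ← lintegral_add_left measurable_const,
    ← lintegral_const_mul' _ _ (ENNReal.pow_ne_top ENNReal.ofNat_ne_top)]
  apply setLIntegral_congr_fun (measurableSet_cube a m x)
  intro y hy
  have := (anch_LC (fun j => cE_LC a j f) (3*M) k).mono hkm y x hy
  simp only [ZZ, this]

lemma ZZ_step {a M : ℝ} (ha : 0 < a) (hM : 1 ≤ M) {f : EE n → ℝ} (hf : Measurable f)
    (hl : LocallyIntegrable f volume)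
    (ho : ∀ m x, ∫⁻ y in cube a m x, ‖f y - cE a m f x‖ₑ ≤ ENNReal.ofReal (M * rad a m ^ n))
    (k : ℕ) (x : EE n) :
    ∫⁻ y in cube a (k+1) x, ZZ a M f (k+1) y ≤ ∫⁻ y in cube a (k+1) x, ZZ a M f k y := by
  rw [ZZ_cube hf le_rfl, ZZ_cube hf (Nat.le_succ k), anch]
  split_ifs with h
  swap
  · exact le_rfl
  have hr := rad_pos ha (k+1)
  set A := (anch (3*M) (fun j => cE a j f x) k).1
  set N := (anch (3*M) (fun j => cE a j f x) k).2
  rw [pow_succ, mul_assoc]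
  refine mul_le_mul_right ?_ _
  have hvt : volume (cube a (k+1) x) ≠ ⊤ := by rw [volume_cube ha]; exact ENNReal.ofReal_ne_top
  have hv : (volume (cube a (k+1) x)).toReal = rad a (k+1) ^ n := by
    rw [volume_cube ha, ENNReal.toReal_ofReal (by positivity)]
  have e : rad a (k+1) ^ n * (cE a (k+1) f x - A) = ∫ y in cube a (k+1) x, (f y - A) := by
    rw [integral_sub (integrableOn_cube ha (k+1) x hl) (integrableOn_const hvt), setIntegral_const,
      measureReal_def, hv, smul_eq_mul, mul_sub]
    congr 1
    rw [cE]
    field_simp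
  have h1 : ENNReal.ofReal (3 * M * rad a (k+1) ^ n) ≤ ∫⁻ y in cube a (k+1) x, ‖f y - A‖ₑ := by
    refine le_trans ?_ (enorm_integral_le_lintegral_enorm _)
    rw [← e, Real.enorm_eq_ofReal_abs]
    apply ENNReal.ofReal_le_ofReal
    rw [abs_mul, abs_of_pos (by positivity), mul_comm]
    gcongr
  have h2 := ho (k+1) x
  rw [volume_cube ha, ← ENNReal.ofReal_mul (by linarith)]
  calc 2 * (ENNReal.ofReal (M * rad a (k+1) ^ n) + ∫⁻ y in cube a (k+1) x, ‖f y - cE a (k+1) f x‖ₑ)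
      ≤ 2 * (ENNReal.ofReal (M * rad a (k+1) ^ n) + ENNReal.ofReal (M * rad a (k+1) ^ n)) := by gcongr
    _ = ENNReal.ofReal (M * rad a (k+1) ^ n) + ENNReal.ofReal (3 * M * rad a (k+1) ^ n) := by
        have : ENNReal.ofReal (3 * M * rad a (k+1) ^ n) = 3 * ENNReal.ofReal (M * rad a (k+1) ^ n) := by
          rw [mul_assoc, ENNReal.ofReal_mul (by norm_num)]; norm_num
        rw [this]; ring
    _ ≤ _ := by gcongr

lemma ZZ_all {a M : ℝ} (ha : 0 < a) (hM : 1 ≤ M) {f : EE n → ℝ} (hf : Measurable f)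
    (hl : LocallyIntegrable f volume)
    (ho : ∀ m x, ∫⁻ y in cube a m x, ‖f y - cE a m f x‖ₑ ≤ ENNReal.ofReal (M * rad a m ^ n))
    (k : ℕ) (x0 : EE n) :
    ∫⁻ y in cube a 0 x0, ZZ a M f k y ≤ 2 * ENNReal.ofReal (M * rad a 0 ^ n) := by
  induction k with
  | zero =>
    have hr := rad_pos ha 0
    rw [ZZ_cube hf le_rfl]
    simp only [anch, pow_zero, one_mul]
    rw [volume_cube ha, ← ENNReal.ofReal_mul (by linarith), two_mul]
    gcongr
    exact ho 0 x0
  | succ k ih =>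
    refine le_trans ?_ ih
    have hc : LC a (k+1) ((cube a 0 x0).indicator (1 : EE n → ℝ≥0∞)) := by
      intro x y h
      have h0 : cidx a 0 x = cidx a 0 y := cidx_mono (Nat.zero_le _) h
      have : x ∈ cube a 0 x0 ↔ y ∈ cube a 0 x0 := by
        change cidx a 0 x = _ ↔ cidx a 0 y = _
        rw [h0]
      by_cases hx : x ∈ cube a 0 x0
      · rw [indicator_of_mem hx, indicator_of_mem (this.mp hx)]; rfl
      · rw [indicator_of_notMem hx, indicator_of_notMem (fun h => hx (this.mpr h))]
    have := lint_le hc (ZZ_meas a M hf (k+1)) (ZZ_meas a M hf k) (ZZ_step ha hM hf hl ho k)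
    have e : ∀ g : EE n → ℝ≥0∞, ∫⁻ x, (cube a 0 x0).indicator (1 : EE n → ℝ≥0∞) x * g x =
        ∫⁻ x in cube a 0 x0, g x := by
      intro g
      rw [← lintegral_indicator (measurableSet_cube a 0 x0)]
      congr 1
      ext x
      by_cases hx : x ∈ cube a 0 x0
      · simp [hx]
      · simp [hx]
    rwa [e, e] at this

lemma cE_tendsto (hn : 1 ≤ n) {a : ℝ} (ha : 0 < a) {f : EE n → ℝ}
    (hl : LocallyIntegrable f volume) :
    ∀ᵐ x, Tendsto (fun k => cE a k f x) atTop (nhds (f x)) := by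
  filter_upwards [IsUnifLocDoublingMeasure.ae_tendsto_average_norm_sub (μ := (volume : Measure (EE n)))
    hl 1] with x hx
  have hn' : (0:ℝ) < n := by exact_mod_cast hn
  have hrad0 : Tendsto (fun k => (n:ℝ) * rad a k) atTop (nhdsWithin 0 (Ioi 0)) := by
    rw [tendsto_nhdsWithin_iff]
    constructor
    · have h1 : Tendsto (fun k : ℕ => (1/2:ℝ)^k) atTop (nhds 0) :=
        tendsto_pow_atTop_nhds_zero_of_lt_one (by norm_num) (by norm_num)
      have := (h1.const_mul a).const_mul (n:ℝ)
      simpa [rad] using this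
    · exact Eventually.of_forall fun k => mul_pos hn' (rad_pos ha k)
  have h := hx (fun _ => x) (fun k : ℕ => (n:ℝ) * rad a k) hrad0 (Eventually.of_forall fun k => by
    have := rad_pos ha k
    simp only [one_mul]
    exact Metric.mem_closedBall_self (by positivity))
  have h2 := h.const_mul ((n:ℝ)^n * vb n)
  rw [mul_zero] at h2
  rw [tendsto_iff_norm_sub_tendsto_zero]
  refine squeeze_zero (fun k => norm_nonneg _) (fun k => ?_) h2
  have hr := rad_pos ha k
  have hvt : volume (cube a k x) ≠ ⊤ := by rw [volume_cube ha]; exact ENNReal.ofReal_ne_top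
  have hv : (volume (cube a k x)).toReal = rad a k ^ n := by
    rw [volume_cube ha, ENNReal.toReal_ofReal (by positivity)]
  have hsub : cube a k x ⊆ Metric.closedBall x (n * rad a k) := by
    intro y hy
    rw [Metric.mem_closedBall, dist_eq_norm]
    exact norm_cube_le ha hy
  have hIB : IntegrableOn (fun y => f y - f x) (Metric.closedBall x (n * rad a k)) :=
    (hl.integrableOn_isCompact (isCompact_closedBall x _)).sub
      (integrableOn_const (isCompact_closedBall x _).measure_lt_top.ne)
  have e : rad a k ^ n * (cE a k f x - f x) = ∫ y in cube a k x, (f y - f x) := by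
    rw [integral_sub (integrableOn_cube ha k x hl) (integrableOn_const hvt), setIntegral_const,
      measureReal_def, hv, smul_eq_mul, mul_sub]
    congr 1
    rw [cE]
    field_simp
  have h3 : rad a k ^ n * ‖cE a k f x - f x‖ ≤ ∫ y in Metric.closedBall x (n * rad a k), ‖f y - f x‖ := by
    have e2 : rad a k ^ n * ‖cE a k f x - f x‖ = ‖∫ y in cube a k x, (f y - f x)‖ := by
      rw [← e, norm_mul, Real.norm_of_nonneg (by positivity : 0 ≤ rad a k ^ n)]
    rw [e2]
    refine (norm_integral_le_integral_norm _).trans ?_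
    exact setIntegral_mono_set hIB.norm (ae_of_all _ fun y => norm_nonneg _) (LE.le.eventuallyLE hsub)
  have hvb : (volume (Metric.closedBall x (n * rad a k))).toReal = rad a k ^ n * ((n:ℝ)^n * vb n) := by
    rw [vol_closedBall x (by positivity), ENNReal.toReal_ofReal
      (mul_nonneg (by positivity) (vb_nonneg n)), mul_pow]
    ring
  have hpos : 0 < (volume (Metric.closedBall x (n * rad a k))).toReal :=
    ENNReal.toReal_pos (Metric.measure_closedBall_pos volume x (by positivity)).ne'
      (isCompact_closedBall x _).measure_lt_top.ne
  rw [setAverage_eq, measureReal_def, smul_eq_mul]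
  set I := ∫ y in Metric.closedBall x (n * rad a k), ‖f y - f x‖
  rw [hvb] at hpos ⊢
  have hne : (n:ℝ)^n * vb n ≠ 0 := right_ne_zero_of_mul hpos.ne'
  have hrn : 0 < rad a k ^ n := by positivity
  have e4 : (n:ℝ)^n * vb n * ((rad a k ^ n * ((n:ℝ)^n * vb n))⁻¹ * I) = I / rad a k ^ n := by
    generalize (n:ℝ)^n * vb n = c at hne ⊢
    field_simp
  rw [e4, le_div_iff₀ hrn]
  linarith

lemma JN_cube (hn : 1 ≤ n) {f : EE n → ℝ} {M : ℝ} (hf : Measurable f)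
    (hl : LocallyIntegrable f volume) (hb : IsBMOWith f M) {a : ℝ} (ha : 0 < a) (x0 : EE n) :
    ∫⁻ x in cube a 0 x0, ‖f x‖ₑ ^ 2 ≠ ⊤ := by
  obtain ⟨M', hM', ho, hd⟩ := osc_cube hl hb ha
  have hM0 : (0:ℝ) < M' := by linarith
  set E0 := cE a 0 f x0 with hE0
  have hvt : volume (cube a 0 x0) ≠ ⊤ := by rw [volume_cube ha]; exact ENNReal.ofReal_ne_top
  have hpt : ∀ k, ∀ x ∈ cube a 0 x0, ‖cE a k f x - E0‖ₑ ^ 2 ≤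
      ENNReal.ofReal (64 * M') * ZZ a M' f k x := by
    intro k x hx
    set N := (anch (3*M') (fun j => cE a j f x) k).2 with hN
    have h1 := anch_dist (lam := 3*M') (M := M') (by linarith) (fun j => cE a j f x)
      (fun j => hd j x) k
    have h2 := (anch_close (lam := 3*M') (by linarith) (fun j => cE a j f x) k).le
    have e0 : cE a 0 f x = E0 := cE_LC a 0 f x x0 hx
    simp only [e0] at h1
    have h3 : |cE a k f x - E0| ≤ 4 * M' * (N + 1) := by
      have := abs_sub_le (cE a k f x) (anch (3*M') (fun j => cE a j f x) k).1 E0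
      linarith
    have h4 : ((N:ℝ)+1)^2 ≤ 4 * 2^N := by exact_mod_cast sq_le_two_pow N
    have h5 : (cE a k f x - E0)^2 ≤ (64 * M') * (2^N * M') := by
      rw [← sq_abs]
      calc |cE a k f x - E0|^2 ≤ (4 * M' * (N + 1))^2 := by gcongr
        _ = 16 * M'^2 * ((N:ℝ)+1)^2 := by ring
        _ ≤ 16 * M'^2 * (4 * 2^N) := by gcongr
        _ = _ := by ring
    rw [← enorm_pow, Real.enorm_eq_ofReal (sq_nonneg _)]
    refine (ENNReal.ofReal_le_ofReal h5).trans ?_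
    rw [ENNReal.ofReal_mul (by positivity)]
    refine mul_le_mul_right ?_ _
    rw [ENNReal.ofReal_mul (by positivity), ENNReal.ofReal_pow (by norm_num), ENNReal.ofReal_ofNat, ZZ]
    exact mul_le_mul_right le_self_add _
  have hk : ∀ k, ∫⁻ x in cube a 0 x0, ‖cE a k f x - E0‖ₑ ^ 2 ≤
      ENNReal.ofReal (64 * M') * (2 * ENNReal.ofReal (M' * rad a 0 ^ n)) := by
    intro k
    refine (setLIntegral_mono' (measurableSet_cube a 0 x0) (hpt k)).trans ?_
    rw [lintegral_const_mul' _ _ ENNReal.ofReal_ne_top]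
    exact mul_le_mul_right (ZZ_all ha hM' hf hl ho k x0) _
  have hF : ∫⁻ x in cube a 0 x0, ‖f x - E0‖ₑ ^ 2 ≤
      ENNReal.ofReal (64 * M') * (2 * ENNReal.ofReal (M' * rad a 0 ^ n)) := by
    have hlim : ∀ᵐ x ∂(volume.restrict (cube a 0 x0)),
        ‖f x - E0‖ₑ ^ 2 = liminf (fun k => ‖cE a k f x - E0‖ₑ ^ 2) atTop := by
      filter_upwards [ae_restrict_of_ae (cE_tendsto hn ha hl)] with x hx
      have : Tendsto (fun k => ‖cE a k f x - E0‖ₑ ^ 2) atTop (nhds (‖f x - E0‖ₑ ^ 2)) := by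
        have hc : Continuous (fun y : ℝ => ‖y - E0‖ₑ ^ 2) := by fun_prop
        exact (hc.tendsto (f x)).comp hx
      exact this.liminf_eq.symm
    rw [lintegral_congr_ae hlim]
    refine (lintegral_liminf_le fun k => ?_).trans ?_
    · have := cE_meas a k f
      fun_prop
    · refine (liminf_le_liminf (Eventually.of_forall hk)).trans ?_
      simp
  have hle : ∫⁻ x in cube a 0 x0, ‖f x‖ₑ ^ 2 ≤
      ∫⁻ x in cube a 0 x0, 2 * (‖f x - E0‖ₑ ^ 2 + ‖E0‖ₑ ^ 2) := by
    apply lintegral_mono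
    intro x
    simp only
    simp_rw [← enorm_pow, Real.enorm_eq_ofReal (sq_nonneg _)]
    rw [← ENNReal.ofReal_add (by positivity) (by positivity),
      show (2 : ℝ≥0∞) = ENNReal.ofReal 2 by simp, ← ENNReal.ofReal_mul (by norm_num)]
    apply ENNReal.ofReal_le_ofReal
    nlinarith [sq_nonneg (f x - 2 * E0)]
  refine ne_top_of_le_ne_top ?_ hle
  rw [lintegral_const_mul' _ _ (by norm_num), lintegral_add_right _ measurable_const, setLIntegral_const]
  refine ENNReal.mul_ne_top (by norm_num) (ENNReal.add_ne_top.mpr ⟨?_, ?_⟩)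
  · exact ne_top_of_le_ne_top (ENNReal.mul_ne_top ENNReal.ofReal_ne_top
      (ENNReal.mul_ne_top (by norm_num) ENNReal.ofReal_ne_top)) hF
  · exact ENNReal.mul_ne_top (ENNReal.pow_ne_top enorm_ne_top) hvt

lemma JN_ball (hn : 1 ≤ n) {f : EE n → ℝ} {M : ℝ} (hf : Measurable f)
    (hl : LocallyIntegrable f volume) (hb : IsBMOWith f M) {R : ℝ} (hR : 0 < R) :
    IsL2 ((Metric.ball (0 : EE n) R).indicator f) := by
  refine ⟨hf.indicator measurableSet_ball, ?_⟩
  have e : Sq ((Metric.ball (0 : EE n) R).indicator f) =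
      (volume.withDensity fun x => ‖f x‖ₑ ^ 2) (Metric.ball (0 : EE n) R) := by
    rw [withDensity_apply _ measurableSet_ball, ← lintegral_indicator measurableSet_ball, Sq]
    congr 1
    ext x
    by_cases hx : x ∈ Metric.ball (0 : EE n) R
    · rw [indicator_of_mem hx, indicator_of_mem hx]
    · rw [indicator_of_notMem hx, indicator_of_notMem hx]; simp
  rw [e]
  have hsub : Metric.ball (0 : EE n) R ⊆
      ⋃ z ∈ Icc (fun _ : Fin n => (-1 : ℤ)) (fun _ => 0), cidx R 0 ⁻¹' {z} := by
    intro y hy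
    rw [mem_iUnion₂]
    refine ⟨cidx R 0 y, ⟨fun i => ?_, fun i => ?_⟩, rfl⟩ <;>
    · have h1 := abs_coord_le y i
      rw [Metric.mem_ball, dist_zero_right] at hy
      have h2 := abs_lt.mp (h1.trans_lt hy)
      simp only [cidx, rad, pow_zero, mul_one]
      first
      | (rw [Int.le_floor, le_div_iff₀ hR]; push_cast; linarith)
      | (rw [← Int.lt_add_one_iff, Int.floor_lt, div_lt_iff₀ hR]; push_cast; linarith)
  refine ne_top_of_le_ne_top ?_ (measure_mono hsub)
  refine (measure_biUnion_lt_top (Set.finite_Icc _ _) fun z _ => ?_).ne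
  by_cases hz : ∃ x0 : EE n, cidx R 0 x0 = z
  · obtain ⟨x0, rfl⟩ := hz
    have h := JN_cube hn hf hl hb hR x0
    rw [← withDensity_apply _ (measurableSet_cube R 0 x0)] at h
    exact h.lt_top
  · have : (cidx R 0 ⁻¹' {z} : Set (EE n)) = ∅ := by
      ext y
      simp only [mem_preimage, mem_singleton_iff, mem_empty_iff_false, iff_false]
      exact fun hy => hz ⟨y, hy⟩
    rw [this]; simp

end VR

namespace VR
variable {n : ℕ}

lemma locInt_congr {f g : EE n → ℝ} (hf : LocallyIntegrable f volume) (h : f =ᵐ[volume] g) :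
    LocallyIntegrable g volume := by
  intro x
  obtain ⟨s, hs, hi⟩ := hf x
  exact ⟨s, hs, hi.congr (ae_restrict_of_ae h)⟩

lemma bmo_congr {f g : EE n → ℝ} {M : ℝ} (hf : IsBMOWith f M) (h : f =ᵐ[volume] g) :
    IsBMOWith g M := by
  intro x r hr
  have e : avgOn g (Metric.ball x r) = avgOn f (Metric.ball x r) := by
    unfold avgOn
    rw [integral_congr_ae (ae_restrict_of_ae h)]
  have e2 : ∫ y in Metric.ball x r, |g y - avgOn f (Metric.ball x r)| =
      ∫ y in Metric.ball x r, |f y - avgOn f (Metric.ball x r)| := by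
    apply integral_congr_ae
    filter_upwards [ae_restrict_of_ae h] with y hy
    rw [hy]
  rw [e, e2]
  exact hf x r hr

lemma truncRiesz_eq (ℓ : Fin n) {a : ℝ} (ha : 0 < a) (ε : ℝ) {f g : EE n → ℝ} {R : ℝ}
    (h : f =ᵐ[volume] g) {x : EE n} (hx : ‖x‖ < R) :
    truncRiesz n ℓ a ε f x = TT ℓ ε a ((Metric.ball (0 : EE n) (R + a)).indicator g) x := by
  unfold truncRiesz TT
  have hset : ({y : EE n | ε < ‖x - y‖ ∧ ‖x - y‖ < a} : Set (EE n)) =ᵐ[volume] Ann x ε a := by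
    have hs : volume (Metric.sphere x a) = 0 := Measure.addHaar_sphere_of_ne_zero volume x ha.ne'
    have : ∀ᵐ y : EE n, y ∉ Metric.sphere x a := measure_eq_zero_iff_ae_notMem.mp hs
    filter_upwards [this] with y hy
    have hne : ‖x - y‖ ≠ a := by
      intro h; apply hy; rw [Metric.mem_sphere, dist_comm, dist_eq_norm]; exact h
    apply propext
    change (ε < ‖x - y‖ ∧ ‖x - y‖ < a) ↔ (ε < ‖x - y‖ ∧ ‖x - y‖ ≤ a)
    constructor
    · rintro ⟨h1, h2⟩; exact ⟨h1, h2.le⟩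
    · rintro ⟨h1, h2⟩; exact ⟨h1, lt_of_le_of_ne h2 hne⟩
  rw [setIntegral_congr_set hset]
  apply setIntegral_congr_ae (measurableSet_Ann x ε a)
  filter_upwards [h] with y hy hyA
  have hyb : y ∈ Metric.ball (0 : EE n) (R + a) := by
    rw [Metric.mem_ball, dist_zero_right]
    have h1 : ‖y‖ ≤ ‖x‖ + ‖x - y‖ := by
      calc ‖y‖ = ‖x - (x - y)‖ := by congr 1; abel
        _ ≤ _ := norm_sub_le _ _
    have h2 := hyA.2
    linarith
  rw [indicator_of_mem hyb, hy]
  rfl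

theorem main (n : ℕ) (hn : 1 ≤ n) (ℓ : Fin n) (ρ : ℝ)
    (hρ : 2 < ρ) (a : ℝ) (ha : 0 < a) (f : EuclideanSpace ℝ (Fin n) → ℝ) (M : ℝ)
    (hfloc : LocallyIntegrable f volume) (hf : IsBMOWith f M) :
    ∀ᵐ x : EuclideanSpace ℝ (Fin n), eVar ρ (fun ε => truncRiesz n ℓ a ε f x) ≠ ⊤ := by
  have hsm := hfloc.aestronglyMeasurable
  set g := hsm.mk f
  have hfg : f =ᵐ[volume] g := hsm.ae_eq_mk
  have hgm : Measurable g := hsm.stronglyMeasurable_mk.measurable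
  have hgl := locInt_congr hfloc hfg
  have hgb := bmo_congr hf hfg
  have h : ∀ m : ℕ, ∀ᵐ x : EE n,
      eVar ρ (fun t => TT ℓ t a ((Metric.ball (0 : EE n) (m + a)).indicator g) x) ≠ ⊤ := fun m =>
    var_L2 hn ℓ ha (JN_ball hn hgm hgl hgb (by positivity)) hρ
  filter_upwards [ae_all_iff.mpr h] with x hx
  obtain ⟨m, hm⟩ := exists_nat_gt ‖x‖
  have e : (fun ε => truncRiesz n ℓ a ε f x) =
      fun t => TT ℓ t a ((Metric.ball (0 : EE n) (m + a)).indicator g) x := by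
    ext ε
    exact truncRiesz_eq ℓ ha ε hfg hm
  rw [e]
  exact hx m

end VR

/-- let `a > 0`, `ℓ ∈ {1,…,n}`, `ρ > 2` and `f ∈ BMO(ℝⁿ)` (with norm at
most `M`). Then the variation of the doubly truncated Riesz transforms is finite
almost everywhere: `V_ρ(R^ε_{ℓ,a})(f)(x) < ∞` for a.e. `x ∈ ℝⁿ`. -/
theorem variation_truncRiesz_ae_finite (n : ℕ) (hn : 1 ≤ n) (ℓ : Fin n) (ρ : ℝ)
    (hρ : 2 < ρ) (a : ℝ) (ha : 0 < a) (f : EuclideanSpace ℝ (Fin n) → ℝ) (M : ℝ)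
    (hfloc : LocallyIntegrable f volume) (hf : IsBMOWith f M) :
    ∀ᵐ x : EuclideanSpace ℝ (Fin n), eVar ρ (fun ε => truncRiesz n ℓ a ε f x) ≠ ⊤ := by
  exact VR.main n hn ℓ ρ hρ a ha f M hfloc hf

end
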